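/- Let Δ be a Bieberbach group, i.e., a group containing ℤ^n as a normal subgroup of finite index with C_Δ(ℤ^n) = ℤ^n (a finite effective extension of ℤ^n), and let A ≤ Aff(ℝ^n) be a Zariski-closed subgroup acting transitively on ℝ^n. Then the deformation space D_c(Δ, A) is homeomorphic to a semi-algebraic set, i.e., to a finite union of subsets of some ℝ^N each defined by finitely many polynomial equations and finitely many strict polynomial inequalities; in particular D_c(Δ, A) is a Hausdorff space. -/

import Mathlib

noncomputable section

/-- The orbit equivalence relation on `V` induced by a subgroup `G` of affine
transformations of `V`. -/
def affOrbitSetoid {V : Type*} [NormedAddCommGroup V] [NormedSpace ℝ V]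
    (G : Subgroup (V ≃ᵃ[ℝ] V)) : Setoid V where
  r x y := ∃ g ∈ G, g x = y
  iseqv := by
    refine ⟨fun x => ⟨1, G.one_mem, rfl⟩, ?_, ?_⟩
    · rintro x y ⟨g, hg, rfl⟩
      exact ⟨g⁻¹, G.inv_mem hg, g.symm_apply_apply x⟩
    · rintro x y z ⟨g, hg, rfl⟩ ⟨k, hk, rfl⟩
      exact ⟨k * g, G.mul_mem hk hg, rfl⟩

/-- A subgroup `G ≤ Aff(V)` is properly discontinuous if for every compact `K ⊆ V`
the set of `g ∈ G` with `gK ∩ K ≠ ∅` is finite. -/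
def ProperlyDiscontinuousAff {V : Type*} [NormedAddCommGroup V] [NormedSpace ℝ V]
    (G : Subgroup (V ≃ᵃ[ℝ] V)) : Prop :=
  ∀ K : Set V, IsCompact K → {g : V ≃ᵃ[ℝ] V | g ∈ G ∧ ((g '' K) ∩ K).Nonempty}.Finite

/-- A subgroup `G ≤ Aff(V)` is an affine crystallographic group if it acts properly
discontinuously on `V` and the orbit space `G \ V` is compact. -/
def IsCrystallographic {V : Type*} [NormedAddCommGroup V] [NormedSpace ℝ V]
    (G : Subgroup (V ≃ᵃ[ℝ] V)) : Prop :=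
  ProperlyDiscontinuousAff G ∧ CompactSpace (Quotient (affOrbitSetoid G))

/-- The image of an affine transformation `g : v ↦ Av + b` of `V` in `GL(V ⊕ ℝ)`,
as the linear endomorphism `(v, t) ↦ (Av + t • b, t)` of `V × ℝ`, corresponding to the
block matrix `(A b; 0 1)`. -/
def affToLin {V : Type*} [NormedAddCommGroup V] [NormedSpace ℝ V]
    (g : V ≃ᵃ[ℝ] V) : Module.End ℝ (V × ℝ) :=
  LinearMap.prod
    (((g.linear : V →ₗ[ℝ] V).comp (LinearMap.fst ℝ V ℝ)) +
      ((LinearMap.toSpanSingleton ℝ V (g 0)).comp (LinearMap.snd ℝ V ℝ)))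
    (LinearMap.snd ℝ V ℝ)

/-- The matrix of the image of an affine transformation in `GL(V ⊕ ℝ)`, with respect to a
fixed basis of `V × ℝ`. -/
def affEntry {V : Type*} [NormedAddCommGroup V] [NormedSpace ℝ V] [FiniteDimensional ℝ V]
    (g : V ≃ᵃ[ℝ] V) :
    Matrix (Fin (Module.finrank ℝ (V × ℝ))) (Fin (Module.finrank ℝ (V × ℝ))) ℝ :=
  LinearMap.toMatrix (Module.finBasis ℝ (V × ℝ)) (Module.finBasis ℝ (V × ℝ)) (affToLin g)

/-- A set of affine transformations is Zariski-closed if it is the intersection of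
`Aff(V)` with the common zero set of a family of real polynomial functions of the matrix
entries in `GL(V ⊕ ℝ)`. -/
def IsZariskiClosedAff {V : Type*} [NormedAddCommGroup V] [NormedSpace ℝ V]
    [FiniteDimensional ℝ V] (Z : Set (V ≃ᵃ[ℝ] V)) : Prop :=
  ∃ (ι : Type) (p : ι → MvPolynomial
      (Fin (Module.finrank ℝ (V × ℝ)) × Fin (Module.finrank ℝ (V × ℝ))) ℝ),
    ∀ g : V ≃ᵃ[ℝ] V,
      g ∈ Z ↔ ∀ i, MvPolynomial.eval (fun jk => affEntry g jk.1 jk.2) (p i) = 0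

/-- `Aff(V)` carries the topology of pointwise convergence on `V`. -/
instance affTopology {V : Type*} [NormedAddCommGroup V] [NormedSpace ℝ V] :
    TopologicalSpace (V ≃ᵃ[ℝ] V) :=
  TopologicalSpace.induced (fun g => (g : V → V)) Pi.topologicalSpace

/-- `Hom(Γ, Aff(V))` carries the topology of pointwise convergence. -/
instance homTopology {V : Type*} [NormedAddCommGroup V] [NormedSpace ℝ V]
    {Γ : Type*} [Group Γ] : TopologicalSpace (Γ →* (V ≃ᵃ[ℝ] V)) :=
  TopologicalSpace.induced (fun ρ => (ρ : Γ → (V ≃ᵃ[ℝ] V))) Pi.topologicalSpace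

/-- The set of crystallographic homomorphisms of `Γ` with image in the subgroup
`A ≤ Aff(V)`. -/
def homC {V : Type*} [NormedAddCommGroup V] [NormedSpace ℝ V]
    (A : Subgroup (V ≃ᵃ[ℝ] V)) (Γ : Type*) [Group Γ] : Set (Γ →* (V ≃ᵃ[ℝ] V)) :=
  {ρ | Function.Injective ρ ∧ (∀ γ : Γ, ρ γ ∈ A) ∧ IsCrystallographic ρ.range}

/-- The equivalence relation on `Hom_c(Γ, A)` given by conjugation by elements of `A`. -/
def conjSetoid {V : Type*} [NormedAddCommGroup V] [NormedSpace ℝ V]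
    (A : Subgroup (V ≃ᵃ[ℝ] V)) (Γ : Type*) [Group Γ] : Setoid ↥(homC A Γ) where
  r ρ ρ' := ∃ a ∈ A,
    ∀ γ : Γ, (ρ' : Γ →* (V ≃ᵃ[ℝ] V)) γ = a * (ρ : Γ →* (V ≃ᵃ[ℝ] V)) γ * a⁻¹
  iseqv := by
    refine ⟨fun ρ => ⟨1, A.one_mem, fun γ => by group⟩, ?_, ?_⟩
    · rintro ρ ρ' ⟨a, ha, h⟩
      exact ⟨a⁻¹, A.inv_mem ha, fun γ => by rw [h γ]; group⟩
    · rintro ρ ρ' ρ'' ⟨a, ha, h⟩ ⟨b, hb, h'⟩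
      exact ⟨b * a, A.mul_mem hb ha, fun γ => by rw [h' γ, h γ]; group⟩


/-- A basic semi-algebraic subset of `ℝ^N`: defined by finitely many polynomial equations
and finitely many strict polynomial inequalities. -/
def IsBasicSemialgebraic {N : ℕ} (S : Set (Fin N → ℝ)) : Prop :=
  ∃ (k l : ℕ) (p : Fin k → MvPolynomial (Fin N) ℝ) (q : Fin l → MvPolynomial (Fin N) ℝ),
    S = {x | (∀ i, MvPolynomial.eval x (p i) = 0) ∧ ∀ j, 0 < MvPolynomial.eval x (q j)}

/-- A semi-algebraic subset of `ℝ^N`: a finite union of basic semi-algebraic sets. -/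
def IsSemialgebraicSet {N : ℕ} (S : Set (Fin N → ℝ)) : Prop :=
  ∃ (m : ℕ) (T : Fin m → Set (Fin N → ℝ)),
    (∀ i, IsBasicSemialgebraic (T i)) ∧ S = ⋃ i, T i

section
noncomputable section
open Polynomial

def TSRel (C : Finset (ℝ × ℝ)) (t t' : ℝ) : Prop := ∀ c ∈ C, cmp c.1 t = cmp c.2 t'
def TSPI (C : Finset (ℝ × ℝ)) : Prop := ∀ a ∈ C, ∀ b ∈ C, cmp a.1 b.1 = cmp a.2 b.2
def TSMatch (C : Finset (ℝ × ℝ)) (p q : ℝ[X]) : Prop :=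
  ∀ t t', TSRel C t t' → SignType.sign (p.eval t) = SignType.sign (q.eval t')

def TSswap (C : Finset (ℝ × ℝ)) : Finset (ℝ × ℝ) := C.image Prod.swap
def TSneg (C : Finset (ℝ × ℝ)) : Finset (ℝ × ℝ) := C.image (fun c => (-c.1, -c.2))

lemma TSRel_swap {C : Finset (ℝ × ℝ)} {t t' : ℝ} : TSRel (TSswap C) t' t ↔ TSRel C t t' := by
  simp only [TSRel, TSswap, Finset.mem_image]
  constructor
  · intro h c hc
    exact (h c.swap ⟨c, hc, rfl⟩).symm
  · rintro h _ ⟨c, hc, rfl⟩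
    exact (h c hc).symm

lemma TSPI_swap {C : Finset (ℝ × ℝ)} (h : TSPI C) : TSPI (TSswap C) := by
  simp only [TSPI, TSswap, Finset.mem_image]
  rintro _ ⟨a, ha, rfl⟩ _ ⟨b, hb, rfl⟩
  exact (h a ha b hb).symm

lemma TSMatch_swap {C : Finset (ℝ × ℝ)} {p q : ℝ[X]} (h : TSMatch C p q) :
    TSMatch (TSswap C) q p := fun t t' ht => (h t' t (TSRel_swap.1 ht)).symm

lemma TS_cmp_neg (a b : ℝ) : cmp (-a) (-b) = (cmp a b).swap := by
  rw [cmp_swap]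
  rcases lt_trichotomy a b with h | h | h
  · rw [(cmp_eq_gt_iff _ _).2 (by linarith), (cmp_eq_gt_iff _ _).2 h]
  · subst h; simp
  · rw [(cmp_eq_lt_iff _ _).2 (by linarith), (cmp_eq_lt_iff _ _).2 h]

lemma TSRel_neg {C : Finset (ℝ × ℝ)} {t t' : ℝ} : TSRel (TSneg C) (-t) (-t') ↔ TSRel C t t' := by
  simp only [TSRel, TSneg, Finset.mem_image]
  constructor
  · intro h c hc
    have := h (-c.1, -c.2) ⟨c, hc, rfl⟩
    simp only [TS_cmp_neg] at this
    exact Ordering.swap_inj.1 this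
  · rintro h _ ⟨c, hc, rfl⟩
    simp only [TS_cmp_neg, h c hc]

lemma TSPI_neg {C : Finset (ℝ × ℝ)} (h : TSPI C) : TSPI (TSneg C) := by
  simp only [TSPI, TSneg, Finset.mem_image]
  rintro _ ⟨a, ha, rfl⟩ _ ⟨b, hb, rfl⟩
  simp only [TS_cmp_neg, h a ha b hb]

lemma TSMatch_neg {C : Finset (ℝ × ℝ)} {p q : ℝ[X]} (h : TSMatch C p q) :
    TSMatch C (-p) (-q) := by
  intro t t' ht
  simp only [eval_neg, Left.sign_neg, h t t' ht]

lemma TSRel.eq_iff {C : Finset (ℝ × ℝ)} {t t' : ℝ} (h : TSRel C t t') {c} (hc : c ∈ C) :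
    c.1 = t ↔ c.2 = t' := by
  rw [← cmp_eq_eq_iff c.1, ← cmp_eq_eq_iff c.2, h c hc]
lemma TSRel.lt_iff {C : Finset (ℝ × ℝ)} {t t' : ℝ} (h : TSRel C t t') {c} (hc : c ∈ C) :
    c.1 < t ↔ c.2 < t' := by
  rw [← cmp_eq_lt_iff, ← cmp_eq_lt_iff, h c hc]
lemma TSRel.gt_iff {C : Finset (ℝ × ℝ)} {t t' : ℝ} (h : TSRel C t t') {c} (hc : c ∈ C) :
    t < c.1 ↔ t' < c.2 := by
  rw [← cmp_eq_gt_iff, ← cmp_eq_gt_iff, h c hc]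

lemma TSRel_of {C : Finset (ℝ × ℝ)} {t t' : ℝ} (h1 : ∀ c ∈ C, c.1 < t → c.2 < t')
    (h2 : ∀ c ∈ C, c.1 = t → c.2 = t') (h3 : ∀ c ∈ C, t < c.1 → t' < c.2) : TSRel C t t' := by
  intro c hc
  rcases lt_trichotomy c.1 t with h | h | h
  · rw [(cmp_eq_lt_iff _ _).2 h, (cmp_eq_lt_iff _ _).2 (h1 c hc h)]
  · rw [(cmp_eq_eq_iff _ _).2 h, (cmp_eq_eq_iff _ _).2 (h2 c hc h)]
  · rw [(cmp_eq_gt_iff _ _).2 h, (cmp_eq_gt_iff _ _).2 (h3 c hc h)]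

/-- cells are convex -/
lemma TSRel_conv {C : Finset (ℝ × ℝ)} {t a b s : ℝ} (ha : TSRel C t a) (hb : TSRel C t b)
    (h1 : a ≤ s) (h2 : s ≤ b) : TSRel C t s := by
  apply TSRel_of
  · intro c hc h
    have := (ha.lt_iff hc).1 h; linarith
  · intro c hc h
    have := (ha.eq_iff hc).1 h
    have := (hb.eq_iff hc).1 h
    linarith
  · intro c hc h
    have := (hb.gt_iff hc).1 h; linarith

lemma TSRel_exists {C : Finset (ℝ × ℝ)} (hC : TSPI C) (t : ℝ) : ∃ t', TSRel C t t' := by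
  obtain ⟨b, hb⟩ := Order.PartialIso.exists_across (⟨C, hC⟩ : Order.PartialIso ℝ ℝ) t
  exact ⟨b, hb⟩

lemma TS_strictMonoOn {p : ℝ[X]} {a b : ℝ} (h : ∀ x ∈ Set.Ioo a b, 0 < (derivative p).eval x) :
    StrictMonoOn (fun x => p.eval x) (Set.Icc a b) := by
  apply strictMonoOn_of_deriv_pos (convex_Icc a b) p.continuous.continuousOn
  intro x hx
  rw [interior_Icc] at hx
  simpa using h x hx

lemma TS_K0 {C : Finset (ℝ × ℝ)} (hC : TSPI C) {p q : ℝ[X]}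
    (hd : TSMatch C (derivative p) (derivative q))
    (hpt : ∀ c ∈ C, SignType.sign (p.eval c.1) = SignType.sign (q.eval c.2))
    {t t' : ℝ} (ht : TSRel C t t') (hne : ∀ c ∈ C, c.1 ≠ t)
    (hdt : 0 < (derivative p).eval t) (h0 : 0 ≤ p.eval t) :
    ∃ s', TSRel C t s' ∧ 0 < q.eval s' := by
  have hdp : ∀ s, TSRel C s t' → 0 < (derivative p).eval s := by
    intro s hs
    have := (hd s t' hs).trans (hd t t' ht).symm
    rw [sign_pos hdt, sign_eq_one_iff] at this
    exact this
  have hdq : ∀ s, TSRel C t s → 0 < (derivative q).eval s := by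
    intro s hs
    have := hd t s hs
    rw [sign_pos hdt] at this
    exact sign_eq_one_iff.1 this.symm
  by_cases hU : ∃ c ∈ C, t < c.1
  · obtain ⟨c, hc, hmin⟩ := Finset.exists_min_image (C.filter (fun c => t < c.1)) Prod.fst
      (by obtain ⟨c, hc, h⟩ := hU; exact ⟨c, by simp [hc, h]⟩)
    rw [Finset.mem_filter] at hc
    have hmin' : ∀ b ∈ C, t < b.1 → c.1 ≤ b.1 := fun b hb h => hmin b (by simp [hb, h])
    have hpc : p.eval t < p.eval c.1 := by
      apply TS_strictMonoOn (p := p) (a := t) (b := c.1) _ (by simp [hc.2.le]) (by simp [hc.2.le]) hc.2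
      intro x hx
      apply hdp
      apply TSRel_of
      · intro b hb h
        by_cases h' : t < b.1
        · exact absurd (hmin' b hb h') (by have := hx.2; push Not; linarith)
        · exact (ht.lt_iff hb).1 (lt_of_le_of_ne (not_lt.1 h') (hne b hb))
      · intro b hb h
        have h1 : t < b.1 := h ▸ hx.1
        have := hmin' b hb h1
        have := hx.2
        linarith
      · intro b hb h
        exact (ht.gt_iff hb).1 (hx.1.trans h)
    have hqc : 0 < q.eval c.2 := by
      have := hpt c hc.1
      rw [sign_pos (h0.trans_lt hpc)] at this
      exact sign_eq_one_iff.1 this.symm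
    have htc : t' < c.2 := (ht.gt_iff hc.1).1 hc.2
    have hev : ∀ᶠ s in nhdsWithin c.2 (Set.Iio c.2), 0 < q.eval s :=
      (q.continuous.continuousAt.tendsto.mono_left nhdsWithin_le_nhds).eventually (lt_mem_nhds hqc)
    have hev2 : ∀ᶠ s in nhdsWithin c.2 (Set.Iio c.2), s ∈ Set.Ioo t' c.2 :=
      Ioo_mem_nhdsLT htc
    obtain ⟨s, hs1, hs2⟩ := (hev.and hev2).exists
    refine ⟨s, ?_, hs1⟩
    apply TSRel_of
    · intro b hb h
      exact ((ht.lt_iff hb).1 h).trans hs2.1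
    · intro b hb h
      exact absurd h (hne b hb)
    · intro b hb h
      have h1 := hmin' b hb h
      have h2 : c.2 ≤ b.2 := by
        have := hC c hc.1 b hb
        rcases h1.lt_or_eq with h1 | h1
        · rw [(cmp_eq_lt_iff _ _).2 h1] at this
          exact ((cmp_eq_lt_iff _ _).1 this.symm).le
        · rw [(cmp_eq_eq_iff _ _).2 h1] at this
          exact ((cmp_eq_eq_iff _ _).1 this.symm).le
      exact hs2.2.trans_le h2
  · push Not at hU
    have hR : ∀ s, t' ≤ s → TSRel C t s := by
      intro s hs
      apply TSRel_of
      · intro b hb h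
        exact ((ht.lt_iff hb).1 h).trans_le hs
      · intro b hb h
        exact absurd h (hne b hb)
      · intro b hb h
        exact absurd (hU b hb) (not_le.2 h)
    by_contra! hcon
    have hdeg : 0 < q.degree := by
      by_contra hdeg
      have := eq_C_of_degree_le_zero (not_lt.1 hdeg)
      have h2 := hdq t' ht
      rw [this] at h2
      simp at h2
    have hmono : ∀ s, t' ≤ s → q.eval t' ≤ q.eval s := by
      intro s hs
      apply (TS_strictMonoOn (p := q) (a := t') (b := s) _).monotoneOn (by simp [hs]) (by simp [hs]) hs
      intro x hx
      exact hdq x (hR x hx.1.le)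
    have habs := q.abs_tendsto_atTop hdeg
    have hev := (habs.eventually_gt_atTop (|q.eval t'|)).and (Filter.eventually_ge_atTop t')
    obtain ⟨s, hs1, hs2⟩ := hev.exists
    have h1 := hcon s (hR s hs2)
    have h2 := hmono s hs2
    rw [abs_of_nonpos h1, abs_of_nonpos (h2.trans h1)] at hs1
    linarith

lemma TS_K1 {C : Finset (ℝ × ℝ)} (hC : TSPI C) {p q : ℝ[X]}
    (hd : TSMatch C (derivative p) (derivative q))
    (hpt : ∀ c ∈ C, SignType.sign (p.eval c.1) = SignType.sign (q.eval c.2))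
    {t t' : ℝ} (ht : TSRel C t t') (hne : ∀ c ∈ C, c.1 ≠ t)
    (hdt : 0 < (derivative p).eval t) (h0 : p.eval t ≤ 0) :
    ∃ s', TSRel C t s' ∧ q.eval s' < 0 := by
  obtain ⟨s, hs1, hs2⟩ := TS_K0 (TSPI_neg hC) (p := -(p.comp (-X))) (q := -(q.comp (-X)))
    (t := -t) (t' := -t') (by
      intro a b hab
      have := hd (-a) (-b) (TSRel_neg.1 (by simpa using hab))
      simpa [derivative_comp] using this) (by
      simp only [TSneg, Finset.mem_image]
      rintro _ ⟨c, hc, rfl⟩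
      simpa [Left.sign_neg] using hpt c hc) (TSRel_neg.2 ht) (by
      simp only [TSneg, Finset.mem_image]
      rintro _ ⟨c, hc, rfl⟩
      simpa using hne c hc) (by simpa [derivative_comp] using hdt) (by simpa using h0)
  refine ⟨-s, TSRel_neg.1 (by simpa using hs1), by simpa using hs2⟩

lemma TS_K {C : Finset (ℝ × ℝ)} (hC : TSPI C) {p q : ℝ[X]}
    (hd : TSMatch C (derivative p) (derivative q))
    (hpt : ∀ c ∈ C, SignType.sign (p.eval c.1) = SignType.sign (q.eval c.2))
    {t : ℝ} (hne : ∀ c ∈ C, c.1 ≠ t)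
    (hdt : (derivative p).eval t ≠ 0) :
    (0 ≤ p.eval t → ∃ s', TSRel C t s' ∧ 0 < q.eval s') ∧
    (p.eval t ≤ 0 → ∃ s', TSRel C t s' ∧ q.eval s' < 0) := by
  obtain ⟨t', ht⟩ := TSRel_exists hC t
  rcases hdt.lt_or_gt with h | h
  · have hd' : TSMatch C (derivative (-p)) (derivative (-q)) := by
      simpa using TSMatch_neg hd
    have hpt' : ∀ c ∈ C, SignType.sign ((-p).eval c.1) = SignType.sign ((-q).eval c.2) := by
      intro c hc
      simpa [Left.sign_neg] using hpt c hc
    refine ⟨fun h0 => ?_, fun h0 => ?_⟩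
    · simpa using TS_K1 hC hd' hpt' ht hne (by simpa using h) (by simpa using h0)
    · simpa using TS_K0 hC hd' hpt' ht hne (by simpa using h) (by simpa using h0)
  · exact ⟨fun h0 => TS_K0 hC hd hpt ht hne h h0, fun h0 => TS_K1 hC hd hpt ht hne h h0⟩
end
end

section
noncomputable section
open Polynomial

lemma TS_root_mem {C : Finset (ℝ × ℝ)} (hC : TSPI C) {g g' : ℝ[X]} (hm : TSMatch C g g')
    (hg : g ≠ 0) {r : ℝ} (hr : g.eval r = 0) : ∃ c ∈ C, c.1 = r := by
  by_contra! hne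
  obtain ⟨r', hr'⟩ := TSRel_exists hC r
  have hev : ∀ᶠ s in nhds r, TSRel C s r' := by
    simp only [TSRel]
    rw [Filter.eventually_all_finset]
    intro c hc
    rw [← hr' c hc]
    rcases (hne c hc).lt_or_gt with h | h
    · filter_upwards [lt_mem_nhds h] with s hs
      rw [(cmp_eq_lt_iff _ _).2 h, (cmp_eq_lt_iff _ _).2 hs]
    · filter_upwards [gt_mem_nhds h] with s hs
      rw [(cmp_eq_gt_iff _ _).2 h, (cmp_eq_gt_iff _ _).2 hs]
  have hev2 : ∀ᶠ s in nhds r, g.IsRoot s := by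
    filter_upwards [hev] with s hs
    have := (hm s r' hs).trans (hm r r' hr').symm
    rw [hr, sign_zero, sign_eq_zero_iff] at this
    exact this
  exact hg (eq_zero_of_infinite_isRoot g (infinite_of_mem_nhds r hev2))

lemma TS_match_ne_zero {C : Finset (ℝ × ℝ)} (hC : TSPI C) {g g' : ℝ[X]} (hm : TSMatch C g g')
    (hg : g ≠ 0) : g' ≠ 0 := by
  rintro rfl
  apply hg
  apply Polynomial.funext
  intro r
  obtain ⟨r', hr'⟩ := TSRel_exists hC r
  have := hm r r' hr'
  simpa using this

lemma TS_ivt {C : Finset (ℝ × ℝ)} {q : ℝ[X]} {t a b : ℝ} (ha : TSRel C t a) (hb : TSRel C t b)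
    (h1 : q.eval a < 0) (h2 : 0 < q.eval b) :
    ∃ z, TSRel C t z ∧ q.eval z = 0 ∧ ((a < z ∧ z < b) ∨ (b < z ∧ z < a)) := by
  rcases le_total a b with hab | hab
  · obtain ⟨z, hz, hz0⟩ := intermediate_value_Icc hab (q.continuous.continuousOn)
      (show (0:ℝ) ∈ Set.Icc (q.eval a) (q.eval b) from ⟨h1.le, h2.le⟩)
    refine ⟨z, TSRel_conv ha hb hz.1 hz.2, hz0, Or.inl ⟨lt_of_le_of_ne hz.1 ?_, lt_of_le_of_ne hz.2 ?_⟩⟩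
    · rintro rfl; simp at hz0; linarith
    · rintro rfl; simp at hz0; linarith
  · obtain ⟨z, hz, hz0⟩ := intermediate_value_Icc' hab (q.continuous.continuousOn)
      (show (0:ℝ) ∈ Set.Icc (q.eval a) (q.eval b) from ⟨h1.le, h2.le⟩)
    refine ⟨z, TSRel_conv hb ha hz.1 hz.2, hz0, Or.inr ⟨lt_of_le_of_ne hz.1 ?_, lt_of_le_of_ne hz.2 ?_⟩⟩
    · rintro rfl; simp at hz0; linarith
    · rintro rfl; simp at hz0; linarith

/-- Rolle -/
lemma TS_rolle {p : ℝ[X]} {a b : ℝ} (hab : a < b) (ha : p.eval a = 0) (hb : p.eval b = 0) :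
    ∃ x ∈ Set.Ioo a b, (derivative p).eval x = 0 := by
  obtain ⟨c, hc, h⟩ := exists_deriv_eq_zero hab (p.continuous.continuousOn) (ha.trans hb.symm)
  exact ⟨c, hc, by simpa using h⟩

lemma TS_step {C : Finset (ℝ × ℝ)} (hC : TSPI C) {p q : ℝ[X]}
    (hd : TSMatch C (derivative p) (derivative q)) (hd0 : derivative p ≠ 0)
    (hpt : ∀ c ∈ C, SignType.sign (p.eval c.1) = SignType.sign (q.eval c.2)) :
    ∃ C' : Finset (ℝ × ℝ), C ⊆ C' ∧ TSPI C' ∧ TSMatch C' p q ∧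
      ∀ c ∈ C', c ∈ C ∨ p.eval c.1 = 0 := by
  classical
  have hp0 : p ≠ 0 := by rintro rfl; simp at hd0
  have hd0' := TS_match_ne_zero hC hd hd0
  have hCs := TSPI_swap hC
  have hds := TSMatch_swap hd
  have hpts : ∀ c ∈ TSswap C, SignType.sign (q.eval c.1) = SignType.sign (p.eval c.2) := by
    simp only [TSswap, Finset.mem_image]
    rintro _ ⟨c, hc, rfl⟩
    exact (hpt c hc).symm
  have hdne : ∀ t, (∀ c ∈ C, c.1 ≠ t) → (derivative p).eval t ≠ 0 := by
    intro t ht h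
    obtain ⟨c, hc, h'⟩ := TS_root_mem hC hd hd0 h
    exact ht c hc h'
  have hdnes : ∀ t, (∀ c ∈ TSswap C, c.1 ≠ t) → (derivative q).eval t ≠ 0 := by
    intro t ht h
    obtain ⟨c, hc, h'⟩ := TS_root_mem hCs hds hd0' h
    exact ht c hc h'
  have hnes : ∀ t t', TSRel C t t' → (∀ c ∈ C, c.1 ≠ t) → ∀ c ∈ TSswap C, c.1 ≠ t' := by
    intro t t' h h1
    simp only [TSswap, Finset.mem_image]
    rintro _ ⟨c, hc, rfl⟩ h2
    exact h1 c hc ((h.eq_iff hc).2 h2)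
  have hex : ∀ z, (∀ c ∈ C, c.1 ≠ z) → p.eval z = 0 → ∃ z', TSRel C z z' ∧ q.eval z' = 0 := by
    intro z hz h
    obtain ⟨h1, h2⟩ := TS_K hC hd hpt hz (hdne z hz)
    obtain ⟨a, ha, ha'⟩ := h1 h.ge
    obtain ⟨b, hb, hb'⟩ := h2 h.le
    obtain ⟨z', h3, h4, -⟩ := TS_ivt hb ha hb' ha'
    exact ⟨z', h3, h4⟩
  choose! zf hzf1 hzf2 using hex
  -- uniqueness of zeros of q in a cell
  have huniq : ∀ t a b, (∀ c ∈ C, c.1 ≠ t) → TSRel C t a → TSRel C t b → q.eval a = 0 →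
      q.eval b = 0 → ¬ a < b := by
    intro t a b ht ha hb ha0 hb0 hab
    obtain ⟨x, hx, hx0⟩ := TS_rolle hab ha0 hb0
    have hx' := TSRel_conv ha hb hx.1.le hx.2.le
    exact hdnes x (hnes t x hx' ht) hx0
  set Zs := p.roots.toFinset.filter (fun z => ∀ c ∈ C, c.1 ≠ z) with hZs
  have hZmem : ∀ z, z ∈ Zs ↔ p.eval z = 0 ∧ ∀ c ∈ C, c.1 ≠ z := by
    intro z
    simp [hZs, hp0]
  refine ⟨C ∪ Zs.image (fun z => (z, zf z)), Finset.subset_union_left, ?_, ?_, ?_⟩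
  · have hlt : ∀ z1 ∈ Zs, ∀ z2 ∈ Zs, z1 < z2 → zf z1 < zf z2 := by
      intro z1 h1 z2 h2 h12
      rw [hZmem] at h1 h2
      obtain ⟨x, hx, hx0⟩ := TS_rolle h12 h1.1 h2.1
      obtain ⟨c, hc, rfl⟩ := TS_root_mem hC hd hd0 hx0
      have e1 := ((hzf1 z1 h1.2 h1.1).gt_iff hc).1 hx.1
      have e2 := ((hzf1 z2 h2.2 h2.1).lt_iff hc).1 hx.2
      exact e1.trans e2
    intro a ha b hb
    rw [Finset.mem_union, Finset.mem_image] at ha hb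
    rcases ha with ha | ⟨z1, h1, rfl⟩ <;> rcases hb with hb | ⟨z2, h2, rfl⟩
    · exact hC a ha b hb
    · have h2' := (hZmem _).1 h2
      exact hzf1 z2 h2'.2 h2'.1 a ha
    · have h1' := (hZmem _).1 h1
      have := hzf1 z1 h1'.2 h1'.1 b hb
      rw [← cmp_swap, this, cmp_swap]
    · rcases lt_trichotomy z1 z2 with h | h | h
      · rw [(cmp_eq_lt_iff _ _).2 h, (cmp_eq_lt_iff _ _).2 (hlt z1 h1 z2 h2 h)]
      · subst h; simp
      · rw [(cmp_eq_gt_iff _ _).2 h, (cmp_eq_gt_iff _ _).2 (hlt z2 h2 z1 h1 h)]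
  · intro t t' htt
    have hCt : TSRel C t t' := fun c hc => htt c (Finset.mem_union_left _ hc)
    by_cases hn : ∃ c ∈ C, c.1 = t
    · obtain ⟨c, hc, rfl⟩ := hn
      rw [hpt c hc, (hCt.eq_iff hc).1 rfl]
    push Not at hn
    have hZt : ∀ z ∈ Zs, cmp z t = cmp (zf z) t' := fun z hz =>
      htt (z, zf z) (Finset.mem_union_right _ (Finset.mem_image_of_mem _ hz))
    have hns := hnes t t' hCt hn
    obtain ⟨k1, k2⟩ := TS_K hC hd hpt hn (hdne t hn)
    obtain ⟨l1, l2⟩ := TS_K hCs hds hpts hns (hdnes t' hns)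
    by_cases hpz : p.eval t = 0
    · have hz : t ∈ Zs := (hZmem t).2 ⟨hpz, hn⟩
      have := hZt t hz
      rw [cmp_self_eq_eq] at this
      have := (cmp_eq_eq_iff _ _).1 this.symm
      rw [hpz, ← this, hzf2 t hn hpz]
    have hzero : ∀ z, TSRel C z t' → p.eval z = 0 → z ∈ Zs := by
      intro z hz h0
      rw [hZmem]
      refine ⟨h0, ?_⟩
      rintro c hc rfl
      exact hns c.swap (Finset.mem_image_of_mem _ hc) ((hz.eq_iff hc).1 rfl)
    have hzz : ∀ z z', TSRel C z t' → p.eval z = 0 → TSRel C t z' → q.eval z' = 0 → zf z = z' := by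
      intro z z' h1 h2 h3 h4
      have h5 := (hZmem z).1 (hzero z h1 h2)
      have h6 := hzf1 z h5.2 h5.1
      have h7 := hzf2 z h5.2 h5.1
      have h8 : TSRel C t (zf z) := by
        intro c hc
        rw [hCt c hc, ← h1 c hc, h6 c hc]
      rcases lt_trichotomy (zf z) z' with h | h | h
      · exact absurd h (huniq t _ _ hn h8 h3 h7 h4)
      · exact h
      · exact absurd h (huniq t _ _ hn h3 h8 h4 h7)
    have hqz : q.eval t' ≠ 0 := by
      intro h0
      obtain ⟨a, ha, ha'⟩ := l1 h0.ge
      obtain ⟨b, hb, hb'⟩ := l2 h0.le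
      obtain ⟨z, h3, h4, -⟩ := TS_ivt hb ha hb' ha'
      have h5 := hzz z t' (TSRel_swap.1 h3) h4 hCt h0
      have h6 := hZt z (hzero z (TSRel_swap.1 h3) h4)
      rw [h5, cmp_self_eq_eq, cmp_eq_eq_iff] at h6
      rw [h6] at h4
      exact hpz h4
    -- signs on both cells
    have hdsg := hd t t' hCt
    have key : ∀ (P Q : ℝ[X]), (∀ s, TSRel C s t' → (derivative P).eval s ≠ 0) → True := by
      intros; trivial
    have hmonop : ∀ s1 s2, TSRel C s1 t' → TSRel C s2 t' → s1 < s2 →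
        (0 < (derivative p).eval t → p.eval s1 < p.eval s2) ∧
        ((derivative p).eval t < 0 → p.eval s2 < p.eval s1) := by
      intro s1 s2 h1 h2 h12
      have hcell : ∀ x ∈ Set.Ioo s1 s2, SignType.sign ((derivative p).eval x)
          = SignType.sign ((derivative p).eval t) := by
        intro x hx
        have := TSRel_conv (TSRel_swap.2 h1) (TSRel_swap.2 h2) hx.1.le hx.2.le
        rw [hd x t' (TSRel_swap.1 this), hdsg]
      constructor
      · intro h
        refine TS_strictMonoOn (p := p) (a := s1) (b := s2) ?_ (by simp [h12.le]) (by simp [h12.le]) h12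
        intro x hx
        have := hcell x hx
        rw [sign_pos h] at this
        exact sign_eq_one_iff.1 this
      · intro h
        have := TS_strictMonoOn (p := -p) (a := s1) (b := s2) ?_ (by simp [h12.le]) (by simp [h12.le]) h12
        · simpa using this
        intro x hx
        have := hcell x hx
        rw [sign_neg h] at this
        simpa using sign_eq_neg_one_iff.1 this
    have hmonoq : ∀ s1 s2, TSRel C t s1 → TSRel C t s2 → s1 < s2 →
        (0 < (derivative p).eval t → q.eval s1 < q.eval s2) ∧
        ((derivative p).eval t < 0 → q.eval s2 < q.eval s1) := by
      intro s1 s2 h1 h2 h12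
      have hcell : ∀ x ∈ Set.Ioo s1 s2, SignType.sign ((derivative q).eval x)
          = SignType.sign ((derivative p).eval t) := by
        intro x hx
        have := TSRel_conv h1 h2 hx.1.le hx.2.le
        rw [hd t x this]
      constructor
      · intro h
        refine TS_strictMonoOn (p := q) (a := s1) (b := s2) ?_ (by simp [h12.le]) (by simp [h12.le]) h12
        intro x hx
        have := hcell x hx
        rw [sign_pos h] at this
        exact sign_eq_one_iff.1 this
      · intro h
        have := TS_strictMonoOn (p := -q) (a := s1) (b := s2) ?_ (by simp [h12.le]) (by simp [h12.le]) h12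
        · simpa using this
        intro x hx
        have := hcell x hx
        rw [sign_neg h] at this
        simpa using sign_eq_neg_one_iff.1 this
    have htt' : TSRel C t t' := hCt
    have final : ∀ z z', TSRel C z t' → p.eval z = 0 → TSRel C t z' → q.eval z' = 0 →
        SignType.sign (p.eval t) = SignType.sign (q.eval t') := by
      intro z z' h1 h2 h3 h4
      have h5 := hzz z z' h1 h2 h3 h4
      have h6 := hZt z (hzero z h1 h2)
      rw [h5] at h6
      have hdt := hdne t hn
      rcases lt_trichotomy z t with h | h | h
      · have h' : z' < t' := by
          rw [(cmp_eq_lt_iff _ _).2 h] at h6; exact (cmp_eq_lt_iff _ _).1 h6.symm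
        have a1 := hmonop z t h1 hCt h
        have a2 := hmonoq z' t' h3 hCt h'
        rw [h2] at a1; rw [h4] at a2
        rcases hdt.lt_or_gt with hh | hh
        · rw [sign_neg (a1.2 hh), sign_neg (a2.2 hh)]
        · rw [sign_pos (a1.1 hh), sign_pos (a2.1 hh)]
      · rw [h] at h2; exact absurd h2 hpz
      · have h' : t' < z' := by
          rw [(cmp_eq_gt_iff _ _).2 h] at h6; exact (cmp_eq_gt_iff _ _).1 h6.symm
        have a1 := hmonop t z hCt h1 h
        have a2 := hmonoq t' z' hCt h3 h'
        rw [h2] at a1; rw [h4] at a2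
        rcases hdt.lt_or_gt with hh | hh
        · rw [sign_pos (a1.2 hh), sign_pos (a2.2 hh)]
        · rw [sign_neg (a1.1 hh), sign_neg (a2.1 hh)]
    rcases lt_or_gt_of_ne hpz with h | h <;> rcases lt_or_gt_of_ne hqz with h' | h'
    · rw [sign_neg h, sign_neg h']
    · obtain ⟨a, ha, ha'⟩ := k2 h.le
      obtain ⟨b, hb, hb'⟩ := l1 h'.le
      obtain ⟨z', e1, e2, -⟩ := TS_ivt ha hCt ha' h'
      obtain ⟨z, e3, e4, -⟩ := TS_ivt (TSRel_swap.2 hCt) hb h hb'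
      exact final z z' (TSRel_swap.1 e3) e4 e1 e2
    · obtain ⟨a, ha, ha'⟩ := k1 h.le
      obtain ⟨b, hb, hb'⟩ := l2 h'.le
      obtain ⟨z', e1, e2, -⟩ := TS_ivt hCt ha h' ha'
      obtain ⟨z, e3, e4, -⟩ := TS_ivt hb (TSRel_swap.2 hCt) hb' h
      exact final z z' (TSRel_swap.1 e3) e4 e1 e2
    · rw [sign_pos h, sign_pos h']
  · intro c hc
    rw [Finset.mem_union, Finset.mem_image] at hc
    rcases hc with hc | ⟨z, hz, rfl⟩
    · exact Or.inl hc
    · exact Or.inr ((hZmem z).1 hz).1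
end
end

section
noncomputable section
open Polynomial

lemma TS_restrict {C : Finset (ℝ × ℝ)} (hC : TSPI C) {J : Type*} (F : Set J) (f f' : J → ℝ[X])
    (hm : ∀ j ∈ F, TSMatch C (f j) (f' j)) :
    ∃ C0 ⊆ C, TSPI C0 ∧ (∀ j ∈ F, TSMatch C0 (f j) (f' j)) ∧
      ∀ c ∈ C0, ∃ j ∈ F, f j ≠ 0 ∧ (f j).eval c.1 = 0 := by
  classical
  set C0 := C.filter (fun c => ∃ j ∈ F, f j ≠ 0 ∧ (f j).eval c.1 = 0) with hC0
  have hsub : C0 ⊆ C := Finset.filter_subset _ _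
  refine ⟨C0, hsub, fun a ha b hb => hC a (hsub ha) b (hsub hb), ?_, ?_⟩
  · intro j hj t t' ht
    by_cases hex : ∃ c ∈ C0, c.1 = t
    · obtain ⟨c, hc, rfl⟩ := hex
      have h2 := (ht.eq_iff hc).1 rfl
      subst h2
      exact hm j hj _ _ (fun a ha => hC a ha c (hsub hc))
    · push Not at hex
      obtain ⟨t2, ht2⟩ := TSRel_exists hC t
      have ht20 : TSRel C0 t t2 := fun c hc => ht2 c (hsub hc)
      rw [hm j hj _ _ ht2]
      by_contra hne
      have hz : ∃ z, TSRel C0 t z ∧ (f' j).eval z = 0 ∧ f' j ≠ 0 := by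
        have hne0 : f' j ≠ 0 := by
          intro h0; rw [h0] at hne; simp at hne
        rcases lt_trichotomy ((f' j).eval t2) 0 with h1 | h1 | h1
        · rcases lt_trichotomy ((f' j).eval t') 0 with h2 | h2 | h2
          · rw [sign_neg h1, sign_neg h2] at hne; exact absurd rfl hne
          · exact ⟨t', ht, h2, hne0⟩
          · obtain ⟨z, a, b, _⟩ := TS_ivt ht20 ht h1 h2
            exact ⟨z, a, b, hne0⟩
        · exact ⟨t2, ht20, h1, hne0⟩
        · rcases lt_trichotomy ((f' j).eval t') 0 with h2 | h2 | h2
          · obtain ⟨z, a, b, _⟩ := TS_ivt ht ht20 h2 h1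
            exact ⟨z, a, b, hne0⟩
          · exact ⟨t', ht, h2, hne0⟩
          · rw [sign_pos h1, sign_pos h2] at hne; exact absurd rfl hne
      obtain ⟨z, hz1, hz2, hz3⟩ := hz
      obtain ⟨c, hc, hcz⟩ := TS_root_mem (TSPI_swap hC) (TSMatch_swap (hm j hj)) hz3 hz2
      simp only [TSswap, Finset.mem_image] at hc
      obtain ⟨a, ha, rfl⟩ := hc
      simp only [Prod.fst_swap] at hcz
      have hfa : (f j).eval a.1 = 0 := by
        have := hm j hj a.1 a.2 (fun b hb => hC b hb a ha)
        rw [hcz, hz2, sign_zero, sign_eq_zero_iff] at this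
        exact this
      have hf0 : f j ≠ 0 := TS_match_ne_zero (TSPI_swap hC) (TSMatch_swap (hm j hj)) hz3
      have haC0 : a ∈ C0 := by
        rw [hC0, Finset.mem_filter]; exact ⟨ha, j, hj, hf0, hfa⟩
      exact hex a haC0 ((hz1.eq_iff haC0).2 hcz)
  · intro c hc
    rw [hC0, Finset.mem_filter] at hc
    exact hc.2

lemma TS_pseudo {R : Type*} [CommRing R] (g : R[X]) (j : ℕ) (hg : g.natDegree ≤ j) :
    ∀ (m : ℕ) (p : R[X]), p.natDegree < m →
    ∃ (e : ℕ) (q r : R[X]), C (g.coeff j) ^ e * p = q * g + r ∧ r.degree < j := by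
  intro m
  induction m with
  | zero => intro p hp; omega
  | succ m ih =>
    intro p hp
    by_cases hd : p.degree < j
    · exact ⟨0, 0, p, by simp, hd⟩
    · rcases Nat.eq_zero_or_pos j with rfl | hj
      · refine ⟨1, p, 0, ?_, by simp⟩
        rw [eq_C_of_natDegree_le_zero hg]; simp; ring
      have hjp : j ≤ p.natDegree := by
        by_contra hlt
        push Not at hlt
        exact hd (lt_of_le_of_lt degree_le_natDegree (by exact_mod_cast hlt))
      set p1 := C (g.coeff j) * p - C p.leadingCoeff * X ^ (p.natDegree - j) * g with hp1
      have hdeg : p1.natDegree < m ∨ p1.natDegree < p.natDegree := by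
        right
        have : p1.natDegree ≤ p.natDegree - 1 := by
          rw [natDegree_le_iff_coeff_eq_zero]
          intro N hN
          rw [hp1, coeff_sub, coeff_C_mul, mul_assoc, coeff_C_mul, coeff_X_pow_mul',
            if_pos (by omega)]
          rcases Nat.lt_or_ge p.natDegree N with h | h
          · rw [coeff_eq_zero_of_natDegree_lt h,
              coeff_eq_zero_of_natDegree_lt (p := g) (n := N - (p.natDegree - j)) (by omega)]
            simp
          · have hN' : N = p.natDegree := by omega
            subst hN'
            rw [show p.natDegree - (p.natDegree - j) = j by omega, coeff_natDegree]
            ring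
        omega
      obtain ⟨e, q, r, h1, h2⟩ := ih p1 (by omega)
      refine ⟨e + 1, q + C (g.coeff j) ^ e * (C p.leadingCoeff * X ^ (p.natDegree - j)), r, ?_, h2⟩
      linear_combination h1 + C (g.coeff j) ^ e * hp1

lemma TS_pseudo2 {R : Type*} [CommRing R] (g : R[X]) (j : ℕ) (hg : g.natDegree ≤ j) (p : R[X]) :
    ∃ (e : ℕ) (q r : R[X]), C (g.coeff j) ^ (2 * e) * p = q * g + r ∧ r.degree < j := by
  obtain ⟨e, q, r, h1, h2⟩ := TS_pseudo g j hg _ p (Nat.lt_succ_self _)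
  refine ⟨e, C (g.coeff j) ^ e * q, C (g.coeff j) ^ e * r, ?_, ?_⟩
  · linear_combination C (g.coeff j) ^ e * h1
  · rw [degree_lt_iff_coeff_zero] at h2 ⊢
    intro m hm
    rw [← C_pow, coeff_C_mul, h2 m hm, mul_zero]

def TStrunc {R : Type*} [CommRing R] (g : R[X]) (j : ℕ) : R[X] :=
  ∑ i ∈ Finset.range (j + 1), monomial i (g.coeff i)

lemma TStrunc_coeff {R : Type*} [CommRing R] (g : R[X]) (j i : ℕ) :
    (TStrunc g j).coeff i = if i ≤ j then g.coeff i else 0 := by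
  simp only [TStrunc, finsetSum_coeff, coeff_monomial]
  simp

lemma TStrunc_natDegree {R : Type*} [CommRing R] (g : R[X]) (j : ℕ) :
    (TStrunc g j).natDegree ≤ j := by
  rw [natDegree_le_iff_coeff_eq_zero]
  intro N hN
  rw [TStrunc_coeff, if_neg (by omega)]

def TSOK {R X : Type*} [CommRing R] (ev : X → R →+* ℝ) (F : Set R[X]) : Prop :=
  ∃ Q : Set R, Q.Finite ∧ ∀ x x', (∀ q ∈ Q, SignType.sign (ev x q) = SignType.sign (ev x' q)) →
    ∃ C : Finset (ℝ × ℝ), TSPI C ∧ ∀ f ∈ F, TSMatch C (f.map (ev x)) (f.map (ev x'))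

lemma TSOK_step {R X : Type*} [CommRing R] (ev : X → R →+* ℝ) (k : ℕ) (hk : 0 < k)
    (p : R[X]) (hp : p.natDegree = k) (F : Set R[X]) (hF : F.Finite)
    (hFd : ∀ f ∈ F, f.natDegree ≤ k)
    (IH : ∀ L : Set R[X], L.Finite → (∀ f ∈ L, f.natDegree < k) → TSOK ev (F ∪ L)) :
    TSOK ev (insert p F) := by
  classical
  choose e q r h1 h2 using fun (g : R[X]) (j : ℕ) =>
    TS_pseudo2 (TStrunc g j) j (TStrunc_natDegree g j) p
  set H : Set R[X] := insert (derivative p) F with hH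
  have hHfin : H.Finite := hF.insert _
  have hHd : ∀ f ∈ H, f.natDegree ≤ k := by
    rintro f (rfl | hf)
    · exact (natDegree_derivative_le p).trans (by omega)
    · exact hFd f hf
  set rems : Set R[X] := Set.image2 r H (Set.Iic k) with hrems
  have hremsfin : rems.Finite := hHfin.image2 _ (Set.finite_Iic k)
  obtain ⟨Q, hQ, hQ2⟩ := IH (insert (derivative p) (insert p.eraseLead rems))
    ((hremsfin.insert _).insert _) (by
      rintro f (rfl | rfl | ⟨g, hg, j, hj, rfl⟩)
      · exact lt_of_lt_of_eq (natDegree_derivative_lt (by omega)) hp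
      · have := eraseLead_natDegree_le p
        omega
      · by_cases h0 : r g j = 0
        · rw [h0]; simpa using hk
        · have := (natDegree_lt_iff_degree_lt h0).2 (h2 g j)
          exact lt_of_lt_of_le this hj)
  refine ⟨Q ∪ Set.image2 (fun g i => g.coeff i) (insert p H) (Set.Iic k),
    hQ.union ((hHfin.insert _).image2 _ (Set.finite_Iic k)), fun x x' hxx => ?_⟩
  obtain ⟨C, hC, hm⟩ := hQ2 x x' (fun q hq => hxx q (Or.inl hq))
  have hcoef : ∀ g ∈ insert p H, ∀ i, SignType.sign (ev x (g.coeff i)) =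
      SignType.sign (ev x' (g.coeff i)) := by
    intro g hg i
    by_cases hi : i ≤ k
    · exact hxx _ (Or.inr ⟨g, hg, i, hi, rfl⟩)
    · have : g.natDegree ≤ k := by
        rcases hg with rfl | hg
        · exact hp.le
        · exact hHd g hg
      rw [coeff_eq_zero_of_natDegree_lt (by omega)]; simp
  have hmH : ∀ g ∈ H, TSMatch C (g.map (ev x)) (g.map (ev x')) := by
    rintro g (rfl | hg)
    · exact hm _ (Or.inr (Or.inl rfl))
    · exact hm _ (Or.inl hg)
  have hlc : SignType.sign (ev x (p.coeff k)) = SignType.sign (ev x' (p.coeff k)) :=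
    hcoef p (Or.inl rfl) k
  by_cases hlc0 : ev x (p.coeff k) = 0
  · refine ⟨C, hC, ?_⟩
    have hlc0' : ev x' (p.coeff k) = 0 := by
      rw [hlc0, sign_zero] at hlc
      exact sign_eq_zero_iff.1 hlc.symm
    rintro f (rfl | hf)
    · have key : ∀ y : X, ev y (f.coeff k) = 0 → f.map (ev y) = f.eraseLead.map (ev y) := by
        intro y hy
        conv_lhs => rw [← eraseLead_add_monomial_natDegree_leadingCoeff f]
        rw [Polynomial.map_add, map_monomial, leadingCoeff, hp, hy]
        simp
      rw [key x hlc0, key x' hlc0']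
      exact hm _ (Or.inr (Or.inr (Or.inl rfl)))
    · exact hm _ (Or.inl hf)
  · obtain ⟨C0, hC0, hC0PI, hC0m, hC0r⟩ := TS_restrict hC H (fun g => g.map (ev x))
      (fun g => g.map (ev x')) hmH
    have hd0 : derivative (p.map (ev x)) ≠ 0 := by
      intro h
      have h3 := congrArg (fun f => f.coeff (k - 1)) h
      simp only [coeff_derivative, coeff_map, coeff_zero] at h3
      rw [show k - 1 + 1 = k by omega] at h3
      rcases mul_eq_zero.1 h3 with h4 | h4
      · exact hlc0 h4
      · have : ((k - 1 : ℕ) : ℝ) + 1 > 0 := by positivity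
        linarith
    have hdm : TSMatch C0 (derivative (p.map (ev x))) (derivative (p.map (ev x'))) := by
      rw [derivative_map, derivative_map]
      exact hC0m _ (Or.inl rfl)
    obtain ⟨C', hsub, hPI, hmp, -⟩ := TS_step hC0PI hdm hd0 (by
      intro c hc
      obtain ⟨g, hg, hg0, hgc⟩ := hC0r c hc
      set j := (g.map (ev x)).natDegree with hj
      have hjk : j ≤ k := (natDegree_map_le).trans (hHd g hg)
      have htx : (TStrunc g j).map (ev x) = g.map (ev x) := by
        ext i
        rw [coeff_map, TStrunc_coeff, coeff_map]
        split_ifs with hi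
        · rfl
        · rw [map_zero, ← coeff_map, coeff_eq_zero_of_natDegree_lt (by omega)]
      have htx' : (TStrunc g j).map (ev x') = g.map (ev x') := by
        ext i
        rw [coeff_map, TStrunc_coeff, coeff_map]
        split_ifs with hi
        · rfl
        · have h5 := hcoef g (Or.inr hg) i
          rw [← coeff_map, coeff_eq_zero_of_natDegree_lt (p := map (ev x) g) (by omega),
            sign_zero] at h5
          rw [map_zero, sign_eq_zero_iff.1 h5.symm]
      have hg'c : (g.map (ev x')).eval c.2 = 0 := by
        have := hmH g hg c.1 c.2 (fun b hb => hC b hb c (hC0 hc))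
        rw [hgc, sign_zero] at this
        exact sign_eq_zero_iff.1 this.symm
      have hl : ev x (g.coeff j) ≠ 0 := by
        rw [← coeff_map, hj, coeff_natDegree]
        exact leadingCoeff_ne_zero.2 hg0
      have hl' : ev x' (g.coeff j) ≠ 0 := by
        intro h0
        have h5 := hcoef g (Or.inr hg) j
        rw [h0, sign_zero, sign_eq_zero_iff] at h5
        exact hl h5
      have key : ∀ (y : X) (t : ℝ), (TStrunc g j).map (ev y) = g.map (ev y) →
          (g.map (ev y)).eval t = 0 → ev y (g.coeff j) ≠ 0 →
          SignType.sign ((p.map (ev y)).eval t) = SignType.sign (((r g j).map (ev y)).eval t) := by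
        intro y t e1 e2 e3
        have h6 := congrArg (fun f => (f.map (ev y)).eval t) (h1 g j)
        simp only [Polynomial.map_mul, Polynomial.map_add, Polynomial.map_pow, map_C, eval_mul,
          eval_add, eval_pow, eval_C, e1, e2, mul_zero, zero_add, TStrunc_coeff, le_refl,
          if_true] at h6
        rw [← h6, sign_mul, sign_pos (a := (ev y) (g.coeff j) ^ (2 * e g j)), one_mul]
        rw [pow_mul]
        positivity
      rw [key x c.1 htx hgc hl, key x' c.2 htx' hg'c hl']
      exact hm _ (Or.inr (Or.inr (Or.inr ⟨g, hg, j, hjk, rfl⟩))) c.1 c.2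
        (fun b hb => hC b hb c (hC0 hc)))
    refine ⟨C', hPI, ?_⟩
    rintro f (rfl | hf)
    · exact hmp
    · intro t t' ht
      exact hC0m f (Or.inr hf) t t' (fun c hc => ht c (hsub hc))

lemma TSOK_mono {R X : Type*} [CommRing R] {ev : X → R →+* ℝ} {F G : Set R[X]} (h : F ⊆ G)
    (hG : TSOK ev G) : TSOK ev F := by
  obtain ⟨Q, hQ, h2⟩ := hG
  refine ⟨Q, hQ, fun x x' hx => ?_⟩
  obtain ⟨C, h3, h4⟩ := h2 x x' hx
  exact ⟨C, h3, fun f hf => h4 f (h hf)⟩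

theorem TSOK_all {R X : Type*} [CommRing R] (ev : X → R →+* ℝ) (k : ℕ) :
    ∀ F : Set R[X], F.Finite → (∀ f ∈ F, f.natDegree ≤ k) → TSOK ev F := by
  induction k with
  | zero =>
    intro F hF hd
    refine ⟨(fun f => f.coeff 0) '' F, hF.image _, fun x x' h => ⟨∅, by simp [TSPI], ?_⟩⟩
    intro f hf t t' _
    have := h _ ⟨f, hf, rfl⟩
    rw [eq_C_of_natDegree_le_zero (hd f hf)]
    simpa using this
  | succ k ih =>
    suffices H : ∀ F : Set R[X], F.Finite → (∀ f ∈ F, f.natDegree ≤ k + 1) →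
        ∀ L : Set R[X], L.Finite → (∀ f ∈ L, f.natDegree < k + 1) → TSOK ev (F ∪ L) by
      intro F hF hd
      simpa using H F hF hd ∅ Set.finite_empty (by simp)
    intro F hF
    induction F, hF using Set.Finite.induction_on with
    | empty =>
      intro _ L hL hLd
      rw [Set.empty_union]
      exact ih L hL (fun f hf => Nat.lt_succ_iff.1 (hLd f hf))
    | @insert p F hpF hF ih2 =>
      intro hd L hL hLd
      have hFd : ∀ f ∈ F, f.natDegree ≤ k + 1 := fun f hf => hd f (Or.inr hf)
      rcases (hd p (Or.inl rfl)).lt_or_eq with hlt | heq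
      · refine TSOK_mono ?_ (ih2 hFd (insert p L) (hL.insert _) ?_)
        · rintro f ((rfl | hf) | hf)
          · right; left; rfl
          · left; exact hf
          · right; right; exact hf
        · rintro f (rfl | hf)
          · exact hlt
          · exact hLd f hf
      · rw [Set.insert_union]
        refine TSOK_step ev (k + 1) (by omega) p heq (F ∪ L) (hF.union hL) ?_ ?_
        · rintro f (hf | hf)
          · exact hFd f hf
          · exact (hLd f hf).le
        · intro L' hL' hL'd
          rw [Set.union_assoc]
          refine ih2 hFd _ (hL.union hL') ?_
          rintro f (hf | hf)
          · exact hLd f hf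
          · exact hL'd f hf

end
end

section
noncomputable section
open Polynomial

/-- The algebra of polynomial functions on a real vector space. -/
def PolyAlg (W : Type*) [AddCommGroup W] [Module ℝ W] : Subalgebra ℝ (W → ℝ) :=
  Algebra.adjoin ℝ (Set.range (fun l : Module.Dual ℝ W => (l : W → ℝ)))

/-- Polynomial maps between real vector spaces. -/
def PolyMap {W W' : Type*} [AddCommGroup W] [Module ℝ W] [AddCommGroup W'] [Module ℝ W']
    (f : W → W') : Prop := ∀ l : Module.Dual ℝ W', (fun w => l (f w)) ∈ PolyAlg W

/-- Sets whose membership is determined by the signs of finitely many polynomial functions. -/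
def SAinv {W : Type*} [AddCommGroup W] [Module ℝ W] (S : Set W) : Prop :=
  ∃ Q : Set (W → ℝ), Q.Finite ∧ Q ⊆ PolyAlg W ∧
    ∀ x x', (∀ q ∈ Q, SignType.sign (q x) = SignType.sign (q x')) → x ∈ S → x' ∈ S

section
variable {W W' W'' U : Type*} [AddCommGroup W] [Module ℝ W] [AddCommGroup W'] [Module ℝ W']
  [AddCommGroup W''] [Module ℝ W''] [AddCommGroup U] [Module ℝ U]

lemma PolyAlg.dual (l : Module.Dual ℝ W) : (l : W → ℝ) ∈ PolyAlg W :=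
  Algebra.subset_adjoin ⟨l, rfl⟩
lemma PolyAlg.const (c : ℝ) : (fun _ : W => c) ∈ PolyAlg W := (PolyAlg W).algebraMap_mem c
lemma PolyAlg.mul {f g : W → ℝ} (hf : f ∈ PolyAlg W) (hg : g ∈ PolyAlg W) :
    (fun w => f w * g w) ∈ PolyAlg W := (PolyAlg W).mul_mem hf hg
lemma PolyAlg.add {f g : W → ℝ} (hf : f ∈ PolyAlg W) (hg : g ∈ PolyAlg W) :
    (fun w => f w + g w) ∈ PolyAlg W := (PolyAlg W).add_mem hf hg
lemma PolyAlg.induct {P : (f : W → ℝ) → f ∈ PolyAlg W → Prop}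
    (hl : ∀ l : Module.Dual ℝ W, P l (PolyAlg.dual l))
    (hc : ∀ c : ℝ, P (fun _ => c) (PolyAlg.const c))
    (ha : ∀ f g hf hg, P f hf → P g hg → P (fun w => f w + g w) (PolyAlg.add hf hg))
    (hm : ∀ f g hf hg, P f hf → P g hg → P (fun w => f w * g w) (PolyAlg.mul hf hg))
    {f : W → ℝ} (hf : f ∈ PolyAlg W) : P f hf := by
  refine Algebra.adjoin_induction (p := fun f h => P f h) ?_ ?_ ?_ ?_ hf
  · rintro _ ⟨l, rfl⟩; exact hl l
  · intro r; exact hc r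
  · intro f g _ _ h1 h2; exact ha f g _ _ h1 h2
  · intro f g _ _ h1 h2; exact hm f g _ _ h1 h2

lemma PolyAlg.sum {J : Type*} (s : Finset J) {f : J → W → ℝ} (hf : ∀ j ∈ s, f j ∈ PolyAlg W) :
    (fun w => ∑ j ∈ s, f j w) ∈ PolyAlg W := by
  have := (PolyAlg W).sum_mem hf
  convert this using 1
  ext w; simp

lemma PolyAlg.comp {f : W' → ℝ} (hf : f ∈ PolyAlg W') {g : W → W'} (hg : PolyMap g) :
    (fun w => f (g w)) ∈ PolyAlg W := by
  induction hf using PolyAlg.induct with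
  | hl l => exact hg l
  | hc c => exact PolyAlg.const c
  | ha f1 f2 _ _ h1 h2 => exact PolyAlg.add h1 h2
  | hm f1 f2 _ _ h1 h2 => exact PolyAlg.mul h1 h2

lemma polyMap_real {f : W → ℝ} : PolyMap f ↔ f ∈ PolyAlg W := by
  constructor
  · intro h; exact h LinearMap.id
  · intro h l
    have : (fun w => l (f w)) = fun w => f w * l 1 := by
      ext w
      rw [← smul_eq_mul, ← map_smul, smul_eq_mul, mul_one]
    rw [this]
    exact PolyAlg.mul h (PolyAlg.const _)

lemma PolyMap.comp {f : W' → W''} (hf : PolyMap f) {g : W → W'} (hg : PolyMap g) :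
    PolyMap (fun w => f (g w)) := fun l => PolyAlg.comp (hf l) hg
lemma PolyMap.lin (L : W →ₗ[ℝ] W') : PolyMap L := fun l => PolyAlg.dual (l ∘ₗ L)
lemma PolyMap.id : PolyMap (fun w : W => w) := fun l => PolyAlg.dual l
lemma PolyMap.linc (L : W' →ₗ[ℝ] W'') {f : W → W'} (hf : PolyMap f) : PolyMap (fun w => L (f w)) :=
  (PolyMap.lin L).comp hf
lemma PolyMap.const (c : W') : PolyMap (fun _ : W => c) := fun l => PolyAlg.const (l c)
lemma PolyMap.add {f g : W → W'} (hf : PolyMap f) (hg : PolyMap g) :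
    PolyMap (fun w => f w + g w) := fun l => by
  simp only [map_add]; exact PolyAlg.add (hf l) (hg l)
lemma PolyMap.smul {f : W → ℝ} {g : W → W'} (hf : PolyMap f) (hg : PolyMap g) :
    PolyMap (fun w => f w • g w) := fun l => by
  simp only [map_smul, smul_eq_mul]; exact PolyAlg.mul (polyMap_real.1 hf) (hg l)
lemma PolyMap.csmul (c : ℝ) {g : W → W'} (hg : PolyMap g) :
    PolyMap (fun w => c • g w) := (PolyMap.const c).smul hg
lemma PolyMap.sub {f g : W → W'} (hf : PolyMap f) (hg : PolyMap g) :
    PolyMap (fun w => f w - g w) := by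
  have := hf.add (hg.csmul (-1))
  simpa [sub_eq_add_neg] using this
lemma PolyMap.sum {J : Type*} (s : Finset J) {f : J → W → W'} (hf : ∀ j ∈ s, PolyMap (f j)) :
    PolyMap (fun w => ∑ j ∈ s, f j w) := fun l => by
  simp only [map_sum]; exact PolyAlg.sum s (fun j hj => hf j hj l)
lemma PolyMap.bilin [FiniteDimensional ℝ W'] (B : W' →ₗ[ℝ] W'' →ₗ[ℝ] U)
    {f : W → W'} {g : W → W''} (hf : PolyMap f) (hg : PolyMap g) :
    PolyMap (fun w => B (f w) (g w)) := by
  let b := Module.finBasis ℝ W'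
  have : (fun w => B (f w) (g w)) = fun w => ∑ i, (b.coord i (f w)) • B (b i) (g w) := by
    ext w
    conv_lhs => rw [← b.sum_repr (f w), map_sum, LinearMap.sum_apply]
    simp only [map_smul, LinearMap.smul_apply, Module.Basis.coord_apply]
  rw [this]
  exact PolyMap.sum _ fun i _ => (hf.linc (b.coord i)).smul (hg.linc (B (b i)))
lemma PolyMap.mul {A : Type*} [Ring A] [Algebra ℝ A] [FiniteDimensional ℝ A] {f g : W → A}
    (hf : PolyMap f) (hg : PolyMap g) : PolyMap (fun w => f w * g w) :=
  PolyMap.bilin (LinearMap.mul ℝ A) hf hg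
lemma PolyMap.pow {A : Type*} [Ring A] [Algebra ℝ A] [FiniteDimensional ℝ A] {f : W → A}
    (hf : PolyMap f) (k : ℕ) : PolyMap (fun w => f w ^ k) := by
  induction k with
  | zero => simpa using PolyMap.const (1 : A)
  | succ k ih => simpa [pow_succ] using ih.mul hf
lemma PolyMap.prodMk {f : W → W'} {g : W → W''} (hf : PolyMap f) (hg : PolyMap g) :
    PolyMap (fun w => (f w, g w)) := by
  have := (hf.linc (LinearMap.inl ℝ W' W'')).add (hg.linc (LinearMap.inr ℝ W' W''))
  simpa using this
lemma PolyMap.fst : PolyMap (Prod.fst : W × W' → W) := PolyMap.lin (LinearMap.fst ℝ W W')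
lemma PolyMap.snd : PolyMap (Prod.snd : W × W' → W') := PolyMap.lin (LinearMap.snd ℝ W W')
lemma PolyMap.pi {J : Type*} [Fintype J] {M : J → Type*} [∀ j, AddCommGroup (M j)]
    [∀ j, Module ℝ (M j)] {f : ∀ j, W → M j}
    (hf : ∀ j, PolyMap (f j)) : PolyMap (fun w j => f j w) := by
  classical
  have := PolyMap.sum Finset.univ (fun j _ => (hf j).linc (LinearMap.single ℝ M j))
  convert this using 1
  ext w j
  simp [Finset.sum_apply]
lemma PolyMap.apply {J : Type*} {M : J → Type*} [∀ j, AddCommGroup (M j)]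
    [∀ j, Module ℝ (M j)] {f : W → ∀ j, M j} (hf : PolyMap f) (j : J) : PolyMap (fun w => f w j) :=
  hf.linc (LinearMap.proj j)
lemma PolyMap.entry {a b : Type*} {f : W → Matrix a b ℝ} (hf : PolyMap f) (i : a) (j : b) :
    PolyMap (fun w => f w i j) := hf.linc (Matrix.entryLinearMap ℝ ℝ i j)
lemma PolyMap.matrix {a b : Type*} [Fintype a] [Fintype b] {f : W → Matrix a b ℝ}
    (hf : ∀ i j, PolyMap (fun w => f w i j)) : PolyMap f := by
  classical
  have : f = fun w => ∑ i, ∑ j, f w i j • Matrix.single i j (1 : ℝ) := by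
    ext1 w
    conv_lhs => rw [Matrix.matrix_eq_sum_single (f w)]
    simp
  rw [this]
  exact PolyMap.sum _ fun i _ => PolyMap.sum _ fun j _ => (hf i j).smul (PolyMap.const _)
lemma PolyMap.mmul {a b c : Type*} [Fintype a] [Fintype b] [Fintype c] {f : W → Matrix a b ℝ}
    {g : W → Matrix b c ℝ} (hf : PolyMap f) (hg : PolyMap g) : PolyMap (fun w => f w * g w) := by
  refine PolyMap.matrix fun i j => ?_
  simp only [Matrix.mul_apply]
  exact PolyMap.sum _ fun k _ => (hf.entry i k).smul (hg.entry k j)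
lemma PolyMap.transpose {a b : Type*} [Fintype a] [Fintype b] {f : W → Matrix a b ℝ}
    (hf : PolyMap f) : PolyMap (fun w => (f w).transpose) :=
  PolyMap.matrix fun i j => hf.entry j i
lemma PolyMap.mvPoly {σ : Type*} {f : W → σ → ℝ} (hf : ∀ i, PolyMap (fun w => f w i))
    (p : MvPolynomial σ ℝ) :
    PolyMap (fun w => MvPolynomial.eval (f w) p) := by
  induction p using MvPolynomial.induction_on with
  | C a => simpa using PolyMap.const a
  | add p q hp hq => simpa using hp.add hq
  | mul_X p i hp => simpa using hp.smul (hf i)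

/-! SAinv closure -/
lemma SAinv.inter {S T : Set W} (hS : SAinv S) (hT : SAinv T) : SAinv (S ∩ T) := by
  obtain ⟨Q, h1, h2, h3⟩ := hS
  obtain ⟨Q', h1', h2', h3'⟩ := hT
  exact ⟨Q ∪ Q', h1.union h1', Set.union_subset h2 h2', fun x x' h hx =>
    ⟨h3 x x' (fun q hq => h q (Or.inl hq)) hx.1, h3' x x' (fun q hq => h q (Or.inr hq)) hx.2⟩⟩

lemma SAinv.preimage {S : Set W'} (hS : SAinv S) {f : W → W'} (hf : PolyMap f) :
    SAinv (f ⁻¹' S) := by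
  obtain ⟨Q, h1, h2, h3⟩ := hS
  refine ⟨(fun q w => q (f w)) '' Q, h1.image _, ?_, ?_⟩
  · rintro _ ⟨q, hq, rfl⟩
    exact PolyAlg.comp (h2 hq) hf
  · intro x x' h hx
    exact h3 _ _ (fun q hq => h _ ⟨q, hq, rfl⟩) hx

/-- evaluation of polynomial functions -/
def PolyAlg.ev (w : W) : PolyAlg W →+* ℝ :=
  (Pi.evalRingHom (fun _ : W => ℝ) w).comp (PolyAlg W).val.toRingHom
lemma PolyAlg.ev_mk (w : W) (f : W → ℝ) (hf : f ∈ PolyAlg W) : PolyAlg.ev w ⟨f, hf⟩ = f w := rfl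

lemma polyAlg_prod_real {f : W × ℝ → ℝ} (hf : f ∈ PolyAlg (W × ℝ)) :
    ∃ F : (PolyAlg W)[X], ∀ w t,
      f (w, t) = (F.map (PolyAlg.ev w)).eval t := by
  induction hf using PolyAlg.induct with
  | hl l =>
    refine ⟨C ⟨_, PolyAlg.dual (l ∘ₗ LinearMap.inl ℝ W ℝ)⟩ + C ⟨_, PolyAlg.const (l (0, 1))⟩ * X,
      fun w t => ?_⟩
    have : ((w, t) : W × ℝ) = (w, 0) + t • (0, 1) := by simp
    rw [this, map_add, map_smul]
    rw [Polynomial.map_add, Polynomial.map_mul, map_C, map_C, map_X, eval_add, eval_mul, eval_C,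
      eval_C, eval_X, PolyAlg.ev_mk, PolyAlg.ev_mk, smul_eq_mul, mul_comm t]
    rfl
  | hc c => exact ⟨C ⟨_, PolyAlg.const c⟩, fun w t => by rw [map_C, eval_C, PolyAlg.ev_mk]⟩
  | ha f g _ _ hf hg =>
    obtain ⟨F, hF⟩ := hf
    obtain ⟨G, hG⟩ := hg
    exact ⟨F + G, fun w t => by simp only [hF, hG, Polynomial.map_add, eval_add]⟩
  | hm f g _ _ hf hg =>
    obtain ⟨F, hF⟩ := hf
    obtain ⟨G, hG⟩ := hg
    exact ⟨F * G, fun w t => by simp only [hF, hG, Polynomial.map_mul, eval_mul]⟩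

lemma SAinv.fst_real {S : Set (W × ℝ)} (hS : SAinv S) : SAinv (Prod.fst '' S) := by
  obtain ⟨Q, h1, h2, h3⟩ := hS
  choose! F hF using fun (f : W × ℝ → ℝ) (hf : f ∈ Q) => polyAlg_prod_real (h2 hf)
  have hfin : (F '' Q).Finite := h1.image F
  obtain ⟨k, hk⟩ := (hfin.image natDegree).bddAbove
  obtain ⟨Q', hQ', h4⟩ := TSOK_all (PolyAlg.ev (W := W)) k (F '' Q) hfin
    (fun f hf => hk ⟨f, hf, rfl⟩)
  refine ⟨Subtype.val '' Q', hQ'.image _, ?_, ?_⟩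
  · rintro _ ⟨q, _, rfl⟩; exact q.2
  · rintro x x' hxx ⟨⟨x0, t⟩, hS, hx0⟩
    obtain rfl : x0 = x := hx0
    obtain ⟨C, hC, hm⟩ := h4 x0 x' (fun q hq => hxx _ ⟨q, hq, rfl⟩)
    obtain ⟨t', ht'⟩ := TSRel_exists hC t
    refine ⟨(x', t'), h3 _ _ (fun q hq => ?_) hS, rfl⟩
    rw [hF q hq, hF q hq]
    exact hm _ ⟨q, hq, rfl⟩ t t' ht'

lemma SAinv.fst_fin (k : ℕ) : ∀ {S : Set (W × (Fin k → ℝ))}, SAinv S → SAinv (Prod.fst '' S) := by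
  induction k with
  | zero =>
    intro S hS
    have : Prod.fst '' S = (fun w => (w, 0)) ⁻¹' S := by
      ext w
      constructor
      · rintro ⟨⟨w, v⟩, h, rfl⟩
        rwa [Subsingleton.elim v 0] at h
      · intro h; exact ⟨_, h, rfl⟩
    rw [this]
    exact hS.preimage (PolyMap.id.prodMk (PolyMap.const _))
  | succ k ih =>
    intro S hS
    let f : (W × (Fin k → ℝ)) × ℝ → W × (Fin (k + 1) → ℝ) := fun w =>
      (w.1.1, fun j => Fin.cons (α := fun _ => ℝ) w.2 w.1.2 j)
    have hf : PolyMap f := by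
      refine (PolyMap.fst.comp PolyMap.fst).prodMk (PolyMap.pi (M := fun _ => ℝ)
        (f := fun j (w : (W × (Fin k → ℝ)) × ℝ) => Fin.cons (α := fun _ => ℝ) w.2 w.1.2 j) fun j => ?_)
      refine Fin.cases ?_ (fun j => ?_) j
      · simpa using PolyMap.snd
      · simpa using (PolyMap.snd.comp PolyMap.fst).apply j
    have := ih (hS.preimage hf).fst_real
    convert this using 1
    ext w
    constructor
    · rintro ⟨⟨w, v⟩, h, rfl⟩
      refine ⟨(w, Fin.tail v), ⟨((w, Fin.tail v), v 0), ?_, rfl⟩, rfl⟩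
      simpa [f] using h
    · rintro ⟨_, ⟨⟨⟨w, v⟩, t⟩, h, rfl⟩, rfl⟩
      exact ⟨_, h, rfl⟩

lemma SAinv.fst [FiniteDimensional ℝ W'] {S : Set (W × W')} (hS : SAinv S) :
    SAinv (Prod.fst '' S) := by
  let e := (Module.finBasis ℝ W').equivFun
  have h := hS.preimage (f := fun w : W × (Fin (Module.finrank ℝ W') → ℝ) => (w.1, e.symm w.2))
    (PolyMap.fst.prodMk (PolyMap.snd.linc e.symm.toLinearMap))
  convert h.fst_fin using 1
  ext w
  constructor
  · rintro ⟨⟨w, v⟩, h, rfl⟩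
    exact ⟨(w, e v), by simpa using h, rfl⟩
  · rintro ⟨⟨w, v⟩, h, rfl⟩
    exact ⟨_, h, rfl⟩

/-- projection form of Tarski–Seidenberg -/
lemma SAinv.exists [FiniteDimensional ℝ W'] {P : W → W' → Prop} (hS : SAinv {w : W × W' | P w.1 w.2}) :
    SAinv {w : W | ∃ v, P w v} := by
  convert hS.fst using 1
  ext w
  constructor
  · rintro ⟨v, h⟩; exact ⟨(w, v), h, rfl⟩
  · rintro ⟨⟨w, v⟩, h, rfl⟩; exact ⟨v, h⟩

instance polyAlg_noeth [FiniteDimensional ℝ W] : IsNoetherianRing (PolyAlg W) := by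
  classical
  have hfg : (PolyAlg W).FG := by
    let b := Module.finBasis ℝ W
    refine ⟨Finset.univ.image (fun i => (b.coord i : W → ℝ)), ?_⟩
    apply le_antisymm
    · apply Algebra.adjoin_le
      intro f hf
      simp only [Finset.coe_image, Finset.coe_univ, Set.image_univ] at hf
      obtain ⟨i, rfl⟩ := hf
      exact PolyAlg.dual _
    · apply Algebra.adjoin_le
      rintro _ ⟨l, rfl⟩
      have : (l : W → ℝ) = ∑ i, l (b i) • (b.coord i : W → ℝ) := by
        ext w
        conv_lhs => rw [← b.sum_repr w, map_sum]
        simp [Finset.sum_apply, mul_comm]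
      change (l : W → ℝ) ∈ _
      rw [this]
      refine Subalgebra.sum_mem _ fun i _ => Subalgebra.smul_mem _ (Algebra.subset_adjoin ?_) _
      simp
  have : Algebra.FiniteType ℝ (PolyAlg W) := Subalgebra.fg_iff_finiteType _ |>.1 hfg
  exact Algebra.FiniteType.isNoetherianRing ℝ _

/-- Hilbert basis theorem for families of polynomial functions. -/
lemma hilbert_family [FiniteDimensional ℝ W] {J : Type*} (f : J → W → ℝ)
    (hf : ∀ j, f j ∈ PolyAlg W) :
    ∃ s : Finset J, ∀ w, (∀ j ∈ s, f j w = 0) → ∀ j, f j w = 0 := by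
  classical
  let F : J → PolyAlg W := fun j => ⟨f j, hf j⟩
  obtain ⟨t, ht, hs⟩ := (Submodule.fg_span_iff_fg_span_finset_subset (Set.range F)).1
    (IsNoetherian.noetherian (Submodule.span (PolyAlg W) (Set.range F)))
  rcases isEmpty_or_nonempty J with hJ | hJ
  · exact ⟨∅, fun w _ j => hJ.elim j⟩
  choose! g hg using fun (x : PolyAlg W) (hx : x ∈ t) => ht hx
  refine ⟨t.image g, fun w hw j => ?_⟩
  have hmem : F j ∈ Submodule.span (PolyAlg W) (t : Set (PolyAlg W)) := by
    rw [← hs]; exact Submodule.subset_span ⟨j, rfl⟩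
  have : ∀ x ∈ Submodule.span (PolyAlg W) (t : Set (PolyAlg W)), x.1 w = 0 := by
    intro x hx
    induction hx using Submodule.span_induction with
    | mem x hx =>
      have := hw (g x) (Finset.mem_image_of_mem _ hx)
      rw [← hg x hx]; exact this
    | zero => rfl
    | add x y _ _ h1 h2 =>
      change x.1 w + y.1 w = 0
      rw [h1, h2, add_zero]
    | smul a x _ h =>
      change a.1 w * x.1 w = 0
      rw [h, mul_zero]
  exact this _ hmem

lemma SAinv.zeros [FiniteDimensional ℝ W] {J : Type*} (f : J → W → ℝ)
    (hf : ∀ j, PolyMap (f j)) : SAinv {w | ∀ j, f j w = 0} := by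
  obtain ⟨s, hs⟩ := hilbert_family f (fun j => polyMap_real.1 (hf j))
  refine ⟨f '' s, s.finite_toSet.image _, ?_, ?_⟩
  · rintro _ ⟨j, _, rfl⟩; exact polyMap_real.1 (hf j)
  · intro x x' h hx
    apply hs
    intro j hj
    have := h (f j) ⟨j, hj, rfl⟩
    rw [hx j, sign_zero] at this
    exact sign_eq_zero_iff.1 this.symm

lemma SAinv.forall_eq [FiniteDimensional ℝ W] {J : Type*} {M : J → Type*}
    [∀ j, AddCommGroup (M j)] [∀ j, Module ℝ (M j)] {f g : ∀ j, W → M j}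
    (hf : ∀ j, PolyMap (f j)) (hg : ∀ j, PolyMap (g j)) : SAinv {w | ∀ j, f j w = g j w} := by
  have := SAinv.zeros (J := Σ j, Module.Dual ℝ (M j)) (fun j w => j.2 (f j.1 w - g j.1 w))
    (fun j => ((hf _).sub (hg _)).linc j.2)
  convert this using 1
  ext w
  simp only [Set.mem_ofPred_eq, Sigma.forall]
  refine forall_congr' fun j => ?_
  rw [← sub_eq_zero]
  exact (Module.forall_dual_apply_eq_zero_iff ℝ _).symm

lemma SAinv.eq [FiniteDimensional ℝ W] {f g : W → W'} (hf : PolyMap f) (hg : PolyMap g) :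
    SAinv {w | f w = g w} := by
  have := SAinv.forall_eq (J := Unit) (f := fun _ => f) (g := fun _ => g) (fun _ => hf) (fun _ => hg)
  simpa using this

lemma PolyMap.cont [FiniteDimensional ℝ W] [TopologicalSpace W] [IsTopologicalAddGroup W]
    [ContinuousSMul ℝ W] [T2Space W] {f : W → ℝ} (hf : f ∈ PolyAlg W) : Continuous f := by
  induction hf using PolyAlg.induct with
  | hl l => exact l.continuous_of_finiteDimensional
  | hc c => exact continuous_const
  | ha f g _ _ hf hg => exact hf.add hg
  | hm f g _ _ hf hg => exact hf.mul hg

lemma polyAlg_mv {N : ℕ} {f : (Fin N → ℝ) → ℝ} (hf : f ∈ PolyAlg (Fin N → ℝ)) :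
    ∃ p : MvPolynomial (Fin N) ℝ, ∀ x, f x = MvPolynomial.eval x p := by
  induction hf using PolyAlg.induct with
  | hl l =>
    refine ⟨∑ i, MvPolynomial.C (l (Pi.single i 1)) * MvPolynomial.X i, fun x => ?_⟩
    simp only [map_sum, map_mul, MvPolynomial.eval_C, MvPolynomial.eval_X]
    conv_lhs => rw [← Finset.univ_sum_single x, map_sum]
    refine Finset.sum_congr rfl fun i _ => ?_
    rw [show (Pi.single i (x i) : Fin N → ℝ) = x i • Pi.single i 1 by
      rw [← Pi.single_smul, smul_eq_mul, mul_one], map_smul, smul_eq_mul, mul_comm]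
  | hc c => exact ⟨MvPolynomial.C c, fun x => by simp⟩
  | ha f g _ _ hf hg =>
    obtain ⟨p, hp⟩ := hf
    obtain ⟨q, hq⟩ := hg
    exact ⟨p + q, fun x => by simp only [hp, hq, map_add]⟩
  | hm f g _ _ hf hg =>
    obtain ⟨p, hp⟩ := hf
    obtain ⟨q, hq⟩ := hg
    exact ⟨p * q, fun x => by simp only [hp, hq, map_mul]⟩
end
end

section
noncomputable section
open Polynomial

lemma SAinv.semialg {N : ℕ} {S : Set (Fin N → ℝ)} (hS : SAinv S) : IsSemialgebraicSet S := by
  classical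
  obtain ⟨Q, hQ, hQP, h⟩ := hS
  choose! p hp using fun q (hq : q ∈ Q) => polyAlg_mv (hQP hq)
  have : Fintype Q := hQ.fintype
  let l := Fintype.card Q
  let eq : Fin l ≃ Q := (Fintype.equivFin Q).symm
  let P : Fin l → MvPolynomial (Fin N) ℝ := fun i => p (eq i)
  have hP : ∀ i x, MvPolynomial.eval x (P i) = (eq i : (Fin N → ℝ) → ℝ) x := fun i x =>
    (hp _ (eq i).2 x).symm
  let sg : (Fin N → ℝ) → (Fin l → SignType) := fun x i => SignType.sign (MvPolynomial.eval x (P i))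
  let I := {σ : Fin l → SignType // ∃ x ∈ S, sg x = σ}
  let m := Fintype.card I
  let em : Fin m ≃ I := (Fintype.equivFin I).symm
  refine ⟨m, fun j => {x | sg x = (em j).1}, fun j => ?_, ?_⟩
  · refine ⟨l, l, fun i => if (em j).1 i = 0 then P i else 0,
      fun i => if (em j).1 i = 0 then 1 else if (em j).1 i = 1 then P i else - P i, ?_⟩
    ext x
    simp only [Set.mem_ofPred_eq]
    rw [← forall_and, funext_iff]
    refine forall_congr' fun i => ?_
    change SignType.sign (MvPolynomial.eval x (P i)) = _ ↔ _
    generalize (em j).1 i = s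
    cases s
    · simp
    · simp [sign_eq_neg_one_iff]
    · simp [sign_eq_one_iff]
  · ext x
    simp only [Set.mem_iUnion, Set.mem_ofPred_eq]
    constructor
    · intro hx
      exact ⟨em.symm ⟨sg x, x, hx, rfl⟩, by simp⟩
    · rintro ⟨j, hj⟩
      obtain ⟨y, hy, hyj⟩ := (em j).2
      refine h y x (fun q hq => ?_) hy
      have h1 := congrFun (hyj.trans hj.symm) (eq.symm ⟨q, hq⟩)
      simp only [sg, hP] at h1
      simpa using h1

lemma locClosed_union {X : Type*} [TopologicalSpace X] {J : Type*} (s : Finset J) (T : J → Set X)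
    (hT : ∀ j ∈ s, IsLocallyClosed (T j)) (hne : (⋃ j ∈ s, T j).Nonempty) :
    ∃ U F : Set X, IsOpen U ∧ IsClosed F ∧ (U ∩ ⋃ j ∈ s, T j).Nonempty ∧
      U ∩ (⋃ j ∈ s, T j) = U ∩ F := by
  classical
  induction s using Finset.induction_on with
  | empty => simp at hne
  | insert a s ha ih =>
    rw [Finset.set_biUnion_insert] at hne ⊢
    obtain ⟨V, F, hV, hF, hVF⟩ := hT a (Finset.mem_insert_self _ _)
    by_cases hO : (⋃ j ∈ s, T j).Nonempty
    · obtain ⟨U, F', hU, hF', hUne, hUe⟩ := ih (fun j hj => hT j (Finset.mem_insert_of_mem hj)) hO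
      by_cases hcl : U ∩ (⋃ j ∈ s, T j) ⊆ closure (T a)
      · obtain ⟨x, hx⟩ := hUne
        obtain ⟨y, hyU, hyT⟩ := mem_closure_iff.1 (hcl hx) U hU hx.1
        refine ⟨U ∩ V, F ∪ F', hU.inter hV, hF.union hF', ⟨y, ⟨hyU, ?_⟩, Or.inl hyT⟩, ?_⟩
        · rw [hVF] at hyT; exact hyT.1
        · rw [Set.inter_union_distrib_left, Set.inter_union_distrib_left]
          congr 1
          · rw [hVF]; ext z; simp only [Set.mem_inter_iff]; tauto
          · rw [Set.inter_assoc, Set.inter_left_comm, hUe, Set.inter_assoc,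
              Set.inter_left_comm]
      · obtain ⟨x, hx, hxn⟩ := Set.not_subset.1 hcl
        refine ⟨U ∩ (closure (T a))ᶜ, F', hU.inter isClosed_closure.isOpen_compl, hF',
          ⟨x, ⟨hx.1, hxn⟩, Or.inr hx.2⟩, ?_⟩
        have : (U ∩ (closure (T a))ᶜ) ∩ T a = ∅ := by
          ext z; simp only [Set.mem_inter_iff, Set.mem_compl_iff, Set.mem_empty_iff_false, iff_false]
          rintro ⟨⟨_, h1⟩, h2⟩
          exact h1 (subset_closure h2)
        rw [Set.inter_union_distrib_left, this, Set.empty_union,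
          Set.inter_comm U, Set.inter_assoc, hUe, Set.inter_assoc]
    · rw [Set.not_nonempty_iff_eq_empty] at hO
      rw [hO, Set.union_empty] at hne ⊢
      refine ⟨V, F, hV, hF, ?_, ?_⟩
      · rw [hVF] at hne ⊢; rwa [← Set.inter_assoc, Set.inter_self]
      · rw [hVF]; simp

lemma SAinv.locClosed {W : Type*} [AddCommGroup W] [Module ℝ W] [FiniteDimensional ℝ W]
    [TopologicalSpace W] [IsTopologicalAddGroup W]
    [ContinuousSMul ℝ W] [T2Space W] {S : Set W} (hS : SAinv S) (hne : S.Nonempty) :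
    ∃ U F : Set W, IsOpen U ∧ IsClosed F ∧ (U ∩ S).Nonempty ∧ U ∩ S = U ∩ F := by
  classical
  obtain ⟨Q, hQ, hQP, h⟩ := hS
  have : Fintype Q := hQ.fintype
  let sg : W → (Q → SignType) := fun x q => SignType.sign (q.1 x)
  let T : (Q → SignType) → Set W := fun σ => {x | sg x = σ}
  have hT : ∀ σ, IsLocallyClosed (T σ) := by
    intro σ
    have : T σ = ⋂ q : Q, {x | SignType.sign (q.1 x) = σ q} := by
      ext x
      simp only [T, sg, Set.mem_ofPred_eq, Set.mem_iInter]
      exact funext_iff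
    rw [this]
    have hq : ∀ q : Q, IsLocallyClosed {x | SignType.sign (q.1 x) = σ q} := by
      intro q
      have hc : Continuous q.1 := PolyMap.cont (hQP q.2)
      generalize σ q = t
      cases t
      · refine IsClosed.isLocallyClosed ?_
        have : {x | SignType.sign (q.1 x) = SignType.zero} = {x | q.1 x = 0} := by
          ext x; exact sign_eq_zero_iff
        rw [this]; exact isClosed_eq hc continuous_const
      · refine IsOpen.isLocallyClosed ?_
        have : {x | SignType.sign (q.1 x) = SignType.neg} = {x | q.1 x < 0} := by
          ext x; exact sign_eq_neg_one_iff
        rw [this]; exact isOpen_lt hc continuous_const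
      · refine IsOpen.isLocallyClosed ?_
        have : {x | SignType.sign (q.1 x) = SignType.pos} = {x | 0 < q.1 x} := by
          ext x; exact sign_eq_one_iff
        rw [this]; exact isOpen_lt continuous_const hc
    choose U F hU hF hUF using hq
    refine ⟨⋂ q, U q, ⋂ q, F q, isOpen_iInter_of_finite hU, isClosed_iInter hF, ?_⟩
    simp only [hUF]
    rw [Set.iInter_inter_distrib]
  let s := Finset.univ.filter (fun σ => ∃ x ∈ S, sg x = σ)
  have hSU : S = ⋃ σ ∈ s, T σ := by
    ext x
    simp only [s, T, Finset.mem_filter, Finset.mem_univ, true_and, Set.mem_iUnion,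
      Set.mem_ofPred_eq, exists_prop]
    constructor
    · intro hx; exact ⟨sg x, ⟨x, hx, rfl⟩, rfl⟩
    · rintro ⟨σ, ⟨y, hy, hyσ⟩, hxσ⟩
      refine h y x (fun q hq => ?_) hy
      exact congrFun (hyσ.trans hxσ.symm) ⟨q, hq⟩
  have := locClosed_union s T (fun σ _ => hT σ) (hSU ▸ hne)
  rwa [← hSU] at this

lemma isOpenMap_of_locClosed {G W : Type*} [TopologicalSpace G] [Group G] [IsTopologicalGroup G]
    [SigmaCompactSpace G] [TopologicalSpace W] [T2Space W] [LocallyCompactSpace W]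
    (f : G → W) (r : G → W → W)
    (hr : ∀ g θ, r g (f θ) = f (θ * g⁻¹))
    (hcont : ContinuousOn (fun p : G × W => r p.1 p.2) (Set.univ ×ˢ Set.range f))
    (hlc : ∃ U F : Set W, IsOpen U ∧ IsClosed F ∧ (U ∩ Set.range f).Nonempty ∧
      U ∩ Set.range f = U ∩ F) :
    IsOpenMap (Set.rangeFactorization f) := by
  let act : MulAction G (Set.range f) :=
    { smul := fun g x => ⟨r g x, by
        obtain ⟨_, θ, rfl⟩ := x
        exact ⟨θ * g⁻¹, (hr g θ).symm⟩⟩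
      one_smul := by
        rintro ⟨_, θ, rfl⟩
        apply Subtype.ext
        change r 1 (f θ) = f θ
        rw [hr]; simp
      mul_smul := by
        rintro g h ⟨_, θ, rfl⟩
        apply Subtype.ext
        change r (g * h) (f θ) = r g (r h (f θ))
        rw [hr, hr, hr, mul_inv_rev, mul_assoc] }
  have hsm : ∀ (g : G) (x : Set.range f), ((g • x : Set.range f) : W) = r g x := fun _ _ => rfl
  have hcs : ContinuousSMul G (Set.range f) := by
    constructor
    apply Continuous.subtype_mk
    have h1 : Continuous (fun p : G × Set.range f => ((p.1, (p.2 : W)) : G × W)) := by fun_prop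
    exact hcont.comp_continuous h1 (fun p => ⟨trivial, p.2.2⟩)
  have htr : MulAction.IsPretransitive G (Set.range f) := by
    constructor
    rintro ⟨_, θ, rfl⟩ ⟨_, η, rfl⟩
    refine ⟨η⁻¹ * θ, Subtype.ext ?_⟩
    rw [hsm, hr]
    simp
  have hwlc : WeaklyLocallyCompactSpace (Set.range f) := by
    obtain ⟨U, F, hU, hF, ⟨x, hxU, hxf⟩, hUF⟩ := hlc
    have hloc : IsLocallyClosed (U ∩ Set.range f) := by
      rw [hUF]; exact ⟨U, F, hU, hF, rfl⟩
    have hlcs : LocallyCompactSpace ↥(U ∩ Set.range f) := hloc.locallyCompactSpace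
    -- a compact neighbourhood of x
    have hK : ∃ K : Set (Set.range f), IsCompact K ∧ K ∈ nhds (⟨x, hxf⟩ : Set.range f) := by
      let i : ↥(U ∩ Set.range f) → Set.range f := fun y => ⟨y.1, y.2.2⟩
      have hi : Topology.IsOpenEmbedding i := by
        refine ⟨Topology.IsEmbedding.of_comp (g := Subtype.val) ?_ continuous_subtype_val
          Topology.IsEmbedding.subtypeVal, ?_⟩
        · fun_prop
        · have : Set.range i = (Subtype.val : Set.range f → W) ⁻¹' U := by
            ext z
            constructor
            · rintro ⟨y, rfl⟩; exact y.2.1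
            · intro hz; exact ⟨⟨z.1, hz, z.2⟩, rfl⟩
          rw [this]; exact hU.preimage continuous_subtype_val
      obtain ⟨K, hK, hKn⟩ := exists_compact_mem_nhds (⟨x, hxU, hxf⟩ : ↥(U ∩ Set.range f))
      exact ⟨i '' K, hK.image hi.continuous, hi.isOpenMap.image_mem_nhds hKn⟩
    obtain ⟨K, hKc, hKn⟩ := hK
    constructor
    intro y
    obtain ⟨g, hg⟩ := htr.exists_smul_eq ⟨x, hxf⟩ y
    refine ⟨(Homeomorph.smul g) '' K, hKc.image (Homeomorph.smul g).continuous, ?_⟩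
    rw [← hg]
    exact (Homeomorph.smul g).isOpenMap.image_mem_nhds hKn
  have hO := isOpenMap_smul_of_sigmaCompact (G := G) (X := Set.range f) ⟨f 1, 1, rfl⟩
  have : Set.rangeFactorization f = (fun g : G => g • (⟨f 1, 1, rfl⟩ : Set.range f)) ∘
      (Homeomorph.inv G) := by
    ext θ
    change f θ = r (θ⁻¹) (f 1)
    rw [hr]; simp
  rw [this]
  exact hO.comp (Homeomorph.inv G).isOpenMap

end
end

section
noncomputable section
open scoped TensorProduct

lemma polyAlg_coeff {d : ℕ} {P : Matrix (Fin d) (Fin d) ℝ → ℝ}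
    (hP : P ∈ PolyAlg (Matrix (Fin d) (Fin d) ℝ)) :
    ∃ (B : Type) (_ : Ring B) (_ : Algebra ℝ B) (_ : FiniteDimensional ℝ B)
      (m : Matrix (Fin d) (Fin d) ℝ →* B) (l : Module.Dual ℝ B), PolyMap m ∧ ∀ X, P X = l (m X) := by
  induction hP using PolyAlg.induct with
  | hl l => exact ⟨Matrix (Fin d) (Fin d) ℝ, inferInstance, inferInstance, inferInstance,
      MonoidHom.id _, l, PolyMap.id, fun X => rfl⟩
  | hc c => exact ⟨ℝ, inferInstance, inferInstance, inferInstance, 1, c • LinearMap.id,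
      PolyMap.const 1, fun X => by simp⟩
  | ha f g _ _ hf hg =>
    obtain ⟨B1, _, _, _, m1, l1, h1, h1'⟩ := hf
    obtain ⟨B2, _, _, _, m2, l2, h2, h2'⟩ := hg
    refine ⟨B1 × B2, inferInstance, inferInstance, inferInstance, m1.prod m2,
      l1.coprod l2, h1.prodMk h2, fun X => ?_⟩
    simp [h1', h2']
  | hm f g _ _ hf hg =>
    obtain ⟨B1, _, _, _, m1, l1, h1, h1'⟩ := hf
    obtain ⟨B2, _, _, _, m2, l2, h2, h2'⟩ := hg
    refine ⟨B1 ⊗[ℝ] B2, inferInstance, inferInstance, inferInstance,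
      { toFun := fun X => m1 X ⊗ₜ m2 X
        map_one' := by simp [Algebra.TensorProduct.one_def]
        map_mul' := by intro X Y; simp },
      (LinearMap.mul' ℝ ℝ) ∘ₗ (TensorProduct.map l1 l2), ?_, fun X => ?_⟩
    · exact PolyMap.bilin (TensorProduct.mk ℝ B1 B2) h1 h2
    · change _ = LinearMap.mul' ℝ ℝ (TensorProduct.map l1 l2 (m1 X ⊗ₜ m2 X))
      simp [h1', h2']

def colProj {N k : Type*} [Fintype N] [Fintype k] [DecidableEq k] (B : Matrix N k ℝ) :
    Matrix N N ℝ := B * (B.transpose * B)⁻¹ * B.transpose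

section
variable {N k : Type*} [Fintype N] [Fintype k] [DecidableEq k] [DecidableEq N]

lemma colProj_det {B : Matrix N k ℝ} (hB : Function.Injective B.mulVec) :
    IsUnit (B.transpose * B).det := by
  have := (Matrix.PosDef.conjTranspose_mul_self B hB).det_pos
  rw [Matrix.conjTranspose_eq_transpose_of_trivial] at this
  exact this.ne'.isUnit

lemma colProj_mul {B : Matrix N k ℝ} (hB : Function.Injective B.mulVec) :
    colProj B * B = B := by
  rw [colProj, Matrix.mul_assoc, Matrix.mul_assoc, Matrix.nonsing_inv_mul _ (colProj_det hB),
    Matrix.mul_one]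

lemma colProj_transpose (B : Matrix N k ℝ) : (colProj B).transpose = colProj B := by
  rw [colProj, Matrix.transpose_mul, Matrix.transpose_mul, Matrix.transpose_nonsing_inv,
    Matrix.transpose_mul, Matrix.transpose_transpose, Matrix.mul_assoc]

lemma colProj_eq_of {B B' : Matrix N k ℝ} (hB : Function.Injective B.mulVec)
    (hB' : Function.Injective B'.mulVec) (X Y : Matrix k k ℝ) (h1 : B = B' * X) (h2 : B' = B * Y) :
    colProj B = colProj B' := by
  have e1 : colProj B' * colProj B = colProj B := by
    conv_lhs => rw [colProj.eq_def B]
    rw [← Matrix.mul_assoc, ← Matrix.mul_assoc]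
    have : colProj B' * B = B := by
      conv_lhs => rw [h1, ← Matrix.mul_assoc, colProj_mul hB']
      exact h1.symm
    rw [this]; rfl
  have e2 : colProj B * colProj B' = colProj B' := by
    conv_lhs => rw [colProj.eq_def B']
    rw [← Matrix.mul_assoc, ← Matrix.mul_assoc]
    have : colProj B * B' = B' := by
      conv_lhs => rw [h2, ← Matrix.mul_assoc, colProj_mul hB]
      exact h2.symm
    rw [this]; rfl
  rw [← colProj_transpose B, ← e1, Matrix.transpose_mul, colProj_transpose, colProj_transpose, e2]

/-- the action on projections -/
def projAct (R P : Matrix N N ℝ) : Matrix N N ℝ :=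
  R * P * (P * R.transpose * R * P + 1 - P)⁻¹ * P * R.transpose

lemma colProj_idem {B : Matrix N k ℝ} (hB : Function.Injective B.mulVec) :
    colProj B * colProj B = colProj B := by
  have h : colProj B * (B * (B.transpose * B)⁻¹ * B.transpose) = colProj B := by
    rw [← Matrix.mul_assoc, ← Matrix.mul_assoc, colProj_mul hB]; rfl
  exact h

lemma projAct_aux {B : Matrix N k ℝ} {R : Matrix N N ℝ} (hB : Function.Injective B.mulVec)
    (hRB : Function.Injective (R * B).mulVec) :
    (colProj B * R.transpose * R * colProj B + 1 - colProj B) *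
      (B * ((R * B).transpose * (R * B))⁻¹ * B.transpose + 1 - colProj B) = 1 ∧
    projAct R (colProj B) = colProj (R * B) := by
  set P := colProj B with hP
  set Q' := ((R * B).transpose * (R * B))⁻¹ with hQ'
  set Z := B * Q' * B.transpose with hZ
  have hPB : P * B = B := colProj_mul hB
  have hPP : P * P = P := colProj_idem hB
  have hBP : B.transpose * P = B.transpose := by
    have := congrArg Matrix.transpose hPB
    rwa [Matrix.transpose_mul, hP, colProj_transpose, ← hP] at this
  have hPZ : P * Z = Z := by
    rw [hZ, ← Matrix.mul_assoc, ← Matrix.mul_assoc, hPB]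
  have hZP : Z * P = Z := by
    rw [hZ, Matrix.mul_assoc, hBP]
  have hK : P * (R.transpose * (R * Z)) = P := by
    have h1 : P * (R.transpose * (R * Z)) = B * (B.transpose * B)⁻¹ *
        (((R * B).transpose * (R * B)) * Q') * B.transpose := by
      rw [hP, colProj, hZ, Matrix.transpose_mul]
      simp only [Matrix.mul_assoc]
    rw [h1, hQ', Matrix.mul_nonsing_inv _ (colProj_det hRB), Matrix.mul_one]
    rfl
  have key : (P * R.transpose * R * P + 1 - P) * (Z + 1 - P) = 1 := by
    simp only [sub_mul, add_mul, mul_sub, mul_add, mul_one, one_mul, mul_assoc, hPZ, hPP, hK]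
    abel
  refine ⟨key, ?_⟩
  rw [projAct, Matrix.inv_eq_right_inv key]
  have h0 : P * (Z + 1 - P) * P = Z := by
    rw [mul_sub, mul_add, mul_one, hPP, hPZ, add_sub_cancel_right, hZP]
  have : R * P * (Z + 1 - P) * P * R.transpose = R * Z * R.transpose := by
    calc R * P * (Z + 1 - P) * P * R.transpose = R * (P * (Z + 1 - P) * P) * R.transpose := by
          simp only [Matrix.mul_assoc]
      _ = _ := by rw [h0]
  rw [this, colProj, hZ, ← hQ', Matrix.transpose_mul]
  simp only [Matrix.mul_assoc]

theorem chev_data {G : Type*} [Group G] {d : ℕ} (κ : G →* Matrix (Fin d) (Fin d) ℝ)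
    (A : Subgroup G) (P : Matrix (Fin d) (Fin d) ℝ → ℝ)
    (hP : P ∈ PolyAlg (Matrix (Fin d) (Fin d) ℝ)) (hA : ∀ g, g ∈ A ↔ P (κ g) = 0) :
    ∃ (N k : ℕ) (R : Matrix (Fin d) (Fin d) ℝ → Matrix (Fin N) (Fin N) ℝ)
      (B0 : Matrix (Fin N) (Fin k) ℝ) (x0 : Fin k → ℝ), PolyMap R ∧
      (∀ X Y, R (X * Y) = R Y * R X) ∧ R 1 = 1 ∧ Function.Injective B0.mulVec ∧
      (∀ a ∈ A, ∃ X : Matrix (Fin k) (Fin k) ℝ, R (κ a) * B0 = B0 * X) ∧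
      (∀ g y, B0.mulVec y = (R (κ g)).mulVec (B0.mulVec x0) → g ∈ A) := by
  obtain ⟨B, _, _, _, m, l, hm, hl⟩ := polyAlg_coeff hP
  let N := Module.finrank ℝ B
  let e : B ≃ₗ[ℝ] (Fin N → ℝ) := (Module.finBasis ℝ B).equivFun
  -- right multiplication
  let Rl : B →ₗ[ℝ] Matrix (Fin N) (Fin N) ℝ :=
    { toFun := fun b => LinearMap.toMatrix' (e.toLinearMap ∘ₗ LinearMap.mulRight ℝ b ∘ₗ
        e.symm.toLinearMap)
      map_add' := by
        intro b c
        rw [← map_add]; congr 1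
        ext; simp [mul_add]
      map_smul' := by
        intro b c
        rw [RingHom.id_apply, ← map_smul]; congr 1
        ext; simp }
  have hRl : ∀ b v, (Rl b).mulVec (e v) = e (v * b) := by
    intro b v
    have h : (LinearMap.toMatrix' (e.toLinearMap ∘ₗ LinearMap.mulRight ℝ b ∘ₗ
        e.symm.toLinearMap)).mulVec (e v) = e (v * b) := by
      rw [LinearMap.toMatrix'_mulVec]
      simp
    exact h
  let R : Matrix (Fin d) (Fin d) ℝ → Matrix (Fin N) (Fin N) ℝ := fun X => Rl (m X)
  have hRp : PolyMap R := hm.linc Rl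
  have hRmul : ∀ X Y, R (X * Y) = R Y * R X := by
    intro X Y
    apply Matrix.ext_of_mulVec_single
    intro i
    obtain ⟨v, hv⟩ := e.surjective (Pi.single i 1)
    rw [← hv, ← Matrix.mulVec_mulVec, hRl, hRl, hRl, map_mul m, mul_assoc]
  have hR1 : R 1 = 1 := by
    apply Matrix.ext_of_mulVec_single
    intro i
    obtain ⟨v, hv⟩ := e.surjective (Pi.single i 1)
    rw [← hv, hRl, map_one m, mul_one, Matrix.one_mulVec]
  let E : Submodule ℝ (Fin N → ℝ) := Submodule.span ℝ (Set.range fun a : A => e (m (κ a)))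
  let k := Module.finrank ℝ E
  let bE := Module.finBasis ℝ E
  let B0 : Matrix (Fin N) (Fin k) ℝ :=
    LinearMap.toMatrix' (E.subtype ∘ₗ bE.equivFun.symm.toLinearMap)
  have hB0 : ∀ v, B0.mulVec v = (bE.equivFun.symm v : Fin N → ℝ) := by
    intro v
    rw [LinearMap.toMatrix'_mulVec]; rfl
  have hB0inj : Function.Injective B0.mulVec := by
    intro v w h
    rw [hB0, hB0] at h
    exact bE.equivFun.symm.injective (Subtype.ext h)
  have hB0E : ∀ x ∈ E, ∃ v, B0.mulVec v = x := by
    intro x hx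
    exact ⟨bE.equivFun ⟨x, hx⟩, by rw [hB0]; simp⟩
  have hB0E' : ∀ v, B0.mulVec v ∈ E := by
    intro v; rw [hB0]; exact Subtype.coe_prop _
  have hEA : ∀ a ∈ A, ∃ X : Matrix (Fin k) (Fin k) ℝ, R (κ a) * B0 = B0 * X := by
    intro a ha
    have hE : ∀ x ∈ E, (R (κ a)).mulVec x ∈ E := by
      intro x hx
      induction hx using Submodule.span_induction with
      | mem x hx =>
        obtain ⟨b, rfl⟩ := hx
        simp only [R, hRl]
        rw [← map_mul m, ← map_mul κ]
        exact Submodule.subset_span ⟨b * ⟨a, ha⟩, rfl⟩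
      | zero => simp
      | add x y _ _ h1 h2 => rw [Matrix.mulVec_add]; exact E.add_mem h1 h2
      | smul c x _ h => rw [Matrix.mulVec_smul]; exact E.smul_mem c h
    choose v hv using fun i : Fin k => hB0E _ (hE _ (hB0E' (Pi.single i 1)))
    refine ⟨Matrix.of fun j i => v i j, ?_⟩
    apply Matrix.ext_of_mulVec_single
    intro i
    rw [← Matrix.mulVec_mulVec, ← hv i, ← Matrix.mulVec_mulVec]
    congr 1
    ext j
    simp
  obtain ⟨x0, hx0⟩ := hB0E (e 1) (by
        apply Submodule.subset_span
        exact ⟨1, by simp⟩)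
  refine ⟨N, k, R, B0, x0, hRp, hRmul, hR1, hB0inj, hEA, ?_⟩
  intro g y hy
  have h5 : e (m (κ g)) ∈ E := by
    rw [hx0, hRl, one_mul] at hy
    rw [← hy]; exact hB0E' y
  rw [hA, hl]
  have h6 : ∀ x ∈ E, l (e.symm x) = 0 := by
    intro x hx
    induction hx using Submodule.span_induction with
    | mem x hx =>
      obtain ⟨b, rfl⟩ := hx
      simp only [LinearEquiv.symm_apply_apply]
      rw [← hl]; exact (hA b).1 b.2
    | zero => simp
    | add x y _ _ h1 h2 => rw [map_add, map_add, h1, h2, add_zero]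
    | smul c x _ h => rw [map_smul, map_smul, h, smul_zero]
  simpa using h6 _ h5

lemma chev_graph {N d k : ℕ} {R : Matrix (Fin d) (Fin d) ℝ → Matrix (Fin N) (Fin N) ℝ}
    (hRp : PolyMap R) (B0 : Matrix (Fin N) (Fin k) ℝ) :
    SAinv {p : Matrix (Fin N) (Fin N) ℝ × Matrix (Fin d) (Fin d) ℝ |
      ∃ Q : Matrix (Fin k) (Fin k) ℝ,
          Q * ((R p.2 * B0).transpose * (R p.2 * B0)) = 1 ∧
          p.1 = R p.2 * B0 * Q * (R p.2 * B0).transpose} := by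
  have h1 : PolyMap (fun w : (Matrix (Fin N) (Fin N) ℝ × Matrix (Fin d) (Fin d) ℝ) ×
        Matrix (Fin k) (Fin k) ℝ => R w.1.2 * B0) :=
      (hRp.comp (PolyMap.snd.comp PolyMap.fst)).mmul (PolyMap.const _)
  have h2 := h1.transpose.mmul h1
  have h3 : PolyMap (fun w : (Matrix (Fin N) (Fin N) ℝ × Matrix (Fin d) (Fin d) ℝ) ×
        Matrix (Fin k) (Fin k) ℝ => w.2 * ((R w.1.2 * B0).transpose * (R w.1.2 * B0))) :=
    PolyMap.snd.mmul h2
  have h4 : PolyMap (fun w : (Matrix (Fin N) (Fin N) ℝ × Matrix (Fin d) (Fin d) ℝ) ×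
        Matrix (Fin k) (Fin k) ℝ => R w.1.2 * B0 * w.2 * (R w.1.2 * B0).transpose) :=
    (h1.mmul PolyMap.snd).mmul h1.transpose
  have h5 : PolyMap (fun w : (Matrix (Fin N) (Fin N) ℝ × Matrix (Fin d) (Fin d) ℝ) ×
        Matrix (Fin k) (Fin k) ℝ => w.1.1) := PolyMap.fst.comp PolyMap.fst
  exact SAinv.exists (P := fun (p : Matrix (Fin N) (Fin N) ℝ × Matrix (Fin d) (Fin d) ℝ)
      (Q : Matrix (Fin k) (Fin k) ℝ) => Q * ((R p.2 * B0).transpose * (R p.2 * B0)) = 1 ∧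
          p.1 = R p.2 * B0 * Q * (R p.2 * B0).transpose)
     ((SAinv.eq h3 (PolyMap.const 1)).inter (SAinv.eq h5 h4))

set_option maxHeartbeats 1000000 in
theorem chevalley {G : Type*} [Group G] [TopologicalSpace G] [IsTopologicalGroup G]
    [SigmaCompactSpace G] {d : ℕ} (κ : G →* Matrix (Fin d) (Fin d) ℝ) (hκc : Continuous κ)
    (hκr : SAinv (Set.range κ)) (A : Subgroup G) (P : Matrix (Fin d) (Fin d) ℝ → ℝ)
    (hP : P ∈ PolyAlg (Matrix (Fin d) (Fin d) ℝ)) (hA : ∀ g, g ∈ A ↔ P (κ g) = 0) :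
    ∃ (N : ℕ) (f : G → Matrix (Fin N) (Fin N) ℝ), Continuous f ∧
      IsOpenMap (Set.rangeFactorization f) ∧ (∀ θ η, f θ = f η ↔ θ * η⁻¹ ∈ A) ∧
      SAinv {p : Matrix (Fin N) (Fin N) ℝ × Matrix (Fin d) (Fin d) ℝ |
        ∃ g, κ g = p.2 ∧ f g = p.1} := by
  obtain ⟨N, k, R, B0, x0, hRp, hRmul, hR1, hB0inj, hEA, hx0⟩ := chev_data κ A P hP hA
  have hRinv : ∀ g : G, R (κ g⁻¹) * R (κ g) = 1 := by
    intro g; rw [← hRmul, ← map_mul κ, mul_inv_cancel, map_one κ, hR1]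
  have hRinj : ∀ g : G, Function.Injective (R (κ g) * B0).mulVec := by
    intro g v w h
    apply hB0inj
    have := congrArg (R (κ g⁻¹)).mulVec h
    simpa only [Matrix.mulVec_mulVec, ← Matrix.mul_assoc, hRinv, Matrix.one_mul] using this
  let f : G → Matrix (Fin N) (Fin N) ℝ := fun g => colProj (R (κ g) * B0)
  have hfiber : ∀ θ η, f θ = f η ↔ θ * η⁻¹ ∈ A := by
    intro θ η
    constructor
    · intro h
      apply hx0 _ ((((R (κ η) * B0).transpose * (R (κ η) * B0))⁻¹ *
          (R (κ η) * B0).transpose).mulVec ((R (κ θ) * B0).mulVec x0))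
      have h1 : (f η).mulVec ((R (κ θ) * B0).mulVec x0) = (R (κ θ) * B0).mulVec x0 := by
        rw [← h, Matrix.mulVec_mulVec, colProj_mul (hRinj θ)]
      have hy : (R (κ η) * B0).mulVec ((((R (κ η) * B0).transpose * (R (κ η) * B0))⁻¹ *
          (R (κ η) * B0).transpose).mulVec ((R (κ θ) * B0).mulVec x0)) =
          (R (κ θ) * B0).mulVec x0 := by
        conv_rhs => rw [← h1]
        change _ = (colProj _).mulVec _
        rw [colProj, Matrix.mul_assoc (R (κ η) * B0), ← Matrix.mulVec_mulVec (M := R (κ η) * B0)]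
      have h4 := congrArg (R (κ η⁻¹)).mulVec hy
      rw [Matrix.mulVec_mulVec, ← Matrix.mul_assoc (R (κ η⁻¹)) (R (κ η)), hRinv, Matrix.one_mul,
        Matrix.mulVec_mulVec (M := R (κ η⁻¹)),
        ← Matrix.mul_assoc (R (κ η⁻¹)) (R (κ θ)), ← hRmul, ← map_mul κ] at h4
      rw [Matrix.mulVec_mulVec (N := B0)]
      exact h4
    · intro h
      obtain ⟨X, hX⟩ := hEA _ h
      obtain ⟨Y, hY⟩ := hEA _ (A.inv_mem h)
      refine colProj_eq_of (hRinj θ) (hRinj η) X Y ?_ ?_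
      · rw [Matrix.mul_assoc, ← hX, ← Matrix.mul_assoc, ← hRmul, ← map_mul κ]
        simp
      · rw [Matrix.mul_assoc, ← hY, ← Matrix.mul_assoc, ← hRmul, ← map_mul κ]
        simp
  have hgraph : SAinv {p : Matrix (Fin N) (Fin N) ℝ × Matrix (Fin d) (Fin d) ℝ |
        ∃ g, κ g = p.2 ∧ f g = p.1} := by
    have hset : {p : Matrix (Fin N) (Fin N) ℝ × Matrix (Fin d) (Fin d) ℝ |
        ∃ g, κ g = p.2 ∧ f g = p.1} = (Prod.snd ⁻¹' Set.range κ) ∩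
        {p | ∃ Q : Matrix (Fin k) (Fin k) ℝ,
          Q * ((R p.2 * B0).transpose * (R p.2 * B0)) = 1 ∧
          p.1 = R p.2 * B0 * Q * (R p.2 * B0).transpose} := by
      ext ⟨p, X⟩
      constructor
      · rintro ⟨g, rfl, rfl⟩
        exact ⟨⟨g, rfl⟩, _, Matrix.nonsing_inv_mul _ (colProj_det (hRinj g)), rfl⟩
      · rintro ⟨⟨g, rfl⟩, Q, hQ, hp⟩
        refine ⟨g, rfl, ?_⟩
        simp only at hp hQ
        change colProj _ = p
        rw [hp, colProj, Matrix.inv_eq_left_inv hQ]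
    rw [hset]
    exact (hκr.preimage PolyMap.snd).inter (chev_graph hRp B0)
  have hRcont : Continuous R := by
    refine continuous_matrix fun i j => ?_
    exact PolyMap.cont (polyMap_real.1 (hRp.entry i j))
  have hfc : Continuous f := by
    have h1 : Continuous fun g => R (κ g) * B0 := (hRcont.comp hκc).matrix_mul continuous_const
    have h2 : Continuous fun g => ((R (κ g) * B0).transpose * (R (κ g) * B0))⁻¹ := by
      rw [continuous_iff_continuousAt]
      intro g
      have h3 := continuousAt_matrix_inv ((R (κ g) * B0).transpose * (R (κ g) * B0))
        (by
          rw [Ring.inverse_eq_inv']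
          exact continuousAt_inv₀ (colProj_det (hRinj g)).ne_zero)
      exact ContinuousAt.comp (f := fun g => (R (κ g) * B0).transpose * (R (κ g) * B0)) h3
        (h1.matrix_transpose.matrix_mul h1).continuousAt
    exact (h1.matrix_mul h2).matrix_mul h1.matrix_transpose
  have hact : ∀ g θ, projAct (R (κ g⁻¹)) (f θ) = f (θ * g⁻¹) := by
    intro g θ
    have h0 : R (κ g⁻¹) * (R (κ θ) * B0) = R (κ (θ * g⁻¹)) * B0 := by
      rw [← Matrix.mul_assoc, ← hRmul, ← map_mul κ]
    have h1 := (projAct_aux (R := R (κ g⁻¹)) (hRinj θ) (by rw [h0]; exact hRinj _)).2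
    rw [h0] at h1
    exact h1
  refine ⟨N, f, hfc, ?_, hfiber, hgraph⟩
  haveI : LocallyCompactSpace (Matrix (Fin N) (Fin N) ℝ) :=
    inferInstanceAs (LocallyCompactSpace (Fin N → Fin N → ℝ))
  apply isOpenMap_of_locClosed f (fun g P => projAct (R (κ g⁻¹)) P) hact
  · rintro ⟨g, Pθ⟩ ⟨-, θ, rfl⟩
    apply ContinuousAt.continuousWithinAt
    have h0 : R (κ g⁻¹) * (R (κ θ) * B0) = R (κ (θ * g⁻¹)) * B0 := by
      rw [← Matrix.mul_assoc, ← hRmul, ← map_mul κ]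
    have hu := (projAct_aux (R := R (κ g⁻¹)) (hRinj θ) (by rw [h0]; exact hRinj _)).1
    have c1 : Continuous fun p : G × Matrix (Fin N) (Fin N) ℝ => R (κ p.1⁻¹) :=
      hRcont.comp (hκc.comp (continuous_fst.inv))
    have c2 : Continuous fun p : G × Matrix (Fin N) (Fin N) ℝ =>
        p.2 * (R (κ p.1⁻¹)).transpose * R (κ p.1⁻¹) * p.2 + 1 - p.2 := by
      refine ((((continuous_snd.matrix_mul c1.matrix_transpose).matrix_mul c1).matrix_mul
        continuous_snd).add continuous_const).sub continuous_snd
    have c3 : ContinuousAt (fun p : G × Matrix (Fin N) (Fin N) ℝ =>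
        (p.2 * (R (κ p.1⁻¹)).transpose * R (κ p.1⁻¹) * p.2 + 1 - p.2)⁻¹) (g, f θ) := by
      have h3 := continuousAt_matrix_inv
        (f θ * (R (κ g⁻¹)).transpose * R (κ g⁻¹) * f θ + 1 - f θ)
        (by
          rw [Ring.inverse_eq_inv']
          refine continuousAt_inv₀ ?_
          intro hd
          have := congrArg Matrix.det hu
          rw [Matrix.det_mul, Matrix.det_one] at this
          change (f θ * (R (κ g⁻¹)).transpose * R (κ g⁻¹) * f θ + 1 - f θ).det * _ = 1 at this
          rw [hd, zero_mul] at this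
          exact zero_ne_one this)
      exact ContinuousAt.comp (f := fun p : G × Matrix (Fin N) (Fin N) ℝ =>
        p.2 * (R (κ p.1⁻¹)).transpose * R (κ p.1⁻¹) * p.2 + 1 - p.2) (x := (g, f θ)) h3
        c2.continuousAt
    have c4 : Continuous fun p : G × Matrix (Fin N) (Fin N) ℝ => R (κ p.1⁻¹) * p.2 :=
      c1.matrix_mul continuous_snd
    exact ((c4.continuousAt.mul c3).mul continuous_snd.continuousAt).mul
      c1.matrix_transpose.continuousAt
  · refine SAinv.locClosed ?_ ⟨f 1, 1, rfl⟩
    have h1 := SAinv.exists (P := fun (p : Matrix (Fin N) (Fin N) ℝ)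
      (X : Matrix (Fin d) (Fin d) ℝ) => ∃ g, κ g = X ∧ f g = p) hgraph
    convert h1 using 1
    ext p
    constructor
    · rintro ⟨g, rfl⟩; exact ⟨κ g, g, rfl, rfl⟩
    · rintro ⟨X, g, _, rfl⟩; exact ⟨g, rfl⟩
end
end

section
noncomputable section
open Topology

lemma induced_le_of_comp {X Y W : Type*} [tY : TopologicalSpace Y] [tW : TopologicalSpace W]
    (f : X → Y) (k : Y → W) (hk : Continuous k) :
    TopologicalSpace.induced f tY ≤ TopologicalSpace.induced (k ∘ f) tW := by
  rw [← induced_compose]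
  exact induced_mono hk.le_induced

section Aff
variable {V : Type*} [NormedAddCommGroup V] [NormedSpace ℝ V] [FiniteDimensional ℝ V]

/-- continuous endomorphisms of `V × ℝ` -/
abbrev EndV (V : Type*) [NormedAddCommGroup V] [NormedSpace ℝ V] := (V × ℝ) →L[ℝ] (V × ℝ)

/-- the linear representation of the affine group -/
def affL : (V ≃ᵃ[ℝ] V) →* EndV V where
  toFun g := LinearMap.toContinuousLinearMap (affToLin g)
  map_one' := by
    ext x <;> simp [affToLin, AffineEquiv.one_def]
  map_mul' g h := by
    have key : ∀ y : V, g (h y) = g.linear (h y) + g 0 := by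
      intro y
      have := g.map_vadd 0 (h y)
      simpa using this
    have hl : ∀ x, (g * h).linear x = g.linear (h.linear x) := fun _ => rfl
    ext x <;> simp [affToLin, key, hl]

lemma affL_apply (g : V ≃ᵃ[ℝ] V) (x : V × ℝ) :
    affL g x = (g.linear x.1 + x.2 • g 0, x.2) := by
  simp [affL, affToLin]

lemma affL_one_apply (g : V ≃ᵃ[ℝ] V) (x : V) : affL g (x, 1) = (g x, 1) := by
  have := g.map_vadd 0 x
  rw [affL_apply]
  simp at this
  simp [this]

lemma affL_snd (g : V ≃ᵃ[ℝ] V) (x : V × ℝ) : (affL g x).2 = x.2 := by rw [affL_apply]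

lemma affL_inj : Function.Injective (affL : (V ≃ᵃ[ℝ] V) →* EndV V) := by
  intro g h hh
  ext x
  have := congrArg (fun a : EndV V => (a (x, 1)).1) hh
  simpa [affL_one_apply] using this

lemma affL_mul_inv (g : V ≃ᵃ[ℝ] V) : affL g * affL g⁻¹ = 1 := by
  rw [← map_mul, mul_inv_cancel, map_one]
lemma affL_inv_mul (g : V ≃ᵃ[ℝ] V) : affL g⁻¹ * affL g = 1 := by
  rw [← map_mul, inv_mul_cancel, map_one]

lemma aff_split (a : EndV V) (p v : V) :
    (a (v + p, 1)).1 = (a (v, 0)).1 + (a (p, 1)).1 := by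
  rw [← Prod.fst_add, ← map_add]; simp

/-- constructor of affine equivalences -/
def mkAff (a b : EndV V) (hab : a * b = 1) (hba : b * a = 1) (ha : ∀ x, (a x).2 = x.2) :
    V ≃ᵃ[ℝ] V :=
  have hb : ∀ x, (b x).2 = x.2 := fun x => by
    rw [← ha (b x), ← mul_apply_eq_comp, hab]; rfl
  have h1 : ∀ (t : ℝ) x, ((a (x, t)).1, t) = a (x, t) := fun t x => Prod.ext rfl (ha (x, t)).symm
  have h2 : ∀ (t : ℝ) x, ((b (x, t)).1, t) = b (x, t) := fun t x => Prod.ext rfl (hb (x, t)).symm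
  { toFun := fun x => (a (x, 1)).1
    invFun := fun x => (b (x, 1)).1
    left_inv := fun x => by
      change (b ((a (x, 1)).1, 1)).1 = x
      rw [h1, ← mul_apply_eq_comp, hba]; rfl
    right_inv := fun x => by
      change (a ((b (x, 1)).1, 1)).1 = x
      rw [h2, ← mul_apply_eq_comp, hab]; rfl
    linear :=
      { toFun := fun x => (a (x, 0)).1
        invFun := fun x => (b (x, 0)).1
        left_inv := fun x => by
          change (b ((a (x, 0)).1, 0)).1 = x
          rw [h1, ← mul_apply_eq_comp, hba]; rfl
        right_inv := fun x => by
          change (a ((b (x, 0)).1, 0)).1 = x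
          rw [h2, ← mul_apply_eq_comp, hab]; rfl
        map_add' := fun x y => by rw [← Prod.fst_add, ← map_add]; simp
        map_smul' := fun c x => by
          rw [RingHom.id_apply, ← Prod.smul_fst, ← map_smul]; simp }
    map_vadd' := fun p v => aff_split a p v }

lemma affL_mkAff (a b : EndV V) (hab : a * b = 1) (hba : b * a = 1) (ha : ∀ x, (a x).2 = x.2) :
    affL (mkAff a b hab hba ha) = a := by
  apply ContinuousLinearMap.ext
  intro x
  rw [affL_apply]
  refine Prod.ext ?_ (ha x).symm
  change (a (x.1, 0)).1 + x.2 • (a (0, 1)).1 = _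
  rw [← Prod.smul_fst, ← Prod.fst_add, ← map_smul, ← map_add]
  simp

lemma affL_inducing : IsInducing (affL : (V ≃ᵃ[ℝ] V) →* EndV V) := by
  have h1 : Continuous (affL : (V ≃ᵃ[ℝ] V) →* EndV V) := by
    rw [continuous_clm_apply]
    intro y
    have hc : ∀ x : V, Continuous fun g : V ≃ᵃ[ℝ] V => g x := fun x =>
      (continuous_apply x).comp continuous_induced_dom
    have h2 : ∀ g : V ≃ᵃ[ℝ] V, affL g y = ((g y.1 - g 0) + y.2 • g 0, y.2) := by
      intro g
      rw [affL_apply]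
      have := g.map_vadd 0 y.1
      simp at this
      simp [this]
    simp only [h2]
    exact (((hc _).sub (hc _)).add ((hc _).const_smul _)).prodMk continuous_const
  constructor
  apply le_antisymm
  · exact continuous_iff_le_induced.1 h1
  · change _ ≤ TopologicalSpace.induced (fun g : V ≃ᵃ[ℝ] V => (g : V → V)) Pi.topologicalSpace
    have h2 := induced_le_of_comp (affL : (V ≃ᵃ[ℝ] V) →* EndV V)
      (fun (a : EndV V) (x : V) => (a (x, 1)).1) (by fun_prop)
    convert h2 using 2
    ext g x
    simp [affL_one_apply]

lemma affL_continuous : Continuous (affL : (V ≃ᵃ[ℝ] V) →* EndV V) := affL_inducing.continuous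

instance affTopGroup : IsTopologicalGroup (V ≃ᵃ[ℝ] V) where
  continuous_mul := by
    rw [affL_inducing.continuous_iff]
    have : (affL ∘ fun p : (V ≃ᵃ[ℝ] V) × (V ≃ᵃ[ℝ] V) => p.1 * p.2) =
      fun p => affL p.1 * affL p.2 := by ext1 p; simp
    rw [this]
    exact (affL_continuous.comp continuous_fst).mul (affL_continuous.comp continuous_snd)
  continuous_inv := by
    rw [affL_inducing.continuous_iff, continuous_iff_continuousAt]
    intro g
    let u : (V ≃ᵃ[ℝ] V) → (EndV V)ˣ := fun g => ⟨affL g, affL g⁻¹, affL_mul_inv g, affL_inv_mul g⟩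
    have : (affL ∘ fun g : V ≃ᵃ[ℝ] V => g⁻¹) = fun g => Ring.inverse (affL g) := by
      ext1 g
      exact (Ring.inverse_unit (u g)).symm
    rw [this]
    exact ContinuousAt.comp (g := Ring.inverse) (NormedRing.inverse_continuousAt (u g)) affL_continuous.continuousAt

instance affSigmaCompact : SigmaCompactSpace (V ≃ᵃ[ℝ] V) := by
  have hcl : IsClosedEmbedding (fun g : V ≃ᵃ[ℝ] V => (affL g, affL g⁻¹)) := by
    refine ⟨⟨⟨?_⟩, ?_⟩, ?_⟩
    · apply le_antisymm
      · exact continuous_iff_le_induced.1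
          (affL_continuous.prodMk (affL_continuous.comp continuous_inv))
      · rw [affL_inducing.eq_induced]
        exact @induced_le_of_comp (V ≃ᵃ[ℝ] V) (EndV V × EndV V) (EndV V) _ _
          (fun g : V ≃ᵃ[ℝ] V => (affL g, affL g⁻¹)) Prod.fst continuous_fst
    · intro g h hh
      exact affL_inj (Prod.ext_iff.1 hh).1
    · have : Set.range (fun g : V ≃ᵃ[ℝ] V => (affL g, affL g⁻¹)) =
        {p : EndV V × EndV V | p.1 * p.2 = 1} ∩ {p | p.2 * p.1 = 1} ∩
          ⋂ x, {p | (p.1 x).2 = x.2} := by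
        ext ⟨a, b⟩
        constructor
        · rintro ⟨g, hg⟩
          obtain ⟨rfl, rfl⟩ := Prod.ext_iff.1 hg
          exact ⟨⟨affL_mul_inv g, affL_inv_mul g⟩, Set.mem_iInter.2 fun x => affL_snd g x⟩
        · rintro ⟨⟨h1, h2⟩, h3⟩
          rw [Set.mem_iInter] at h3
          have h4 := affL_mkAff a b h1 h2 h3
          refine ⟨mkAff a b h1 h2 h3, Prod.ext h4 ?_⟩
          have h5 := affL_mul_inv (mkAff a b h1 h2 h3)
          rw [h4] at h5
          exact (left_inv_eq_right_inv h2 h5).symm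
      rw [this]
      refine ((isClosed_eq (by fun_prop) (by fun_prop)).inter
        (isClosed_eq (by fun_prop) (by fun_prop))).inter (isClosed_iInter fun x =>
          isClosed_eq ?_ (by fun_prop))
      have : Continuous fun p : EndV V × EndV V => p.1 x := by fun_prop
      exact continuous_snd.comp this
  have : ProperSpace (EndV V) := FiniteDimensional.proper_real _
  exact hcl.sigmaCompactSpace

/-- index type for matrices -/
abbrev MatV (V : Type*) [NormedAddCommGroup V] [NormedSpace ℝ V] [FiniteDimensional ℝ V] :=
  Matrix (Fin (Module.finrank ℝ (V × ℝ))) (Fin (Module.finrank ℝ (V × ℝ))) ℝ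

/-- endomorphisms as matrices -/
def toMatV : EndV V ≃ₗ[ℝ] MatV V :=
  (LinearMap.toContinuousLinearMap (𝕜 := ℝ) (E := V × ℝ) (F' := V × ℝ)).symm ≪≫ₗ
    LinearMap.toMatrix (Module.finBasis ℝ (V × ℝ)) (Module.finBasis ℝ (V × ℝ))

lemma toMatV_mul (a b : EndV V) : toMatV (a * b) = toMatV a * toMatV b := by
  exact LinearMap.toMatrix_mul _ _ _
lemma toMatV_one : toMatV (1 : EndV V) = 1 := by
  exact LinearMap.toMatrix_one _

/-- matrix representation -/
def affK : (V ≃ᵃ[ℝ] V) →* MatV V where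
  toFun g := toMatV (affL g)
  map_one' := by rw [map_one, toMatV_one]
  map_mul' g h := by rw [map_mul, toMatV_mul]

lemma affK_eq (g : V ≃ᵃ[ℝ] V) : affK g = affEntry g := rfl

lemma affK_cont : Continuous (affK : (V ≃ᵃ[ℝ] V) →* MatV V) :=
  (toMatV (V := V)).toLinearMap.continuous_of_finiteDimensional.comp affL_continuous

lemma affL_range : Set.range (affL : (V ≃ᵃ[ℝ] V) →* EndV V) =
    {a | ∃ b, (a * b = 1 ∧ b * a = 1) ∧ ∀ x, (a x).2 = x.2} := by
  ext a
  constructor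
  · rintro ⟨g, rfl⟩
    exact ⟨affL g⁻¹, ⟨affL_mul_inv g, affL_inv_mul g⟩, affL_snd g⟩
  · rintro ⟨b, ⟨h1, h2⟩, h3⟩
    exact ⟨_, affL_mkAff a b h1 h2 h3⟩

/-- evaluation as a linear map -/
def evalL (x : V × ℝ) : EndV V →ₗ[ℝ] V × ℝ where
  toFun a := a x
  map_add' _ _ := rfl
  map_smul' _ _ := rfl

lemma affL_range_SA : SAinv (Set.range (affL : (V ≃ᵃ[ℝ] V) →* EndV V)) := by
  rw [affL_range]
  refine SAinv.exists (P := fun a b : EndV V => (a * b = 1 ∧ b * a = 1) ∧ ∀ x, (a x).2 = x.2) ?_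
  refine ((SAinv.eq (PolyMap.fst.mul PolyMap.snd) (PolyMap.const 1)).inter
    (SAinv.eq (PolyMap.snd.mul PolyMap.fst) (PolyMap.const 1))).inter
    (SAinv.forall_eq (f := fun x (w : EndV V × EndV V) => (w.1 x).2) (g := fun x _ => x.2)
      (fun x => ?_) (fun x => PolyMap.const _))
  exact (PolyMap.fst.linc (evalL x)).linc (LinearMap.snd ℝ V ℝ)

lemma affK_range_SA : SAinv (Set.range (affK : (V ≃ᵃ[ℝ] V) →* MatV V)) := by
  have h := (affL_range_SA (V := V)).preimage (PolyMap.lin (toMatV (V := V)).symm.toLinearMap)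
  convert h using 1
  ext a
  constructor
  · rintro ⟨g, rfl⟩
    exact ⟨g, by simp [affK]⟩
  · rintro ⟨g, hg⟩
    exact ⟨g, by simp [affK, hg]⟩
end Aff
end
end

section
noncomputable section
open Topology Polynomial

section nexp
variable {R : Type*} [Ring R] [Algebra ℝ R]

/-- truncated exponential -/
def nexp (d : ℕ) (N : R) : R := ∑ k ∈ Finset.range d, ((k.factorial : ℝ)⁻¹) • N ^ k

lemma nexp_zero {d : ℕ} (hd : 0 < d) : nexp d (0 : R) = 1 := by
  obtain ⟨e, rfl⟩ := Nat.exists_eq_add_of_lt hd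
  rw [nexp, zero_add, Finset.sum_range_succ']
  simp

lemma nexp_add {d : ℕ} {a b : R} (hab : Commute a b) (ha : a ^ d = 0) (hb : b ^ d = 0)
    (hc : (a + b) ^ d = 0) : nexp d (a + b) = nexp d a * nexp d b := by
  let _ : Algebra ℚ R := Algebra.compHom R (algebraMap ℚ ℝ)
  have key : ∀ N : R, N ^ d = 0 → nexp d N = IsNilpotent.exp N := by
    intro N hN
    rw [IsNilpotent.exp_eq_sum hN, nexp]
    refine Finset.sum_congr rfl fun k _ => ?_
    change _ = (algebraMap ℚ ℝ ((k.factorial : ℚ)⁻¹)) • N ^ k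
    simp
  rw [key _ ha, key _ hb, key _ hc, IsNilpotent.exp_add_of_commute hab ⟨d, ha⟩ ⟨d, hb⟩]

lemma nexp_semiconj (d : ℕ) {a N M : R} (h : a * N = M * a) : a * nexp d N = nexp d M * a := by
  have h1 : SemiconjBy a N M := h
  rw [nexp, nexp, Finset.mul_sum, Finset.sum_mul]
  refine Finset.sum_congr rfl fun k _ => ?_
  rw [mul_smul_comm, smul_mul_assoc, (h1.pow_right k).eq]

lemma nexp_commute (d : ℕ) {a N : R} (h : Commute a N) : Commute a (nexp d N) :=
  nexp_semiconj d h

lemma nexp_map {S : Type*} [Ring S] [Algebra ℝ S] (F : R →ₐ[ℝ] S) (d : ℕ) (N : R) :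
    F (nexp d N) = nexp d (F N) := by
  simp [nexp]

lemma nexp_conj (d : ℕ) {a b N : R} (hba : b * a = 1) :
    nexp d (a * N * b) = 1 + a * (nexp d N - 1) * b ∨ d = 0 := by
  rcases d with _ | d
  · right; rfl
  left
  have h : ∀ k, (a * N * b) ^ (k + 1) = a * N ^ (k + 1) * b := by
    intro k
    induction k with
    | zero => simp
    | succ k ih =>
      rw [pow_succ, ih]
      calc a * N ^ (k + 1) * b * (a * N * b) = a * N ^ (k + 1) * (b * a) * N * b := by
            simp only [mul_assoc]
        _ = _ := by rw [hba, mul_one, pow_succ (n := k + 1)]; simp only [mul_assoc]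
  rw [nexp, nexp, Finset.sum_range_succ', Finset.sum_range_succ']
  simp only [h]
  simp [Finset.mul_sum, Finset.sum_mul, add_comm]

lemma nexp_conj' {d : ℕ} (hd : 0 < d) {a b N : R} (hab : a * b = 1) (hba : b * a = 1) :
    nexp d (a * N * b) = a * nexp d N * b := by
  rcases nexp_conj d (N := N) hba with h | h
  · rw [h, mul_sub, sub_mul, mul_one, hab]; abel
  · omega

/-- `nexp d N - 1 = N * (...)` -/
lemma nexp_sub_one {d : ℕ} (N : R) : ∃ q : ℝ[X],
    nexp (d + 2) N - 1 = N * (1 + N * aeval N q) := by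
  refine ⟨∑ k ∈ Finset.range d, (((k + 2).factorial : ℝ)⁻¹) • X ^ k, ?_⟩
  rw [nexp, Finset.sum_range_succ', Finset.sum_range_succ']
  simp [Finset.mul_sum, mul_add, pow_succ' N (_ + 1)]
  simp only [pow_succ', add_assoc, Nat.reduceAdd]
  rw [add_comm]

lemma aeval_commute (N : R) (q : ℝ[X]) : Commute N (aeval N q) := by
  have : Commute (aeval N (X : ℝ[X])) (aeval N q) := by
    rw [Commute, SemiconjBy, ← map_mul, ← map_mul, mul_comm]
  simpa using this

lemma aeval_commute' {a N : R} (h : Commute a N) (q : ℝ[X]) : Commute a (aeval N q) := by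
  induction q using Polynomial.induction_on' with
  | add p q hp hq => rw [map_add]; exact hp.add_right hq
  | monomial k c =>
    rw [aeval_monomial]
    exact (Algebra.commute_algebraMap_right c a).mul_right (h.pow_right k)

lemma aeval_semiconj {a N M : R} (h : a * N = M * a) (q : ℝ[X]) :
    a * aeval N q = aeval M q * a := by
  have h1 : SemiconjBy a N M := h
  induction q using Polynomial.induction_on' with
  | add p q hp hq => rw [map_add, map_add, mul_add, add_mul, hp, hq]
  | monomial k c =>
    rw [aeval_monomial, aeval_monomial, ← mul_assoc, ← Algebra.commutes c a, mul_assoc,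
      (h1.pow_right k).eq, mul_assoc]

lemma nexp_eq_one {d : ℕ} {N : R} (hN : N ^ d = 0) (h : nexp d N = 1) : N = 0 := by
  rcases d with _ | _ | d
  · have : (1 : R) = 0 := by simpa using hN
    rw [← mul_one N, this, mul_zero]
  · simpa using hN
  · obtain ⟨q, hq⟩ := nexp_sub_one (d := d) N
    rw [h, sub_self] at hq
    have hn : IsNilpotent (N * aeval N q) :=
      (aeval_commute N q).isNilpotent_mul_right ⟨_, hN⟩
    have hu : IsUnit (1 + N * aeval N q) := hn.isUnit_one_add
    exact (hu.mul_left_eq_zero.1 hq.symm)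

lemma exists_plog (d m : ℕ) (hm : 1 ≤ m) (hmd : m ≤ d) :
    ∃ p : ℝ[X], X ∣ p ∧ X ^ m ∣ nexp d p - (1 + X) := by
  induction m, hm using Nat.le_induction with
  | base =>
    refine ⟨0, dvd_zero _, ?_⟩
    rw [nexp_zero (by omega)]
    simp
  | succ m hm ih =>
    obtain ⟨p, hp, r, hr⟩ := ih (by omega)
    obtain ⟨d, rfl⟩ : ∃ e, d = e + 2 := ⟨d - 2, by omega⟩
    let c := r.coeff 0
    let p' := p - C c * X ^ m
    have hp' : X ∣ p' := dvd_sub hp (Dvd.dvd.mul_left (dvd_pow_self X (by omega)) _)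
    refine ⟨p', hp', ?_⟩
    have hdiff : X ^ (m + 1) ∣ nexp (d + 2) p' - nexp (d + 2) p - (p' - p) := by
      rw [nexp, nexp, Finset.sum_range_succ', Finset.sum_range_succ', Finset.sum_range_succ',
        Finset.sum_range_succ']
      have : (∑ k ∈ Finset.range d, (((k + 1 + 1).factorial : ℝ)⁻¹) • p' ^ (k + 1 + 1) +
          (((0 + 1).factorial : ℝ)⁻¹) • p' ^ (0 + 1) + (((0).factorial : ℝ)⁻¹) • p' ^ 0 -
          (∑ k ∈ Finset.range d, (((k + 1 + 1).factorial : ℝ)⁻¹) • p ^ (k + 1 + 1) +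
          (((0 + 1).factorial : ℝ)⁻¹) • p ^ (0 + 1) + (((0).factorial : ℝ)⁻¹) • p ^ 0) - (p' - p))
          = ∑ k ∈ Finset.range d, (((k + 1 + 1).factorial : ℝ)⁻¹) •
            (p' ^ (k + 1 + 1) - p ^ (k + 1 + 1)) := by
        simp only [smul_sub, Finset.sum_sub_distrib]
        simp
        ring
      rw [this]
      refine Finset.dvd_sum fun k _ => ?_
      rw [smul_eq_C_mul]
      refine Dvd.dvd.mul_left ?_ _
      rw [← geom_sum₂_mul, pow_succ']
      refine mul_dvd_mul ?_ ?_
      · refine Finset.dvd_sum fun i hi => ?_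
        rw [Finset.mem_range] at hi
        rcases Nat.eq_zero_or_pos i with h0 | h0
        · exact Dvd.dvd.mul_left (dvd_pow hp (by omega)) _
        · exact Dvd.dvd.mul_right (dvd_pow hp' (by omega)) _
      · exact ⟨- C c, by simp only [p']; ring⟩
    have hfin : nexp (d + 2) p' - (1 + X) =
        (nexp (d + 2) p' - nexp (d + 2) p - (p' - p)) + X ^ m * (r - C c) := by
      have : nexp (d + 2) p = X ^ m * r + (1 + X) := by rw [← hr]; ring
      rw [this]
      simp only [p']
      ring
    rw [hfin]
    refine dvd_add hdiff ?_
    rw [pow_succ]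
    refine mul_dvd_mul_left _ ?_
    rw [X_dvd_iff]
    simp [c]

/-- truncated logarithm polynomial -/
def plog (d : ℕ) : ℝ[X] :=
  open Classical in if h : 1 ≤ d then (exists_plog d d h le_rfl).choose else 0

lemma plog_dvd (d : ℕ) : X ∣ plog d := by
  rw [plog]
  split_ifs with h
  · exact (exists_plog d d h le_rfl).choose_spec.1
  · exact dvd_zero _

lemma plog_spec {d : ℕ} (h : 1 ≤ d) : X ^ d ∣ nexp d (plog d) - (1 + X) := by
  rw [plog, dif_pos h]
  exact (exists_plog d d h le_rfl).choose_spec.2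

/-- logarithm of `1 + N` -/
def nlog (d : ℕ) (N : R) : R := aeval N (plog d)

lemma nlog_nil (d : ℕ) {N : R} (hN : IsNilpotent N) : IsNilpotent (nlog d N) := by
  obtain ⟨q, hq⟩ := plog_dvd d
  rw [nlog, hq, map_mul, aeval_X]
  exact (aeval_commute N q).isNilpotent_mul_right hN

lemma nexp_nlog {d : ℕ} (h : 1 ≤ d) {N : R} (hN : N ^ d = 0) : nexp d (nlog d N) = 1 + N := by
  obtain ⟨q, hq⟩ := plog_spec h
  have := congrArg (aeval N) hq
  rw [map_sub, nexp_map, map_mul, map_pow, aeval_X, hN, zero_mul, map_add, map_one, aeval_X,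
    sub_eq_zero] at this
  exact this

lemma nlog_commute (d : ℕ) {a N : R} (h : Commute a N) : Commute a (nlog d N) :=
  aeval_commute' h _

lemma nlog_semiconj (d : ℕ) {a N M : R} (h : a * N = M * a) : a * nlog d N = nlog d M * a :=
  aeval_semiconj h _

lemma nexp_sub_one_nil {d : ℕ} {N : R} (hN : IsNilpotent N) (h : 1 ≤ d) :
    IsNilpotent (nexp d N - 1) := by
  rcases d with _ | _ | d
  · omega
  · simp [nexp]
  · obtain ⟨q, hq⟩ := nexp_sub_one (d := d) N
    rw [hq]
    refine Commute.isNilpotent_mul_right ?_ hN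
    exact (Commute.one_right N).add_right ((Commute.refl N).mul_right (aeval_commute N q))

/-- bound on the nilpotency index -/
def NilBound (R : Type*) [Ring R] (d : ℕ) : Prop := ∀ N : R, IsNilpotent N → N ^ d = 0

variable {d : ℕ}

lemma nexp_add' (hd : NilBound R d)
    {a b : R} (hab : Commute a b) (ha : IsNilpotent a) (hb : IsNilpotent b) :
    nexp d (a + b) = nexp d a * nexp d b :=
  nexp_add hab (hd _ ha) (hd _ hb) (hd _ (hab.isNilpotent_add ha hb))

lemma nexp_neg (hd : NilBound R d) (h : 1 ≤ d) {a : R} (ha : IsNilpotent a) : nexp d a * nexp d (-a) = 1 := by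
  rw [← nexp_add' hd (Commute.refl a).neg_right ha ha.neg, add_neg_cancel, nexp_zero h]

lemma nexp_neg' (hd : NilBound R d) (h : 1 ≤ d) {a : R} (ha : IsNilpotent a) : nexp d (-a) * nexp d a = 1 := by
  rw [← nexp_add' hd (Commute.refl a).neg_left ha.neg ha, neg_add_cancel, nexp_zero h]

lemma nexp_inj (hd : NilBound R d) (h : 1 ≤ d)
    {a b : R} (hab : Commute a b) (ha : IsNilpotent a) (hb : IsNilpotent b)
    (he : nexp d a = nexp d b) : a = b := by
  have h1 : nexp d (a + -b) = 1 := by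
    rw [nexp_add' hd hab.neg_right ha hb.neg, he, nexp_neg hd h hb]
  have h2 := nexp_eq_one (hd _ (hab.neg_right.isNilpotent_add ha hb.neg)) h1
  rwa [← sub_eq_add_neg, sub_eq_zero] at h2

lemma nlog_nexp (hd : NilBound R d) (h : 1 ≤ d) {N : R} (hN : IsNilpotent N) : nlog d (nexp d N - 1) = N := by
  have h1 := nexp_sub_one_nil hN h
  refine nexp_inj hd h ?_ (nlog_nil d h1) hN ?_
  · exact (nlog_commute d ((nexp_commute d (Commute.refl N)).sub_right (Commute.one_right N))).symm
  · rw [nexp_nlog h (hd _ h1), add_sub_cancel]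

lemma nexp_nlog' (hd : NilBound R d) (h : 1 ≤ d) {N : R} (hN : IsNilpotent N) : nexp d (nlog d N) = 1 + N :=
  nexp_nlog h (hd _ hN)
end nexp

section
variable {V : Type*} [NormedAddCommGroup V] [NormedSpace ℝ V] [FiniteDimensional ℝ V]
variable (V) in
/-- total dimension -/
abbrev dimE := Module.finrank ℝ (V × ℝ)

lemma dimE_pos : 1 ≤ dimE V := by
  have : 0 < Module.finrank ℝ (V × ℝ) := Module.finrank_pos
  exact this

lemma nilBound_end : NilBound (EndV V) (dimE V) := by
  intro N hN
  have h1 : IsNilpotent (N : (V × ℝ) →ₗ[ℝ] (V × ℝ)) := by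
    obtain ⟨k, hk⟩ := hN
    exact ⟨k, by rw [← ContinuousLinearMap.toLinearMap_pow, hk]; rfl⟩
  have h2 := LinearMap.aeval_self_charpoly (N : (V × ℝ) →ₗ[ℝ] (V × ℝ))
  rw [IsNilpotent.charpoly_eq_X_pow_finrank h1, map_pow, aeval_X,
    ← ContinuousLinearMap.toLinearMap_pow] at h2
  exact ContinuousLinearMap.coe_injective h2
end
end
end

section
noncomputable section
open Topology

/-- Euclidean space -/
abbrev Vn (n : ℕ) := EuclideanSpace ℝ (Fin n)

/-- standard basis -/
abbrev bV (n : ℕ) : Module.Basis (Fin n) ℝ (Vn n) := (EuclideanSpace.basisFun (Fin n) ℝ).toBasis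

/-- inclusion of the standard lattice -/
def latt (n : ℕ) : (Fin n → ℤ) →+ Vn n where
  toFun m := ∑ i, (m i : ℝ) • bV n i
  map_zero' := by simp
  map_add' := by intro a b; simp [add_smul, Finset.sum_add_distrib]

lemma latt_apply {n : ℕ} (m : Fin n → ℤ) (i : Fin n) : latt n m i = (m i : ℝ) := by
  simp [latt, Finset.sum_apply, Pi.single_apply]

lemma latt_inj (n : ℕ) : Function.Injective (latt n) := by
  intro a b h
  ext i
  have := congrArg (fun v : Vn n => v i) h
  simpa [latt_apply] using this

lemma latt_single {n : ℕ} (i : Fin n) : latt n (Pi.single i 1) = bV n i := by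
  simp [latt, Pi.single_apply]

section
variable {W : Type*} [AddCommGroup W] [Module ℝ W] {n : ℕ}

/-- linear extension of a homomorphism on the lattice -/
def extL (f : (Fin n → ℤ) →+ W) : Vn n →ₗ[ℝ] W :=
  (bV n).constr ℝ fun i => f (Pi.single i 1)

lemma extL_latt (f : (Fin n → ℤ) →+ W) (m : Fin n → ℤ) : extL f (latt n m) = f m := by
  have : (extL f).toAddMonoidHom.comp (latt n) = f := by
    ext i
    simp only [AddMonoidHom.comp_apply, LinearMap.toAddMonoidHom_coe, AddMonoidHom.single_apply]
    rw [latt_single, extL, Module.Basis.constr_basis]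
  exact DFunLike.congr_fun this m

lemma lin_ext_latt {f g : Vn n →ₗ[ℝ] W} (h : ∀ m, f (latt n m) = g (latt n m)) : f = g := by
  apply (bV n).ext
  intro i
  rw [← latt_single]; exact h _
end

/-- linearised data of a Bieberbach group -/
structure GData (n : ℕ) (Δ : Type*) [Group Δ] (Z : Subgroup Δ) where
  /-- the holonomy representation -/
  α : Δ →* (Vn n →L[ℝ] Vn n)
  /-- the translation cocycle -/
  c : Δ → Vn n
  /-- the lattice isomorphism -/
  ζ : ↥Z ≃* Multiplicative (Fin n → ℤ)
  c_mul : ∀ δ ε, c (δ * ε) = c δ + α δ (c ε)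
  c_Z : ∀ z : Z, c z = latt n (ζ z).toAdd
  α_Z : ∀ z ∈ Z, α z = 1
  α_ker : ∀ δ, α δ = 1 → δ ∈ Z

section
variable {n : ℕ} {Δ : Type*} [Group Δ] (Z : Subgroup Δ) (hnorm : Z.Normal)
  (ζ : ↥Z ≃* Multiplicative (Fin n → ℤ))

/-- conjugation on the lattice -/
def cjZ (δ : Δ) : (Fin n → ℤ) →+ (Fin n → ℤ) where
  toFun m := (ζ ⟨δ * (ζ.symm (Multiplicative.ofAdd m) : Δ) * δ⁻¹,
    hnorm.conj_mem _ (Subtype.coe_prop _) δ⟩).toAdd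
  map_zero' := by
    have : (⟨δ * (ζ.symm (Multiplicative.ofAdd 0) : Δ) * δ⁻¹,
      hnorm.conj_mem _ (Subtype.coe_prop _) δ⟩ : Z) = 1 := by
      apply Subtype.ext
      simp
    rw [this, map_one]; rfl
  map_add' a b := by
    rw [← toAdd_mul, ← map_mul]
    congr 2
    apply Subtype.ext
    simp

lemma cjZ_apply (δ : Δ) (z z' : Z) (h : (z' : Δ) = δ * z * δ⁻¹) :
    cjZ Z hnorm ζ δ (ζ z).toAdd = (ζ z').toAdd := by
  simp only [cjZ, AddMonoidHom.coe_mk, ZeroHom.coe_mk]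
  congr 2
  apply Subtype.ext
  simp [h]

/-- holonomy -/
def holL (δ : Δ) : Vn n →ₗ[ℝ] Vn n := extL ((latt n).comp (cjZ Z hnorm ζ δ))

lemma holL_latt (δ : Δ) (z z' : Z) (h : (z' : Δ) = δ * z * δ⁻¹) :
    holL Z hnorm ζ δ (latt n (ζ z).toAdd) = latt n (ζ z').toAdd := by
  rw [holL, extL_latt, AddMonoidHom.comp_apply, cjZ_apply Z hnorm ζ δ z z' h]

lemma hol_ext {f g : Vn n →ₗ[ℝ] Vn n}
    (h : ∀ z : Z, f (latt n (ζ z).toAdd) = g (latt n (ζ z).toAdd)) : f = g := by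
  apply lin_ext_latt
  intro m
  have := h (ζ.symm (Multiplicative.ofAdd m))
  simpa using this

theorem exists_gdata (hnorm : Z.Normal) (ζ : ↥Z ≃* Multiplicative (Fin n → ℤ))
    (hfi : Z.FiniteIndex) (hc : Subgroup.centralizer (Z : Set Δ) = Z) :
    Nonempty (GData n Δ Z) := by
  have conj : ∀ δ (z : Z), ∃ z' : Z, (z' : Δ) = δ * z * δ⁻¹ := fun δ z =>
    ⟨⟨_, hnorm.conj_mem _ z.2 δ⟩, rfl⟩
  let α : Δ →* (Vn n →L[ℝ] Vn n) :=
    { toFun := fun δ => LinearMap.toContinuousLinearMap (holL Z hnorm ζ δ)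
      map_one' := by
        apply ContinuousLinearMap.coe_injective
        apply hol_ext Z ζ
        intro z
        exact holL_latt Z hnorm ζ 1 z z (by simp)
      map_mul' := by
        intro δ ε
        apply ContinuousLinearMap.coe_injective
        apply hol_ext Z ζ
        intro z
        obtain ⟨z1, h1⟩ := conj ε z
        obtain ⟨z2, h2⟩ := conj δ z1
        change holL Z hnorm ζ (δ * ε) _ = holL Z hnorm ζ δ (holL Z hnorm ζ ε _)
        rw [holL_latt Z hnorm ζ ε z z1 h1, holL_latt Z hnorm ζ δ z1 z2 h2,
          holL_latt Z hnorm ζ (δ * ε) z z2 (by rw [h2, h1]; group)] }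
  have hα : ∀ δ (z z' : Z), (z' : Δ) = δ * z * δ⁻¹ →
    α δ (latt n (ζ z).toAdd) = latt n (ζ z').toAdd := holL_latt Z hnorm ζ
  let s : Δ ⧸ Z → Δ := Quotient.out
  have hs : ∀ f : Δ ⧸ Z, ((s f : Δ) : Δ ⧸ Z) = f := fun f => Quotient.out_eq' f
  have hsZ : ∀ (δ : Δ) (f : Δ ⧸ Z), δ * s f * (s (δ • f))⁻¹ ∈ Z := by
    intro δ f
    have h1 : (s (δ • f))⁻¹ * (δ * s f) ∈ Z := by
      rw [← QuotientGroup.eq, hs]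
      conv_lhs => rw [← hs f]
      rfl
    have h2 := hnorm.conj_mem _ h1 (s (δ • f))
    simpa [mul_assoc] using h2
  let b : Δ → Δ ⧸ Z → Vn n := fun δ f => latt n (ζ ⟨_, hsZ δ f⟩).toAdd
  have : Fintype (Δ ⧸ Z) := Subgroup.fintypeQuotientOfFiniteIndex
  have hb : ∀ δ ε f, b (δ * ε) f = b δ (ε • f) + α δ (b ε f) := by
    intro δ ε f
    obtain ⟨z', hz'⟩ := conj δ ⟨_, hsZ ε f⟩
    simp only [b]
    rw [hα δ _ z' hz', add_comm, ← map_add, ← toAdd_mul, ← map_mul]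
    congr 3
    apply Subtype.ext
    simp only [Subgroup.coe_mul, hz', mul_smul]
    group
  let q : ℝ := (Fintype.card (Δ ⧸ Z) : ℝ)
  have hq : q ≠ 0 := by simp [q]
  refine ⟨⟨α, fun δ => q⁻¹ • ∑ f, b δ f, ζ, ?_, ?_, ?_, ?_⟩⟩
  · intro δ ε
    simp only [hb, Finset.sum_add_distrib, smul_add, map_smul, map_sum]
    congr 2
    exact (Equiv.sum_comp (MulAction.toPerm ε : Equiv.Perm (Δ ⧸ Z)) (b δ))
  · intro z
    have : ∀ f, b z f = latt n (ζ z).toAdd := by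
      intro f
      have h1 : (z : Δ) • f = f := by
        conv_lhs => rw [← hs f]
        conv_rhs => rw [← hs f]
        change ((((z : Δ) * s f : Δ)) : Δ ⧸ Z) = _
        rw [eq_comm, QuotientGroup.eq]
        have := hnorm.conj_mem _ z.2 (s f)⁻¹
        simpa [mul_assoc] using this
      simp only [b]
      congr 3
      apply Subtype.ext
      simp [h1]
    simp only [this, Finset.sum_const, Finset.card_univ]
    rw [← Nat.cast_smul_eq_nsmul ℝ, smul_smul, inv_mul_cancel₀ hq, one_smul]
  · intro w hw
    apply ContinuousLinearMap.coe_injective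
    apply hol_ext Z ζ
    intro z
    refine holL_latt Z hnorm ζ w z z ?_
    have : (⟨w, hw⟩ : Z) * z = z * ⟨w, hw⟩ := by
      apply ζ.injective
      rw [map_mul, map_mul, mul_comm]
    have h2 := congrArg (Subtype.val) this
    simp only [Subgroup.coe_mul] at h2
    rw [h2]; group
  · intro δ hδ
    rw [← hc, Subgroup.mem_centralizer_iff]
    intro z hz
    obtain ⟨z', hz'⟩ := conj δ ⟨z, hz⟩
    have h1 := hα δ _ z' hz'
    rw [hδ] at h1
    have h2 := ζ.injective (Multiplicative.toAdd.injective (latt_inj n h1))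
    rw [← h2] at hz'
    simp only at hz'
    conv_lhs => rw [hz']
    group
end
end
end

section
noncomputable section
open Topology Polynomial

/-- bicommutant -/
def bicomm {R : Type*} [Ring R] [Algebra ℝ R] (S : Set R) : Subalgebra ℝ R :=
  Subalgebra.centralizer ℝ (Subalgebra.centralizer ℝ S : Set R)

section
variable {R : Type*} [Ring R] [Algebra ℝ R] {S : Set R}

lemma subset_bicomm {a : R} (ha : a ∈ S) : a ∈ bicomm S := by
  rw [bicomm, Subalgebra.mem_centralizer_iff]
  intro g hg
  exact ((Subalgebra.mem_centralizer_iff ℝ).1 hg a ha).symm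

lemma bicomm_comm (hS : ∀ a ∈ S, ∀ b ∈ S, a * b = b * a) {a b : R} (ha : a ∈ bicomm S)
    (hb : b ∈ bicomm S) : Commute a b := by
  have h1 : a ∈ Subalgebra.centralizer ℝ S := by
    rw [Subalgebra.mem_centralizer_iff]
    intro g hg
    have : g ∈ Subalgebra.centralizer ℝ S := (Subalgebra.mem_centralizer_iff ℝ).2
      fun k hk => hS k hk g hg
    exact ((Subalgebra.mem_centralizer_iff ℝ).1 ha g this)
  exact ((Subalgebra.mem_centralizer_iff ℝ).1 hb a h1)

lemma aeval_mem_sub (B : Subalgebra ℝ R) {a : R} (ha : a ∈ B) (q : ℝ[X]) : aeval a q ∈ B := by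
  have := Polynomial.aeval_algHom_apply B.val ⟨a, ha⟩ q
  simp only [Subalgebra.coe_val] at this
  rw [this]; exact Subtype.coe_prop _

lemma nexp_mem_sub (B : Subalgebra ℝ R) {a : R} (ha : a ∈ B) (d : ℕ) : nexp d a ∈ B :=
  B.sum_mem fun k _ => B.smul_mem (B.pow_mem ha k) _

/-- the polynomial idempotent onto the nilpotent part -/
lemma exists_idem_poly [FiniteDimensional ℝ R] (T : R) : ∃ g : ℝ[X],
    aeval T (1 + X * g) * aeval T (1 + X * g) = aeval T (1 + X * g) ∧
    IsNilpotent (aeval T (1 + X * g) * T) := by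
  obtain ⟨p, hp0, hp⟩ : ∃ p : ℝ[X], p ≠ 0 ∧ aeval T p = 0 :=
    ⟨minpoly ℝ T, minpoly.ne_zero (Algebra.IsIntegral.isIntegral T), minpoly.aeval ℝ T⟩
  obtain ⟨k, q, hq, hpq⟩ : ∃ (k : ℕ) (q : ℝ[X]), ¬ X ∣ q ∧ p = X ^ k * q := by
    obtain ⟨q, h1, h2⟩ := Polynomial.exists_eq_pow_rootMultiplicity_mul_and_not_dvd p hp0 0
    simp only [C_0, sub_zero] at h1 h2
    exact ⟨_, q, h2, h1⟩
  have hcop : IsCoprime (X ^ (k + 1) : ℝ[X]) q :=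
    ((Polynomial.irreducible_X.coprime_iff_not_dvd).2 hq).pow_left
  obtain ⟨a, b, hab⟩ := hcop
  refine ⟨- (a * X ^ k), ?_⟩
  have hh : (1 + X * (-(a * X ^ k)) : ℝ[X]) = b * q := by
    rw [← hab]; ring
  rw [hh]
  have h0 : aeval T (b * q) * aeval T (X ^ (k + 1) : ℝ[X]) = 0 := by
    rw [← map_mul, show (b * q * X ^ (k + 1) : ℝ[X]) = b * X * (X ^ k * q) by ring, ← hpq, map_mul, hp,
      mul_zero]
  constructor
  · have h1 : aeval T (b * q) * aeval T (1 - b * q) = 0 := by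
      rw [show (1 - b * q : ℝ[X]) = X ^ (k + 1) * a by rw [← hab]; ring,
        map_mul (aeval T) (X ^ (k + 1)) a, ← mul_assoc, h0,
        zero_mul]
    rw [map_sub, map_one, mul_sub, mul_one, sub_eq_zero] at h1
    exact h1.symm
  · refine ⟨k + 1, ?_⟩
    rw [((aeval_commute T (b * q)).symm).mul_pow, pow_succ, mul_assoc]
    have : T ^ (k + 1) = aeval T (X ^ (k + 1) : ℝ[X]) := by simp
    rw [this, h0, mul_zero]
end

section
variable {V : Type*} [NormedAddCommGroup V] [NormedSpace ℝ V] [FiniteDimensional ℝ V]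

lemma exists_idem_fin {ι : Type*} (s : Finset ι) (T : ι → EndV V) (B : Subalgebra ℝ (EndV V))
    (hB : ∀ a ∈ B, ∀ b ∈ B, Commute a b) (hT : ∀ i, T i ∈ B) (hl : ∀ i x, (T i x).2 = 0) :
    ∃ e ∈ B, e * e = e ∧ (∀ i ∈ s, IsNilpotent (e * T i)) ∧ ∀ x, (e x).2 = x.2 := by
  classical
  induction s using Finset.induction_on with
  | empty => exact ⟨1, B.one_mem, by simp, by simp, fun x => rfl⟩
  | insert j s _ ih =>
    obtain ⟨e, heB, hee, hes, hel⟩ := ih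
    obtain ⟨g, hg1, hg2⟩ := exists_idem_poly (T j)
    set h := aeval (T j) (1 + X * g) with hh
    have hhB : h ∈ B := aeval_mem_sub B (hT j) _
    have ceh := hB _ heB _ hhB
    refine ⟨e * h, B.mul_mem heB hhB, ?_, ?_, ?_⟩
    · calc e * h * (e * h) = e * (h * e) * h := by simp only [mul_assoc]
        _ = (e * e) * (h * h) := by rw [← ceh.eq]; simp only [mul_assoc]
        _ = e * h := by rw [hee, hg1]
    · intro i hi
      rcases Finset.mem_insert.1 hi with rfl | hi
      · rw [mul_assoc]
        exact (hB _ heB _ (B.mul_mem hhB (hT _))).isNilpotent_mul_left hg2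
      · rw [ceh.eq, mul_assoc]
        exact (hB _ hhB _ (B.mul_mem heB (hT _))).isNilpotent_mul_left (hes i hi)
    · intro x
      rw [mul_apply_eq_comp, hel, hh, map_add, map_one, map_mul, aeval_X]
      change (x + T j (aeval (T j) g x)).2 = _
      rw [Prod.snd_add, hl, add_zero]
end

section
variable {n : ℕ} {R : Type*} [Ring R] [Algebra ℝ R]

lemma constr_mem (B : Subalgebra ℝ R) {N : Fin n → R} (hN : ∀ i, N i ∈ B) (v : Vn n) :
    (bV n).constr ℝ N v ∈ B := by
  rw [Module.Basis.constr_apply_fintype]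
  exact B.sum_mem fun i _ => B.smul_mem (hN i) _

lemma constr_nil (B : Subalgebra ℝ R) (hB : ∀ a ∈ B, ∀ b ∈ B, Commute a b)
    {N : Fin n → R} (hN : ∀ i, N i ∈ B) (hnil : ∀ i, IsNilpotent (N i)) (v : Vn n) :
    IsNilpotent ((bV n).constr ℝ N v) := by
  rw [Module.Basis.constr_apply_fintype]
  have : ∀ s : Finset (Fin n), IsNilpotent (∑ i ∈ s, (bV n).equivFun v i • N i) := by
    intro s
    induction s using Finset.induction_on with
    | empty => simp
    | insert j s hj ih =>
      rw [Finset.sum_insert hj]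
      refine Commute.isNilpotent_add (hB _ (B.smul_mem (hN j) _) _
        (B.sum_mem fun i _ => B.smul_mem (hN i) _)) ?_ ih
      exact (hnil j).smul _
  exact this _

lemma lattice_span (H : AddSubgroup (Fin n → ℤ)) (h : ∀ i, Pi.single i 1 ∈ H) (m : Fin n → ℤ) :
    m ∈ H := by
  have : m = ∑ i, m i • (Pi.single i (1 : ℤ) : Fin n → ℤ) := by
    ext j
    simp [Finset.sum_apply, Pi.single_apply]
  rw [this]
  exact H.sum_mem fun i _ => H.zsmul_mem (h i) _
end

lemma nexp_apply_fix {V : Type*} [NormedAddCommGroup V] [NormedSpace ℝ V] [FiniteDimensional ℝ V]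
    {d : ℕ} (hd : 1 ≤ d) (N : EndV V) (w : V × ℝ) (h : N w = 0) : nexp d N w = w := by
  obtain ⟨d, rfl⟩ : ∃ e, d = e + 1 := ⟨d - 1, by omega⟩
  rw [nexp, Finset.sum_range_succ']
  simp [pow_succ, h]

lemma nexp_continuous {V : Type*} [NormedAddCommGroup V] [NormedSpace ℝ V] [FiniteDimensional ℝ V]
    (d : ℕ) : Continuous (nexp d : EndV V → EndV V) := by
  unfold nexp
  fun_prop

/-- the properly discontinuous lattice acts freely in every direction -/
lemma lattice_free {n : ℕ} (τ : Multiplicative (Fin n → ℤ) →* (Vn n ≃ᵃ[ℝ] Vn n))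
    (hPD : ∀ K : Set (Vn n), IsCompact K → {m | ((τ m '' K) ∩ K).Nonempty}.Finite)
    (φ : Vn n →ₗ[ℝ] EndV (Vn n)) (hcomm : ∀ v v', Commute (φ v) (φ v'))
    (hnil : ∀ v, IsNilpotent (φ v)) (w0 : Vn n)
    (hτ : ∀ m, nexp (dimE (Vn n)) (φ (latt n m)) (w0, 1) = affL (τ (Multiplicative.ofAdd m)) (w0, 1))
    (v : Vn n) (hv : φ v (w0, 1) = 0) : v = 0 := by
  set d := dimE (Vn n) with hdd
  have hd : NilBound (EndV (Vn n)) d := nilBound_end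
  have hd1 : 1 ≤ d := dimE_pos
  let ψ : Vn n → Vn n := fun r => (nexp d (- φ r) (w0, 1)).1
  have hψ : Continuous ψ := by
    have h1 : Continuous φ := φ.continuous_of_finiteDimensional
    have h2 : Continuous fun r => nexp d (- φ r) := (nexp_continuous d).comp h1.neg
    exact continuous_fst.comp (h2.clm_apply continuous_const)
  let K : Set (Vn n) := ψ '' (WithLp.toLp 2 '' Set.Icc (0 : Fin n → ℝ) 1)
  have hK : IsCompact K := (isCompact_Icc.image (PiLp.continuous_toLp 2 _)).image hψ
  have hw0 : w0 ∈ K := by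
    refine ⟨0, ⟨0, ⟨le_rfl, zero_le_one⟩, rfl⟩, ?_⟩
    simp [ψ, nexp_zero hd1]
  have hfin := hPD K hK
  let z : ℕ → Fin n → ℤ := fun k i => ⌊(k : ℝ) * v i⌋
  have hz : ∀ k, Multiplicative.ofAdd (z k) ∈ {m | ((τ m '' K) ∩ K).Nonempty} := by
    intro k
    refine ⟨τ (Multiplicative.ofAdd (z k)) w0, ⟨w0, hw0, rfl⟩, ?_⟩
    let r : Fin n → ℝ := fun i => Int.fract ((k : ℝ) * v i)
    refine ⟨_, ⟨r, ⟨fun i => Int.fract_nonneg _, fun i => (Int.fract_lt_one _).le⟩, rfl⟩, ?_⟩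
    have h1 : latt n (z k) = -(WithLp.toLp 2 r : Vn n) + (k : ℝ) • v := by
      ext i
      rw [latt_apply]
      simp only [PiLp.add_apply, PiLp.neg_apply, PiLp.smul_apply, smul_eq_mul, r, z]
      have := Int.floor_add_fract ((k : ℝ) * v i)
      linarith
    have h2 := hτ (z k)
    rw [affL_one_apply, h1, map_add, nexp_add' hd (hcomm _ _) (hnil _) (hnil _),
      mul_apply_eq_comp, nexp_apply_fix hd1 (φ ((k : ℝ) • v)) _ (by simp [hv]), map_neg] at h2
    simp only [ψ]
    rw [h2]
  by_contra hne
  obtain ⟨i, hi⟩ : ∃ i, v i ≠ 0 := by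
    by_contra hcon
    push Not at hcon
    exact hne (by ext i; simpa using hcon i)
  have hfin2 : (Set.range fun k => z k i).Finite := by
    refine (hfin.image (fun m => m.toAdd i)).subset ?_
    rintro _ ⟨k, rfl⟩
    exact ⟨_, hz k, rfl⟩
  obtain ⟨C, hC⟩ := (hfin2.image (fun t : ℤ => |(t : ℝ)|)).bddAbove
  obtain ⟨k, hk⟩ := Archimedean.arch (C + 2) (abs_pos.2 hi)
  have h3 : |((z k i : ℤ) : ℝ)| ≤ C := hC ⟨_, ⟨k, rfl⟩, rfl⟩
  have h4 : |(k : ℝ) * v i| ≤ C + 1 := by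
    have := Int.floor_add_fract ((k : ℝ) * v i)
    have h5 := Int.fract_nonneg ((k : ℝ) * v i)
    have h6 := Int.fract_lt_one ((k : ℝ) * v i)
    rw [← this]
    refine (abs_add_le _ _).trans (add_le_add h3 ?_)
    rw [abs_of_nonneg h5]; exact h6.le
  rw [abs_mul, Nat.abs_cast] at h4
  rw [nsmul_eq_mul] at hk
  linarith

/-- logarithm of a lattice representation -/
def latLog {n : ℕ} (τ : Multiplicative (Fin n → ℤ) →* (Vn n ≃ᵃ[ℝ] Vn n)) :
    Vn n →ₗ[ℝ] EndV (Vn n) :=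
  (bV n).constr ℝ fun i =>
    nlog (dimE (Vn n)) (affL (τ (Multiplicative.ofAdd (Pi.single i 1))) - 1)

lemma constr_snd {n : ℕ} {N : Fin n → EndV (Vn n)} (hN : ∀ i x, (N i x).2 = 0) (v : Vn n)
    (x : Vn n × ℝ) : ((bV n).constr ℝ N v x).2 = 0 := by
  rw [Module.Basis.constr_apply_fintype]
  rw [sum_apply, Prod.snd_sum]
  refine Finset.sum_eq_zero fun i _ => ?_
  simp [hN]

lemma nlog_snd {n : ℕ} {a : EndV (Vn n)} (ha : ∀ x, (a x).2 = 0) (d : ℕ) (x : Vn n × ℝ) :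
    (nlog d a x).2 = 0 := by
  obtain ⟨q, hq⟩ := plog_dvd d
  rw [nlog, hq, map_mul, aeval_X, mul_apply_eq_comp]
  exact ha _

theorem latLog_spec {n : ℕ} (τ : Multiplicative (Fin n → ℤ) →* (Vn n ≃ᵃ[ℝ] Vn n))
    (hPD : ∀ K : Set (Vn n), IsCompact K → {m | ((τ m '' K) ∩ K).Nonempty}.Finite) :
    (∀ v v', Commute (latLog τ v) (latLog τ v')) ∧ (∀ v, IsNilpotent (latLog τ v)) ∧
    (∀ v x, (latLog τ v x).2 = 0) ∧
    (∀ m, nexp (dimE (Vn n)) (latLog τ (latt n m)) = affL (τ (Multiplicative.ofAdd m))) ∧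
    ∀ x v, latLog τ v (x, 1) = 0 → v = 0 := by
  set d := dimE (Vn n) with hdd
  have hd : NilBound (EndV (Vn n)) d := nilBound_end
  have hd1 : 1 ≤ d := dimE_pos
  set B := bicomm (Set.range fun m => affL (τ m)) with hBdef
  have hB : ∀ a ∈ B, ∀ b ∈ B, Commute a b := by
    intro a ha b hb
    refine bicomm_comm ?_ ha hb
    rintro _ ⟨m, rfl⟩ _ ⟨m', rfl⟩
    change affL (τ m) * affL (τ m') = affL (τ m') * affL (τ m)
    rw [← map_mul, ← map_mul, ← map_mul, ← map_mul, mul_comm]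
  have hτB : ∀ m, affL (τ m) ∈ B := fun m => subset_bicomm ⟨m, rfl⟩
  let T : Fin n → EndV (Vn n) := fun i => affL (τ (Multiplicative.ofAdd (Pi.single i 1))) - 1
  have hTB : ∀ i, T i ∈ B := fun i => B.sub_mem (hτB _) B.one_mem
  have hTs : ∀ i x, (T i x).2 = 0 := by
    intro i x
    change (affL _ x - x).2 = 0
    rw [Prod.snd_sub, affL_snd, sub_self]
  obtain ⟨e, heB, hee, hen, hes⟩ := exists_idem_fin Finset.univ T B hB hTB hTs
  replace hen : ∀ i, IsNilpotent (e * T i) := fun i => hen i (Finset.mem_univ i)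
  have heTB : ∀ i, e * T i ∈ B := fun i => B.mul_mem heB (hTB i)
  let N : Fin n → EndV (Vn n) := fun i => nlog d (e * T i)
  have hNB : ∀ i, N i ∈ B := fun i => aeval_mem_sub B (heTB i) _
  have hNn : ∀ i, IsNilpotent (N i) := fun i => nlog_nil d (hen i)
  have hNs : ∀ i x, (N i x).2 = 0 := fun i x => nlog_snd (fun x => by
    rw [mul_apply_eq_comp, hes, hTs]) d x
  set φ := (bV n).constr ℝ N with hφ
  have hφB : ∀ v, φ v ∈ B := fun v => constr_mem B hNB v
  have hφc : ∀ v v', Commute (φ v) (φ v') := fun v v' => hB _ (hφB v) _ (hφB v')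
  have hφn : ∀ v, IsNilpotent (φ v) := fun v => constr_nil B hB hNB hNn v
  have hφs : ∀ v x, (φ v x).2 = 0 := fun v x => constr_snd hNs v x
  have hexp : ∀ m, nexp d (φ (latt n m)) * e = affL (τ (Multiplicative.ofAdd m)) * e := by
    let H : AddSubgroup (Fin n → ℤ) :=
      { carrier := {m | nexp d (φ (latt n m)) * e = affL (τ (Multiplicative.ofAdd m)) * e}
        zero_mem' := by
          change nexp d (φ (latt n 0)) * e = affL (τ (Multiplicative.ofAdd 0)) * e
          rw [map_zero, map_zero, nexp_zero hd1, ofAdd_zero, map_one, map_one]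
        add_mem' := by
          intro a b ha hb
          change nexp d (φ (latt n a)) * e = affL (τ (Multiplicative.ofAdd a)) * e at ha
          change nexp d (φ (latt n b)) * e = affL (τ (Multiplicative.ofAdd b)) * e at hb
          change nexp d (φ (latt n (a + b))) * e = affL (τ (Multiplicative.ofAdd (a + b))) * e
          rw [map_add, map_add, nexp_add' hd (hφc _ _) (hφn _) (hφn _), mul_assoc, hb, ← mul_assoc,
            (hB _ (nexp_mem_sub B (hφB (latt n a)) d) _ (hτB (Multiplicative.ofAdd b))).eq,
            mul_assoc, ha, ← mul_assoc, ← map_mul, ← map_mul, ← ofAdd_add, add_comm b a]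
        neg_mem' := by
          intro a ha
          change nexp d (φ (latt n a)) * e = affL (τ (Multiplicative.ofAdd a)) * e at ha
          change nexp d (φ (latt n (-a))) * e = affL (τ (Multiplicative.ofAdd (-a))) * e
          have h1 : affL (τ (Multiplicative.ofAdd (-a))) * affL (τ (Multiplicative.ofAdd a)) = 1 := by
            rw [← map_mul, ← map_mul, ← ofAdd_add, neg_add_cancel, ofAdd_zero, map_one, map_one]
          have h2 := nexp_neg hd hd1 (hφn (latt n a))
          have c1 := hB _ (nexp_mem_sub B (hφB (latt n (-a))) d) _ (hτB (Multiplicative.ofAdd (-a)))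
          have c2 := hB _ (nexp_mem_sub B (hφB (latt n a)) d) _ (nexp_mem_sub B (hφB (latt n (-a))) d)
          rw [map_neg, map_neg] at c1 c2 ⊢
          calc nexp d (-φ (latt n a)) * e
              = nexp d (-φ (latt n a)) * ((affL (τ (Multiplicative.ofAdd (-a))) *
                  affL (τ (Multiplicative.ofAdd a))) * e) := by rw [h1, one_mul]
            _ = nexp d (-φ (latt n a)) * (affL (τ (Multiplicative.ofAdd (-a))) *
                  (nexp d (φ (latt n a)) * e)) := by rw [mul_assoc, ← ha]
            _ = affL (τ (Multiplicative.ofAdd (-a))) * ((nexp d (φ (latt n a)) *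
                  nexp d (-φ (latt n a))) * e) := by
                rw [← mul_assoc, c1.eq, c2.eq]; simp only [mul_assoc]
            _ = _ := by rw [h2, one_mul] }
    refine lattice_span H fun i => ?_
    change nexp d (φ (latt n (Pi.single i 1))) * e =
      affL (τ (Multiplicative.ofAdd (Pi.single i 1))) * e
    rw [latt_single, hφ, Module.Basis.constr_basis, nexp_nlog' hd hd1 (hen i), add_mul, one_mul,
      mul_assoc, (hB _ (hTB i) _ heB).eq, ← mul_assoc, hee, ← (hB _ (hTB i) _ heB).eq, sub_mul,
      one_mul, add_sub_cancel]
  set w := e (0, 1) with hw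
  have hw2 : w.2 = 1 := hes _
  have hww : w = (w.1, 1) := Prod.ext rfl hw2
  have hew : e w = w := by rw [hw, ← mul_apply_eq_comp, hee]
  have hinj : ∀ v, φ v w = 0 → v = 0 := by
    intro v hv
    refine lattice_free τ hPD φ hφc hφn w.1 ?_ v (by rwa [← hww])
    intro m
    have h1 := DFunLike.congr_fun (hexp m) w
    rw [mul_apply_eq_comp, mul_apply_eq_comp, hew] at h1
    rw [← hww]; exact h1
  let Lw : Vn n →ₗ[ℝ] Vn n :=
    (LinearMap.fst ℝ (Vn n) ℝ).comp ((evalL w).comp φ)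
  have hLw : ∀ v, (φ v w) = (Lw v, 0) := fun v => Prod.ext rfl (hφs v w)
  have hLi : Function.Injective Lw := by
    rw [← LinearMap.ker_eq_bot, LinearMap.ker_eq_bot']
    intro v hv
    exact hinj v (by rw [hLw, hv]; rfl)
  have hLs : Function.Surjective Lw := LinearMap.injective_iff_surjective.1 hLi
  have he1 : e = 1 := by
    apply ContinuousLinearMap.ext
    intro x
    obtain ⟨v, hv⟩ := hLs (x.1 - x.2 • w.1)
    have hx : x = φ v w + x.2 • w := by
      rw [hLw, hv]
      refine Prod.ext ?_ ?_
      · simp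
      · simp [hw2]
    have h1 : e (φ v w) = φ v w := by
      rw [← mul_apply_eq_comp, (hB _ heB _ (hφB v)).eq, mul_apply_eq_comp, hew]
    change e x = x
    conv_lhs => rw [hx]
    rw [map_add, map_smul, h1, hew, ← hx]
  have hφL : latLog τ = φ := by
    rw [latLog, hφ]
    congr 1
    ext1 i
    simp only [N, T, he1, one_mul, hdd]
  rw [hφL]
  have hexp' : ∀ m, nexp d (φ (latt n m)) = affL (τ (Multiplicative.ofAdd m)) := by
    intro m
    have := hexp m
    rwa [he1, mul_one, mul_one] at this
  refine ⟨hφc, hφn, hφs, hexp', fun x v hv => ?_⟩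
  exact lattice_free τ hPD φ hφc hφn x (fun m => by rw [hexp']) v hv
end
end

section
noncomputable section
open Topology Polynomial

section
variable {n : ℕ} {Δ : Type*} [Group Δ] {Z : Subgroup Δ}

lemma GData.c_one (D : GData n Δ Z) : D.c 1 = 0 := by
  have := D.c_mul 1 1
  rw [map_one, mul_one] at this
  change D.c 1 = D.c 1 + D.c 1 at this
  exact left_eq_add.1 this

lemma GData.c_eq_zero (D : GData n Δ Z) (z : Z) (h : D.c z = 0) : z = 1 := by
  rw [D.c_Z, ← map_zero (latt n)] at h
  have := latt_inj n h
  have h2 : D.ζ z = 1 := this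
  exact (MulEquiv.map_eq_one_iff _).1 h2

/-- linear part extended to `V × ℝ` -/
def alH (D : GData n Δ Z) : Δ →* EndV (Vn n) where
  toFun δ := (D.α δ).prodMap (ContinuousLinearMap.id ℝ ℝ)
  map_one' := by
    rw [map_one]
    apply ContinuousLinearMap.ext; intro x; rfl
  map_mul' δ ε := by
    rw [map_mul]
    apply ContinuousLinearMap.ext; intro x; rfl

lemma alH_apply (D : GData n Δ Z) (δ : Δ) (x : Vn n × ℝ) : alH D δ x = (D.α δ x.1, x.2) := rfl

/-- the algebraic conditions on the normal form -/
structure IsY (D : GData n Δ Z) (φ : Vn n →ₗ[ℝ] EndV (Vn n)) : Prop where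
  comm : ∀ v v', φ v * φ v' = φ v' * φ v
  snd : ∀ v x, (φ v x).2 = 0
  ev : ∀ v, φ v (0, 1) = (v, 0)
  nil : ∀ v, (φ v) ^ (dimE (Vn n)) = 0
  eqv : ∀ δ v, alH D δ * φ v = φ (D.α δ v) * alH D δ

lemma nexp_snd {N : EndV (Vn n)} (hN : ∀ x, (N x).2 = 0) {d : ℕ} (hd : 1 ≤ d) (x : Vn n × ℝ) :
    (nexp d N x).2 = x.2 := by
  obtain ⟨d, rfl⟩ : ∃ e, d = e + 1 := ⟨d - 1, by omega⟩
  rw [nexp, Finset.sum_range_succ']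
  simp only [pow_succ', pow_zero, Nat.factorial_zero, Nat.cast_one, inv_one, one_smul]
  rw [add_apply, sum_apply, Prod.snd_add, Prod.snd_sum, Finset.sum_eq_zero]
  · simp
  · intro i _
    simp [hN]


/-- abbreviation for the nilpotency bound -/
abbrev dd (n : ℕ) : ℕ := dimE (Vn n)

lemma dd_pos : 1 ≤ dd n := dimE_pos
lemma dd_nil : NilBound (EndV (Vn n)) (dd n) := nilBound_end

lemma IsY.isNil {D : GData n Δ Z} {φ : Vn n →ₗ[ℝ] EndV (Vn n)} (h : IsY D φ) (v : Vn n) :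
    IsNilpotent (φ v) := ⟨_, h.nil v⟩

lemma IsY.nexp_add {D : GData n Δ Z} {φ : Vn n →ₗ[ℝ] EndV (Vn n)} (h : IsY D φ) (v w : Vn n) :
    nexp (dd n) (φ (v + w)) = nexp (dd n) (φ v) * nexp (dd n) (φ w) := by
  rw [map_add, nexp_add' dd_nil (h.comm v w) (h.isNil v) (h.isNil w)]

lemma IsY.nexp_alH {D : GData n Δ Z} {φ : Vn n →ₗ[ℝ] EndV (Vn n)} (h : IsY D φ) (δ : Δ)
    (v : Vn n) : alH D δ * nexp (dd n) (φ v) = nexp (dd n) (φ (D.α δ v)) * alH D δ :=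
  nexp_semiconj _ (h.eqv δ v)

/-- elements of the commutant are determined by the value at the base point -/
lemma IsY.ext {D : GData n Δ Z} {φ : Vn n →ₗ[ℝ] EndV (Vn n)} (h : IsY D φ) {a b : EndV (Vn n)}
    (ha : ∀ v, Commute a (φ v)) (hb : ∀ v, Commute b (φ v)) (hab : a (0, 1) = b (0, 1)) :
    a = b := by
  have hx : ∀ x : Vn n × ℝ, x = φ x.1 (0, 1) + x.2 • (0, 1) := by
    intro x
    rw [h.ev]
    exact Prod.ext (by simp) (by simp)
  apply ContinuousLinearMap.ext
  intro x
  rw [hx x, map_add, map_add, map_smul, map_smul, hab, ← mul_apply_eq_comp, ← mul_apply_eq_comp,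
    (ha _).eq, (hb _).eq, mul_apply_eq_comp, mul_apply_eq_comp, hab]

lemma IsY.nexp_comm {D : GData n Δ Z} {φ : Vn n →ₗ[ℝ] EndV (Vn n)} (h : IsY D φ) (v w : Vn n) :
    Commute (nexp (dd n) (φ v)) (φ w) :=
  (nexp_commute _ (h.comm w v)).symm

/-- the developing map -/
def Om (φ : Vn n →ₗ[ℝ] EndV (Vn n)) (v : Vn n) : Vn n := (nexp (dd n) (φ v) (0, 1)).1

/-- the inverse of the developing map -/
def OmI (φ : Vn n →ₗ[ℝ] EndV (Vn n)) (v : Vn n) : Vn n := (nlog (dd n) (φ v) (0, 1)).1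

lemma IsY.Om_spec {D : GData n Δ Z} {φ : Vn n →ₗ[ℝ] EndV (Vn n)} (h : IsY D φ) (v : Vn n) :
    nexp (dd n) (φ v) (0, 1) = (Om φ v, 1) :=
  Prod.ext rfl (nexp_snd (h.snd v) dd_pos _)

lemma IsY.OmI_Om {D : GData n Δ Z} {φ : Vn n →ₗ[ℝ] EndV (Vn n)} (h : IsY D φ) (v : Vn n) :
    OmI φ (Om φ v) = v := by
  have h1 : nexp (dd n) (φ v) - 1 = φ (Om φ v) := by
    refine h.ext (fun w => (h.nexp_comm v w).sub_left (Commute.one_left _))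
      (fun w => h.comm _ _) ?_
    rw [h.ev, sub_apply, h.Om_spec]
    exact Prod.ext (by simp) (by simp)
  rw [OmI, ← h1, nlog_nexp dd_nil dd_pos (h.isNil v), h.ev]

lemma IsY.Om_OmI {D : GData n Δ Z} {φ : Vn n →ₗ[ℝ] EndV (Vn n)} (h : IsY D φ) (v : Vn n) :
    Om φ (OmI φ v) = v := by
  have h1 : nlog (dd n) (φ v) = φ (OmI φ v) := by
    refine h.ext (fun w => (nlog_commute _ (h.comm w v)).symm)
      (fun w => h.comm _ _) ?_
    rw [h.ev]
    exact Prod.ext rfl (nlog_snd (h.snd v) _ _)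
  rw [Om, ← h1, nexp_nlog' dd_nil dd_pos (h.isNil v), add_apply, h.ev]
  simp

lemma aeval_cont {V : Type*} [NormedAddCommGroup V] [NormedSpace ℝ V] (p : ℝ[X]) :
    Continuous fun N : EndV V => aeval N p := by
  induction p using Polynomial.induction_on' with
  | add p q hp hq => simp only [map_add]; exact hp.add hq
  | monomial k c =>
    simp only [aeval_monomial]
    fun_prop

lemma nlog_cont (d : ℕ) : Continuous (nlog d : EndV (Vn n) → EndV (Vn n)) := aeval_cont _

/-- the developing map as a homeomorphism -/
def IsY.homeo {D : GData n Δ Z} {φ : Vn n →ₗ[ℝ] EndV (Vn n)} (h : IsY D φ) : Vn n ≃ₜ Vn n where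
  toFun := Om φ
  invFun := OmI φ
  left_inv := h.OmI_Om
  right_inv := h.Om_OmI
  continuous_toFun := by
    have h1 : Continuous φ := φ.continuous_of_finiteDimensional
    exact continuous_fst.comp (((nexp_continuous _).comp h1).clm_apply continuous_const)
  continuous_invFun := by
    have h1 : Continuous φ := φ.continuous_of_finiteDimensional
    exact continuous_fst.comp (((nlog_cont _).comp h1).clm_apply continuous_const)

/-- lift of a linear representation to affine maps -/
def liftAff (κ : Δ →* EndV (Vn n)) (hκ : ∀ δ x, (κ δ x).2 = x.2) : Δ →* (Vn n ≃ᵃ[ℝ] Vn n) where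
  toFun δ := mkAff (κ δ) (κ δ⁻¹) (by rw [← map_mul, mul_inv_cancel, map_one])
    (by rw [← map_mul, inv_mul_cancel, map_one]) (hκ δ)
  map_one' := by
    apply affL_inj
    rw [affL_mkAff, map_one, map_one]
  map_mul' δ ε := by
    apply affL_inj
    rw [map_mul affL, affL_mkAff, affL_mkAff, affL_mkAff, map_mul]

lemma affL_liftAff (κ : Δ →* EndV (Vn n)) (hκ : ∀ δ x, (κ δ x).2 = x.2) (δ : Δ) :
    affL (liftAff κ hκ δ) = κ δ := by
  exact affL_mkAff (κ δ) (κ δ⁻¹) (by rw [← map_mul, mul_inv_cancel, map_one])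
    (by rw [← map_mul, inv_mul_cancel, map_one]) (hκ δ)

/-- the model representation -/
def rM {D : GData n Δ Z} {φ : Vn n →ₗ[ℝ] EndV (Vn n)} (h : IsY D φ) : Δ →* EndV (Vn n) where
  toFun δ := nexp (dd n) (φ (D.c δ)) * alH D δ
  map_one' := by rw [D.c_one, map_zero, nexp_zero dd_pos, map_one, one_mul]
  map_mul' δ ε := by
    rw [D.c_mul, h.nexp_add, map_mul, mul_assoc, mul_assoc, ← mul_assoc (alH D δ), h.nexp_alH]
    simp only [mul_assoc]

lemma rM_apply {D : GData n Δ Z} {φ : Vn n →ₗ[ℝ] EndV (Vn n)} (h : IsY D φ) (δ : Δ) :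
    rM h δ = nexp (dd n) (φ (D.c δ)) * alH D δ := rfl

lemma rM_snd {D : GData n Δ Z} {φ : Vn n →ₗ[ℝ] EndV (Vn n)} (h : IsY D φ) (δ : Δ)
    (x : Vn n × ℝ) : (rM h δ x).2 = x.2 := by
  rw [rM_apply, mul_apply_eq_comp, nexp_snd (h.snd _) dd_pos, alH_apply]

/-- the model representation conjugated by an affine map -/
def PsiH {D : GData n Δ Z} {φ : Vn n →ₗ[ℝ] EndV (Vn n)} (h : IsY D φ) (θ : Vn n ≃ᵃ[ℝ] Vn n) :
    Δ →* (Vn n ≃ᵃ[ℝ] Vn n) :=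
  (MulAut.conj θ).toMonoidHom.comp (liftAff (rM h) (rM_snd h))

lemma PsiH_apply {D : GData n Δ Z} {φ : Vn n →ₗ[ℝ] EndV (Vn n)} (h : IsY D φ)
    (θ : Vn n ≃ᵃ[ℝ] Vn n) (δ : Δ) :
    PsiH h θ δ = θ * liftAff (rM h) (rM_snd h) δ * θ⁻¹ := rfl

lemma affL_PsiH {D : GData n Δ Z} {φ : Vn n →ₗ[ℝ] EndV (Vn n)} (h : IsY D φ)
    (θ : Vn n ≃ᵃ[ℝ] Vn n) (δ : Δ) :
    affL (PsiH h θ δ) = affL θ * (nexp (dd n) (φ (D.c δ)) * alH D δ) * affL θ⁻¹ := by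
  rw [PsiH_apply, map_mul, map_mul, affL_liftAff, rM_apply]

lemma PsiH_Om {D : GData n Δ Z} {φ : Vn n →ₗ[ℝ] EndV (Vn n)} (h : IsY D φ)
    (θ : Vn n ≃ᵃ[ℝ] Vn n) (δ : Δ) (v : Vn n) :
    PsiH h θ δ (θ (Om φ v)) = θ (Om φ (D.c δ + D.α δ v)) := by
  have h1 : affL (PsiH h θ δ) (θ (Om φ v), 1) = (θ (Om φ (D.c δ + D.α δ v)), 1) := by
    rw [affL_PsiH, ← affL_one_apply, ← affL_one_apply, ← h.Om_spec, ← h.Om_spec,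
      ← mul_apply_eq_comp, mul_assoc _ (affL θ⁻¹), affL_inv_mul, mul_one, mul_apply_eq_comp,
      mul_apply_eq_comp, ← mul_apply_eq_comp (alH D δ), h.nexp_alH, mul_apply_eq_comp,
      ← mul_apply_eq_comp (nexp (dd n) (φ (D.c δ))), ← h.nexp_add, alH_apply, map_zero]
  rw [affL_one_apply] at h1
  exact congrArg Prod.fst h1

lemma latt_finite (C : Set (Vn n)) (hC : IsCompact C) : {m | latt n m ∈ C}.Finite := by
  obtain ⟨R, hR⟩ := hC.isBounded.exists_norm_le
  refine (Set.finite_Icc (fun _ => -⌈R⌉ : Fin n → ℤ) (fun _ => ⌈R⌉)).subset ?_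
  intro m hm
  have h1 : ∀ i, |(m i : ℝ)| ≤ ⌈R⌉ := by
    intro i
    rw [← latt_apply, ← Real.norm_eq_abs]
    exact (PiLp.norm_apply_le _ i).trans ((hR _ hm).trans (Int.le_ceil R))
  constructor
  · intro i
    have := (abs_le.1 (h1 i)).1
    exact_mod_cast this
  · intro i
    have := (abs_le.1 (h1 i)).2
    exact_mod_cast this

lemma model_finite (D : GData n Δ Z) (hfi : Z.FiniteIndex) (K : Set (Vn n)) (hK : IsCompact K) :
    {δ | ∃ v ∈ K, D.c δ + D.α δ v ∈ K}.Finite := by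
  have _ : Finite (Δ ⧸ Z) := Subgroup.finite_quotient_of_finiteIndex
  have key : ∀ s : Δ, {z : Z | ∃ v ∈ K, D.c (s * z) + D.α (s * z) v ∈ K}.Finite := by
    intro s
    let C : Set (Vn n) := (fun p : Vn n × Vn n => D.α s⁻¹ (p.1 - D.c s) - p.2) '' (K ×ˢ K)
    have hC : IsCompact C := (hK.prod hK).image (by fun_prop)
    have hf := (latt_finite C hC).preimage
      (f := fun z : Z => (D.ζ z).toAdd) (Function.Injective.injOn (fun a b hab => D.ζ.injective hab))
    refine hf.subset ?_
    rintro z ⟨v, hv, hv2⟩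
    refine ⟨(_, v), ⟨hv2, hv⟩, ?_⟩
    rw [← D.c_Z]
    have h1 : D.α s⁻¹ * D.α s = 1 := by rw [← map_mul, inv_mul_cancel, map_one]
    have h2 : ∀ y, D.α s⁻¹ (D.α s y) = y := fun y => by
      rw [← mul_apply_eq_comp, h1]; rfl
    simp only [D.c_mul, map_mul, D.α_Z _ z.2, mul_one]
    rw [add_assoc, add_sub_cancel_left, map_add, h2, h2, add_sub_cancel_right]
  refine (Set.finite_iUnion fun q : Δ ⧸ Z => (key q.out).image fun z : Z => q.out * (z : Δ)).subset ?_
  rintro δ ⟨v, hv, hv2⟩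
  have hz : ((δ : Δ ⧸ Z).out)⁻¹ * δ ∈ Z := by
    rw [← QuotientGroup.eq]; exact QuotientGroup.out_eq' _
  refine Set.mem_iUnion.2 ⟨(δ : Δ ⧸ Z), ⟨⟨_, hz⟩, ⟨v, hv, ?_⟩, ?_⟩⟩
  · simpa using hv2
  · simp

/-- conjugates of the affine crystallographic model are crystallographic -/
lemma cryst_of_homeo (D : GData n Δ Z) (hfi : Z.FiniteIndex) (ρ : Δ →* (Vn n ≃ᵃ[ℝ] Vn n))
    (O : Vn n ≃ₜ Vn n) (hO : ∀ δ v, ρ δ (O v) = O (D.c δ + D.α δ v)) :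
    Function.Injective ρ ∧ IsCrystallographic ρ.range := by
  refine ⟨?_, ?_, ?_⟩
  · rw [injective_iff_map_eq_one]
    intro δ hδ
    have h1 : ∀ v, D.c δ + D.α δ v = v := by
      intro v
      have := hO δ v
      rw [hδ] at this
      exact (O.injective this).symm
    have h2 : D.c δ = 0 := by simpa using h1 0
    have h3 : D.α δ = 1 := by
      apply ContinuousLinearMap.ext
      intro v
      have := h1 v
      rwa [h2, zero_add] at this
    have h4 := D.c_eq_zero ⟨δ, D.α_ker δ h3⟩ h2
    exact congrArg Subtype.val h4
  · intro K hK
    have hK' : IsCompact (O.symm '' K) := hK.image O.symm.continuous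
    refine ((model_finite D hfi _ hK').image ρ).subset ?_
    rintro g ⟨⟨δ, rfl⟩, ⟨y, ⟨x, hx, rfl⟩, hy⟩⟩
    refine ⟨δ, ⟨O.symm x, ⟨x, hx, rfl⟩, ⟨_, hy, ?_⟩⟩, rfl⟩
    rw [O.symm_apply_eq, ← hO, O.apply_symm_apply]
  · let K : Set (Vn n) := O '' (WithLp.toLp 2 '' Set.Icc (0 : Fin n → ℝ) 1)
    have hK : IsCompact K := (isCompact_Icc.image (PiLp.continuous_toLp 2 _)).image O.continuous
    constructor
    have hc : Continuous (Quotient.mk (affOrbitSetoid ρ.range)) := continuous_quotient_mk'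
    have : (Set.univ : Set (Quotient (affOrbitSetoid ρ.range))) = Quotient.mk _ '' K := by
      symm
      rw [Set.eq_univ_iff_forall]
      intro q
      obtain ⟨x, rfl⟩ := Quotient.exists_rep q
      let v := O.symm x
      let r : Fin n → ℝ := fun i => Int.fract (v i)
      let z : Z := D.ζ.symm (Multiplicative.ofAdd (fun i => -⌊v i⌋))
      refine ⟨O (WithLp.toLp 2 r), ⟨_, ⟨r, ⟨fun i => Int.fract_nonneg _,
        fun i => (Int.fract_lt_one _).le⟩, rfl⟩, rfl⟩, ?_⟩
      symm
      apply Quotient.sound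
      refine ⟨ρ z, ⟨z, rfl⟩, ?_⟩
      have hx : x = O v := (O.apply_symm_apply x).symm
      rw [hx, hO, D.α_Z _ z.2, D.c_Z]
      congr 1
      ext i
      change latt n _ i + v i = r i
      rw [latt_apply]
      simp only [z, r, MulEquiv.apply_symm_apply, toAdd_ofAdd]
      have := Int.floor_add_fract (v i)
      push_cast
      linarith
    rw [this]
    exact hK.image hc

lemma PsiH_cryst {D : GData n Δ Z} (hfi : Z.FiniteIndex) {φ : Vn n →ₗ[ℝ] EndV (Vn n)}
    (h : IsY D φ) (θ : Vn n ≃ᵃ[ℝ] Vn n) :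
    Function.Injective (PsiH h θ) ∧ IsCrystallographic (PsiH h θ).range := by
  refine cryst_of_homeo D hfi _ (h.homeo.trans
    (AffineEquiv.toContinuousAffineEquiv θ).toHomeomorph) ?_
  intro δ v
  exact PsiH_Om h θ δ v
end
end
end

section
noncomputable section
open Topology Polynomial

section
variable {n : ℕ} {Δ : Type*} [Group Δ] {Z : Subgroup Δ}

/-- restriction to the lattice -/
def tauOf (D : GData n Δ Z) (ρ : Δ →* (Vn n ≃ᵃ[ℝ] Vn n)) :
    Multiplicative (Fin n → ℤ) →* (Vn n ≃ᵃ[ℝ] Vn n) :=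
  ρ.comp (Z.subtype.comp D.ζ.symm.toMonoidHom)

lemma tauOf_apply (D : GData n Δ Z) (ρ : Δ →* (Vn n ≃ᵃ[ℝ] Vn n)) (m : Multiplicative (Fin n → ℤ)) :
    tauOf D ρ m = ρ (D.ζ.symm m) := rfl

/-- logarithm on the lattice -/
def phiOf (D : GData n Δ Z) (ρ : Δ →* (Vn n ≃ᵃ[ℝ] Vn n)) : Vn n →ₗ[ℝ] EndV (Vn n) :=
  latLog (tauOf D ρ)

/-- crystallographic homomorphisms -/
def Cr (ρ : Δ →* (Vn n ≃ᵃ[ℝ] Vn n)) : Prop :=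
  Function.Injective ρ ∧ IsCrystallographic ρ.range

lemma Cr.PD (D : GData n Δ Z) {ρ : Δ →* (Vn n ≃ᵃ[ℝ] Vn n)} (h : Cr ρ) (K : Set (Vn n))
    (hK : IsCompact K) : {m | ((tauOf D ρ m '' K) ∩ K).Nonempty}.Finite := by
  have h1 := h.2.1 K hK
  have hinj : Function.Injective (tauOf D ρ) := by
    intro a b hab
    rw [tauOf_apply, tauOf_apply] at hab
    exact D.ζ.symm.injective (Subtype.ext (h.1 hab))
  refine (h1.preimage hinj.injOn).subset ?_
  intro m hm
  exact ⟨⟨_, rfl⟩, hm⟩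

lemma phi_comm (D : GData n Δ Z) {ρ : Δ →* (Vn n ≃ᵃ[ℝ] Vn n)} (h : Cr ρ) (v v' : Vn n) :
    Commute (phiOf D ρ v) (phiOf D ρ v') := (latLog_spec _ (h.PD D)).1 v v'
lemma phi_nil (D : GData n Δ Z) {ρ : Δ →* (Vn n ≃ᵃ[ℝ] Vn n)} (h : Cr ρ) (v : Vn n) :
    IsNilpotent (phiOf D ρ v) := (latLog_spec _ (h.PD D)).2.1 v
lemma phi_snd (D : GData n Δ Z) {ρ : Δ →* (Vn n ≃ᵃ[ℝ] Vn n)} (h : Cr ρ) (v : Vn n)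
    (x : Vn n × ℝ) : (phiOf D ρ v x).2 = 0 := (latLog_spec _ (h.PD D)).2.2.1 v x
lemma phi_free (D : GData n Δ Z) {ρ : Δ →* (Vn n ≃ᵃ[ℝ] Vn n)} (h : Cr ρ) (x v : Vn n)
    (hv : phiOf D ρ v (x, 1) = 0) : v = 0 := (latLog_spec _ (h.PD D)).2.2.2.2 x v hv
lemma phi_exp (D : GData n Δ Z) {ρ : Δ →* (Vn n ≃ᵃ[ℝ] Vn n)} (h : Cr ρ) (z : Z) :
    nexp (dd n) (phiOf D ρ (D.c z)) = affL (ρ z) := by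
  rw [D.c_Z]
  have := (latLog_spec _ (h.PD D)).2.2.2.1 (D.ζ z).toAdd
  rw [tauOf_apply] at this
  rw [show D.ζ.symm (Multiplicative.ofAdd (D.ζ z).toAdd) = z from D.ζ.symm_apply_apply z] at this
  exact this

lemma GData.c_conj (D : GData n Δ Z) (δ : Δ) (z : Z) : ∃ z' : Z, δ * z = z' * δ ∧
    D.c z' = D.α δ (D.c z) := by
  have hz : δ * z * δ⁻¹ ∈ Z := by
    apply D.α_ker
    rw [map_mul, map_mul, D.α_Z _ z.2, mul_one, ← map_mul, mul_inv_cancel, map_one]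
  refine ⟨⟨_, hz⟩, by simp, ?_⟩
  have h1 : D.c (δ * z) = D.c ((δ * z * δ⁻¹) * δ) := by simp
  rw [D.c_mul, D.c_mul (δ * z * δ⁻¹), D.α_Z _ hz] at h1
  change _ = _ + D.c δ at h1
  rw [add_comm] at h1
  exact (add_right_cancel h1).symm

lemma phi_eqv (D : GData n Δ Z) {ρ : Δ →* (Vn n ≃ᵃ[ℝ] Vn n)} (h : Cr ρ) (δ : Δ) (v : Vn n) :
    affL (ρ δ) * phiOf D ρ v = phiOf D ρ (D.α δ v) * affL (ρ δ) := by
  let f : Vn n →ₗ[ℝ] EndV (Vn n) := (LinearMap.mulLeft ℝ (affL (ρ δ))).comp (phiOf D ρ)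
  let g : Vn n →ₗ[ℝ] EndV (Vn n) := (LinearMap.mulRight ℝ (affL (ρ δ))).comp
    ((phiOf D ρ).comp (D.α δ : Vn n →ₗ[ℝ] Vn n))
  have hfg : f = g := by
    apply lin_ext_latt
    intro m
    change affL (ρ δ) * phiOf D ρ (latt n m) = phiOf D ρ (D.α δ (latt n m)) * affL (ρ δ)
    obtain ⟨z, hz⟩ : ∃ z : Z, D.c z = latt n m :=
      ⟨D.ζ.symm (Multiplicative.ofAdd m), by rw [D.c_Z]; simp⟩
    obtain ⟨z', hz', hc⟩ := D.c_conj δ z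
    rw [← hz, ← hc, ← nlog_nexp dd_nil dd_pos (phi_nil D h (D.c z)),
      ← nlog_nexp dd_nil dd_pos (phi_nil D h (D.c z'))]
    apply nlog_semiconj
    rw [phi_exp D h, phi_exp D h, mul_sub, sub_mul, mul_one, one_mul, ← map_mul, ← map_mul,
      ← map_mul, ← map_mul, hz']
  exact DFunLike.congr_fun hfg v

/-- the finite-order part -/
def rbar (D : GData n Δ Z) (ρ : Δ →* (Vn n ≃ᵃ[ℝ] Vn n)) (δ : Δ) : EndV (Vn n) :=
  nexp (dd n) (-(phiOf D ρ (D.c δ))) * affL (ρ δ)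

lemma rbar_mul (D : GData n Δ Z) {ρ : Δ →* (Vn n ≃ᵃ[ℝ] Vn n)} (h : Cr ρ) (δ ε : Δ) :
    rbar D ρ (δ * ε) = rbar D ρ δ * rbar D ρ ε := by
  have h1 : affL (ρ δ) * nexp (dd n) (-(phiOf D ρ (D.c ε))) =
      nexp (dd n) (-(phiOf D ρ (D.α δ (D.c ε)))) * affL (ρ δ) := by
    apply nexp_semiconj
    rw [← map_neg, ← map_neg, phi_eqv D h, map_neg]
  rw [rbar, rbar, rbar, D.c_mul, map_add, neg_add,
    nexp_add' dd_nil ((Commute.neg_left (phi_comm D h (D.c δ) (D.α δ (D.c ε)))).neg_right) (phi_nil D h _).neg (phi_nil D h _).neg,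
    map_mul, map_mul, mul_assoc, mul_assoc, ← mul_assoc (affL (ρ δ)), h1]
  simp only [mul_assoc]

lemma rbar_Z (D : GData n Δ Z) {ρ : Δ →* (Vn n ≃ᵃ[ℝ] Vn n)} (h : Cr ρ) (z : Δ) (hz : z ∈ Z) :
    rbar D ρ z = 1 := by
  rw [rbar, ← phi_exp D h ⟨z, hz⟩, nexp_neg' dd_nil dd_pos (phi_nil D h _)]

lemma rbar_snd (D : GData n Δ Z) {ρ : Δ →* (Vn n ≃ᵃ[ℝ] Vn n)} (h : Cr ρ) (δ : Δ)
    (x : Vn n × ℝ) : (rbar D ρ δ x).2 = x.2 := by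
  rw [rbar, mul_apply_eq_comp, nexp_snd _ dd_pos, affL_snd]
  intro x
  rw [neg_apply, Prod.snd_neg, phi_snd D h, neg_zero]

lemma rbar_eqv (D : GData n Δ Z) {ρ : Δ →* (Vn n ≃ᵃ[ℝ] Vn n)} (h : Cr ρ) (δ : Δ) (v : Vn n) :
    rbar D ρ δ * phiOf D ρ v = phiOf D ρ (D.α δ v) * rbar D ρ δ := by
  rw [rbar, mul_assoc, phi_eqv D h, ← mul_assoc, ← mul_assoc]
  congr 1
  exact (nexp_commute _ (phi_comm D h _ _).neg_right).eq.symm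

/-- candidate for the normalising affine map -/
def thL (φ : Vn n →ₗ[ℝ] EndV (Vn n)) (x : Vn n × ℝ) : EndV (Vn n) :=
  LinearMap.toContinuousLinearMap
    (((evalL x).comp φ).comp (LinearMap.fst ℝ (Vn n) ℝ) +
      (LinearMap.toSpanSingleton ℝ (Vn n × ℝ) x).comp (LinearMap.snd ℝ (Vn n) ℝ))

lemma thL_apply (φ : Vn n →ₗ[ℝ] EndV (Vn n)) (x y : Vn n × ℝ) :
    thL φ x y = φ y.1 x + y.2 • x := rfl

/-- linear extension -/
def Ml (M : Fin n → EndV (Vn n)) : Vn n →ₗ[ℝ] EndV (Vn n) := (bV n).constr ℝ M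

variable [Fintype (Δ ⧸ Z)]

/-- the fixed point -/
def xhat (D : GData n Δ Z) (ρ : Δ →* (Vn n ≃ᵃ[ℝ] Vn n)) : Vn n × ℝ :=
  ((Fintype.card (Δ ⧸ Z) : ℝ)⁻¹) • ∑ q : Δ ⧸ Z, rbar D ρ q.out (0, 1)

lemma xhat_fix (D : GData n Δ Z) {ρ : Δ →* (Vn n ≃ᵃ[ℝ] Vn n)} (h : Cr ρ) (δ : Δ) :
    rbar D ρ δ (xhat D ρ) = xhat D ρ := by
  rw [xhat, map_smul, map_sum]
  congr 1
  refine Fintype.sum_equiv (MulAction.toPerm δ) _ _ fun q => ?_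
  rw [← mul_apply_eq_comp, ← rbar_mul D h]
  have hz : ((δ • q).out)⁻¹ * (δ * q.out) ∈ Z := by
    rw [← QuotientGroup.eq, QuotientGroup.out_eq']
    conv_lhs => rw [← QuotientGroup.out_eq' q]
    rfl
  have h1 := rbar_mul D h (δ • q).out (((δ • q).out)⁻¹ * (δ * q.out))
  rw [rbar_Z D h _ hz, mul_one, mul_inv_cancel_left] at h1
  rw [h1]; rfl

lemma xhat_snd (D : GData n Δ Z) {ρ : Δ →* (Vn n ≃ᵃ[ℝ] Vn n)} (h : Cr ρ) : (xhat D ρ).2 = 1 := by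
  rw [xhat, Prod.smul_snd, Prod.snd_sum, Finset.sum_congr rfl (fun q _ => rbar_snd D h _ _)]
  simp

/-- the normalising affine map -/
def thOf (D : GData n Δ Z) (ρ : Δ →* (Vn n ≃ᵃ[ℝ] Vn n)) : Vn n ≃ᵃ[ℝ] Vn n :=
  open Classical in
  if h : ∃ g : Vn n ≃ᵃ[ℝ] Vn n, affL g = thL (phiOf D ρ) (xhat D ρ) then h.choose else 1

lemma thOf_spec (D : GData n Δ Z) {ρ : Δ →* (Vn n ≃ᵃ[ℝ] Vn n)} (h : Cr ρ) :
    affL (thOf D ρ) = thL (phiOf D ρ) (xhat D ρ) := by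
  have hex : ∃ g : Vn n ≃ᵃ[ℝ] Vn n, affL g = thL (phiOf D ρ) (xhat D ρ) := by
    set a := thL (phiOf D ρ) (xhat D ρ) with ha
    have hs : ∀ y, (a y).2 = y.2 := by
      intro y
      rw [ha, thL_apply, Prod.snd_add, phi_snd D h, Prod.smul_snd, xhat_snd D h]
      simp
    have hinj : Function.Injective (a : (Vn n × ℝ) →ₗ[ℝ] (Vn n × ℝ)) := by
      rw [← LinearMap.ker_eq_bot, LinearMap.ker_eq_bot']
      intro y hy
      change a y = 0 at hy
      have h2 : y.2 = 0 := by rw [← hs, hy]; rfl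
      rw [ha, thL_apply, h2, zero_smul, add_zero,
        show xhat D ρ = ((xhat D ρ).1, 1) from Prod.ext rfl (xhat_snd D h)] at hy
      exact Prod.ext (phi_free D h _ _ hy) h2
    let e := (LinearEquiv.ofInjectiveEndo _ hinj).toContinuousLinearEquiv
    have he : ∀ y, e y = a y := fun y => rfl
    refine ⟨mkAff a (e.symm : EndV (Vn n)) ?_ ?_ hs, affL_mkAff _ _ _ _ _⟩
    · apply ContinuousLinearMap.ext
      intro y
      change a (e.symm y) = y
      rw [← he, e.apply_symm_apply]
    · apply ContinuousLinearMap.ext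
      intro y
      change e.symm (a y) = y
      rw [← he, e.symm_apply_apply]
  rw [thOf, dif_pos hex]
  exact hex.choose_spec

/-- normal form of the logarithm -/
def MOf (D : GData n Δ Z) (ρ : Δ →* (Vn n ≃ᵃ[ℝ] Vn n)) (i : Fin n) : EndV (Vn n) :=
  affL (thOf D ρ)⁻¹ * phiOf D ρ (bV n i) * affL (thOf D ρ)

lemma Ml_MOf (D : GData n Δ Z) (ρ : Δ →* (Vn n ≃ᵃ[ℝ] Vn n)) (v : Vn n) :
    Ml (MOf D ρ) v = affL (thOf D ρ)⁻¹ * phiOf D ρ v * affL (thOf D ρ) := by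
  have : Ml (MOf D ρ) = (LinearMap.mulRight ℝ (affL (thOf D ρ))).comp
      ((LinearMap.mulLeft ℝ (affL (thOf D ρ)⁻¹)).comp (phiOf D ρ)) := by
    apply (bV n).ext
    intro i
    rw [Ml, Module.Basis.constr_basis]; rfl
  rw [this]; rfl

lemma th_alH (D : GData n Δ Z) {ρ : Δ →* (Vn n ≃ᵃ[ℝ] Vn n)} (h : Cr ρ) (δ : Δ) :
    affL (thOf D ρ) * alH D δ = rbar D ρ δ * affL (thOf D ρ) := by
  rw [thOf_spec D h]
  apply ContinuousLinearMap.ext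
  intro y
  rw [mul_apply_eq_comp, mul_apply_eq_comp, thL_apply, thL_apply, alH_apply, map_add, map_smul,
    xhat_fix D h, ← mul_apply_eq_comp (rbar D ρ δ), rbar_eqv D h, mul_apply_eq_comp, xhat_fix D h]

lemma MOf_isY (D : GData n Δ Z) {ρ : Δ →* (Vn n ≃ᵃ[ℝ] Vn n)} (h : Cr ρ) :
    IsY D (Ml (MOf D ρ)) := by
  set t := affL (thOf D ρ) with ht
  set s := affL (thOf D ρ)⁻¹ with hs
  have hst : s * t = 1 := affL_inv_mul _
  have hts : t * s = 1 := affL_mul_inv _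
  have hts' : ∀ a, t * (s * a) = a := fun a => by rw [← mul_assoc, hts, one_mul]
  have hM : ∀ v, Ml (MOf D ρ) v = s * phiOf D ρ v * t := Ml_MOf D ρ
  refine ⟨fun v v' => ?_, fun v x => ?_, fun v => ?_, fun v => ?_, fun δ v => ?_⟩
  · rw [hM, hM]
    simp only [mul_assoc, hts']
    rw [← mul_assoc (phiOf D ρ v), ← mul_assoc (phiOf D ρ v'), (phi_comm D h v v').eq]
  · rw [hM, mul_assoc, mul_apply_eq_comp, hs, affL_snd, mul_apply_eq_comp, phi_snd D h]
  · rw [hM, mul_assoc, mul_apply_eq_comp, mul_apply_eq_comp]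
    have h1 : t (0, 1) = xhat D ρ := by
      rw [ht, thOf_spec D h, thL_apply]; simp
    have h2 : t (v, 0) = phiOf D ρ v (xhat D ρ) := by
      rw [ht, thOf_spec D h, thL_apply]; simp
    rw [h1, ← h2, ← mul_apply_eq_comp, hst]; rfl
  · have h1 : ∀ k, (s * phiOf D ρ v * t) ^ k = s * (phiOf D ρ v) ^ k * t := by
      intro k
      induction k with
      | zero => rw [pow_zero, pow_zero, mul_one, hst]
      | succ k ih => rw [pow_succ, ih, pow_succ]; simp only [mul_assoc, hts']
    rw [hM, h1, dd_nil _ (phi_nil D h v), mul_zero, zero_mul]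
  · have h1 : alH D δ * s = s * rbar D ρ δ := by
      have := congrArg (fun a => s * a * s) (th_alH D h δ)
      simp only [mul_assoc] at this
      rw [← ht, hts, mul_one, ← mul_assoc, hst, one_mul] at this
      exact this
    rw [hM, hM, ← mul_assoc, ← mul_assoc, h1, mul_assoc s, rbar_eqv D h]
    simp only [mul_assoc]
    rw [th_alH D h]

lemma PsiH_NF (D : GData n Δ Z) {ρ : Δ →* (Vn n ≃ᵃ[ℝ] Vn n)} (h : Cr ρ) :
    PsiH (MOf_isY D h) (thOf D ρ) = ρ := by
  ext1 δ
  apply affL_inj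
  rw [affL_PsiH, Ml_MOf, nexp_conj' dd_pos (affL_inv_mul _) (affL_mul_inv _)]
  simp only [← mul_assoc]
  rw [affL_mul_inv, one_mul, mul_assoc (nexp _ _), th_alH D h, mul_assoc, mul_assoc, affL_mul_inv,
    mul_one, rbar, ← mul_assoc, nexp_neg dd_nil dd_pos (phi_nil D h _), one_mul]
end
end
end

section
noncomputable section
open Topology Polynomial

section
variable {n : ℕ} {Δ : Type*} [Group Δ] {Z : Subgroup Δ}

lemma phi_Psi {D : GData n Δ Z} {φ : Vn n →ₗ[ℝ] EndV (Vn n)} (h : IsY D φ)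
    (θ : Vn n ≃ᵃ[ℝ] Vn n) (v : Vn n) :
    phiOf D (PsiH h θ) v = affL θ * φ v * affL θ⁻¹ := by
  have key : phiOf D (PsiH h θ) = (LinearMap.mulRight ℝ (affL θ⁻¹)).comp
      ((LinearMap.mulLeft ℝ (affL θ)).comp φ) := by
    apply (bV n).ext
    intro i
    rw [phiOf, latLog, Module.Basis.constr_basis]
    change nlog (dd n) _ = affL θ * φ (bV n i) * affL θ⁻¹
    have hz := (D.ζ.symm (Multiplicative.ofAdd (Pi.single i 1))).2
    have hc : D.c (D.ζ.symm (Multiplicative.ofAdd (Pi.single i 1))) = bV n i := by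
      rw [D.c_Z, MulEquiv.apply_symm_apply, toAdd_ofAdd, latt_single]
    have h1 : alH D (D.ζ.symm (Multiplicative.ofAdd (Pi.single i 1)) : Δ) = 1 := by
      apply ContinuousLinearMap.ext
      intro x
      rw [alH_apply, D.α_Z _ hz]; rfl
    rw [tauOf_apply, affL_PsiH, h1, mul_one, hc]
    have h2 : affL θ * (nexp (dd n) (φ (bV n i)) - 1) =
        (affL θ * nexp (dd n) (φ (bV n i)) * affL θ⁻¹ - 1) * affL θ := by
      rw [sub_mul, mul_assoc _ (affL θ⁻¹), affL_inv_mul, mul_sub, mul_one, mul_one, one_mul]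
    have h3 := nlog_semiconj (dd n) h2
    rw [nlog_nexp dd_nil dd_pos (h.isNil _)] at h3
    rw [h3, mul_assoc _ (affL θ), affL_mul_inv, mul_one]
  rw [key]; rfl

lemma rbar_Psi {D : GData n Δ Z} {φ : Vn n →ₗ[ℝ] EndV (Vn n)} (h : IsY D φ)
    (θ : Vn n ≃ᵃ[ℝ] Vn n) (δ : Δ) :
    rbar D (PsiH h θ) δ = affL θ * alH D δ * affL θ⁻¹ := by
  rw [rbar, ← map_neg, phi_Psi, nexp_conj' dd_pos (affL_mul_inv _) (affL_inv_mul _), affL_PsiH,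
    map_neg]
  have h1 := nexp_neg' dd_nil dd_pos (h.isNil (D.c δ))
  calc affL θ * nexp (dd n) (-φ (D.c δ)) * affL θ⁻¹ *
      (affL θ * (nexp (dd n) (φ (D.c δ)) * alH D δ) * affL θ⁻¹)
      = affL θ * nexp (dd n) (-φ (D.c δ)) * (affL θ⁻¹ * affL θ) *
        (nexp (dd n) (φ (D.c δ)) * alH D δ) * affL θ⁻¹ := by simp only [mul_assoc]
    _ = affL θ * (nexp (dd n) (-φ (D.c δ)) * nexp (dd n) (φ (D.c δ))) * alH D δ * affL θ⁻¹ := by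
        rw [affL_inv_mul, mul_one]; simp only [mul_assoc]
    _ = _ := by rw [h1, mul_one]

variable [Fintype (Δ ⧸ Z)]

lemma th_Psi {D : GData n Δ Z} (hfi : Z.FiniteIndex) {φ : Vn n →ₗ[ℝ] EndV (Vn n)} (h : IsY D φ)
    (θ : Vn n ≃ᵃ[ℝ] Vn n) :
    ∃ v, affL (thOf D (PsiH h θ)) = affL θ * nexp (dd n) (φ v) := by
  have hC : Cr (PsiH h θ) := PsiH_cryst hfi h θ
  set x := xhat D (PsiH h θ) with hx
  set y := affL θ⁻¹ x with hy
  have hy2 : y.2 = 1 := by rw [hy, affL_snd, hx, xhat_snd D hC]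
  have hty : affL θ y = x := by
    rw [hy, ← mul_apply_eq_comp, affL_mul_inv]; rfl
  have hyO : nexp (dd n) (φ (OmI φ y.1)) (0, 1) = y := by
    rw [h.Om_spec, h.Om_OmI]; exact Prod.ext rfl hy2.symm
  refine ⟨OmI φ y.1, ?_⟩
  rw [thOf_spec D hC]
  apply ContinuousLinearMap.ext
  intro w
  have hw : w = φ w.1 (0, 1) + w.2 • (0, 1) := by
    rw [h.ev]
    exact Prod.ext (by simp) (by simp)
  rw [thL_apply, phi_Psi, ← hx, mul_apply_eq_comp, mul_apply_eq_comp, ← hy, mul_apply_eq_comp]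
  conv_rhs => rw [hw]
  rw [map_add, map_smul, hyO, ← mul_apply_eq_comp (nexp _ _), (h.nexp_comm _ _).eq,
    mul_apply_eq_comp, hyO, map_add, map_smul, hty]

lemma MOf_Psi {D : GData n Δ Z} (hfi : Z.FiniteIndex) {M : Fin n → EndV (Vn n)}
    (h : IsY D (Ml M)) (θ : Vn n ≃ᵃ[ℝ] Vn n) : MOf D (PsiH h θ) = M := by
  obtain ⟨v, hv⟩ := th_Psi hfi h θ
  ext1 i
  have hM : M i = Ml M (bV n i) := by rw [Ml, Module.Basis.constr_basis]
  have h1 : affL (thOf D (PsiH h θ)) * M i =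
      phiOf D (PsiH h θ) (bV n i) * affL (thOf D (PsiH h θ)) := by
    rw [hv, phi_Psi, hM, mul_assoc, (h.nexp_comm _ _).eq, mul_assoc _ (affL θ⁻¹),
      ← mul_assoc (affL θ⁻¹), affL_inv_mul, one_mul, mul_assoc]
  rw [MOf, mul_assoc, ← h1, ← mul_assoc, affL_inv_mul, one_mul]
end

section
variable {n : ℕ}

/-- a polynomial function vanishing on the lattice vanishes -/
lemma poly_latt {P : Vn n → ℝ} (hP : P ∈ PolyAlg (Vn n)) (h : ∀ m, P (latt n m) = 0) (v : Vn n) :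
    P v = 0 := by
  let L : (Fin n → ℝ) ≃ₗ[ℝ] Vn n := (WithLp.linearEquiv 2 ℝ (Fin n → ℝ)).symm
  have hf : (fun x => P (L x)) ∈ PolyAlg (Fin n → ℝ) :=
    PolyAlg.comp hP (PolyMap.lin L.toLinearMap)
  obtain ⟨p, hp⟩ := polyAlg_mv hf
  have hp0 : p = 0 := by
    refine MvPolynomial.funext_set (fun _ : Fin n => Set.range (Int.cast : ℤ → ℝ))
      (fun _ => Set.infinite_range_of_injective Int.cast_injective) fun x hx => ?_
    choose m hm using fun i => hx i (Set.mem_univ i)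
    have hx' : L x = latt n m := by
      ext i
      rw [latt_apply, hm]; rfl
    rw [← hp, hx', h, map_zero]
  have := hp (L.symm v)
  rwa [LinearEquiv.apply_symm_apply, hp0, map_zero] at this

lemma PolyMap.nexp {W : Type*} [AddCommGroup W] [Module ℝ W] {f : W → EndV (Vn n)}
    (hf : PolyMap f) (d : ℕ) : PolyMap (fun w => nexp d (f w)) :=
  PolyMap.sum _ fun k _ => (hf.pow k).csmul _

variable {Δ : Type*} [Group Δ] {Z : Subgroup Δ}

lemma unip_mem {D : GData n Δ Z} {φ : Vn n →ₗ[ℝ] EndV (Vn n)} (h : IsY D φ)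
    (θ : Vn n ≃ᵃ[ℝ] Vn n) (A : Subgroup (Vn n ≃ᵃ[ℝ] Vn n)) (P : MatV (Vn n) → ℝ)
    (hP : P ∈ PolyAlg (MatV (Vn n))) (hA : ∀ g, g ∈ A ↔ P (affK g) = 0)
    (hin : ∀ δ, PsiH h θ δ ∈ A) (g : Vn n ≃ᵃ[ℝ] Vn n) (v : Vn n)
    (hg : affL g = affL θ * nexp (dd n) (φ v) * affL θ⁻¹) : g ∈ A := by
  rw [hA]
  change P (toMatV (affL g)) = 0
  rw [hg]
  have h1 : PolyMap (fun v : Vn n => affL θ * nexp (dd n) (φ v) * affL θ⁻¹) :=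
    ((PolyMap.const _).mul ((PolyMap.lin φ).nexp _)).mul (PolyMap.const _)
  have h2 : (fun v : Vn n => P (toMatV (affL θ * nexp (dd n) (φ v) * affL θ⁻¹))) ∈
      PolyAlg (Vn n) := PolyAlg.comp hP (h1.linc (toMatV (V := Vn n)).toLinearMap)
  refine poly_latt h2 (fun m => ?_) v
  obtain ⟨z, hz⟩ : ∃ z : Z, D.c z = latt n m :=
    ⟨D.ζ.symm (Multiplicative.ofAdd m), by rw [D.c_Z, MulEquiv.apply_symm_apply, toAdd_ofAdd]⟩
  have h3 : affL (PsiH h θ z) = affL θ * nexp (dd n) (φ (latt n m)) * affL θ⁻¹ := by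
    have ha : alH D (z : Δ) = 1 := by
      apply ContinuousLinearMap.ext
      intro x
      rw [alH_apply, D.α_Z _ z.2]; rfl
    rw [affL_PsiH, ha, mul_one, hz]
  rw [← h3]
  exact (hA _).1 (hin z)

end
end
end

section
noncomputable section
open Topology
lemma exists_P_fam {W : Type*} [AddCommGroup W] [Module ℝ W] [FiniteDimensional ℝ W] {ι : Type*}
    (q : ι → W → ℝ) (hq : ∀ i, PolyMap (q i)) :
    ∃ P : W → ℝ, P ∈ PolyAlg W ∧ ∀ w, (∀ i, q i w = 0) ↔ P w = 0 := by
  obtain ⟨s, hs⟩ := hilbert_family q fun i => polyMap_real.1 (hq i)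
  refine ⟨fun m => ∑ i ∈ s, q i m * q i m,
    polyMap_real.1 (PolyMap.sum s fun i _ => (hq i).mul (hq i)), fun g => ?_⟩
  rw [Finset.sum_eq_zero_iff_of_nonneg (fun i _ => mul_self_nonneg _)]
  constructor
  · intro h i _; rw [h i, mul_zero]
  · intro h; exact hs _ fun i hi => mul_self_eq_zero.1 (h i hi)

lemma mv_entry {a : Type*} (p : MvPolynomial (a × a) ℝ) :
    PolyMap (fun m : Matrix a a ℝ => MvPolynomial.eval (fun jk => m jk.1 jk.2) p) := by
  have h : ∀ jk : a × a, PolyMap (fun m : Matrix a a ℝ => m jk.1 jk.2) := fun jk =>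
    PolyMap.lin (Matrix.entryLinearMap ℝ ℝ jk.1 jk.2)
  exact PolyMap.mvPoly (f := fun (m : Matrix a a ℝ) (jk : a × a) => m jk.1 jk.2) h p

lemma exists_P {V : Type*} [NormedAddCommGroup V] [NormedSpace ℝ V] [FiniteDimensional ℝ V]
    (A : Subgroup (V ≃ᵃ[ℝ] V)) (hA : IsZariskiClosedAff (A : Set (V ≃ᵃ[ℝ] V))) :
    ∃ P : MatV V → ℝ, P ∈ PolyAlg (MatV V) ∧ ∀ g, g ∈ A ↔ P (affK g) = 0 := by
  obtain ⟨ι, p, hp⟩ := hA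
  have hq : ∀ i, PolyMap (fun m : MatV V => MvPolynomial.eval (fun jk => m jk.1 jk.2) (p i)) :=
    fun i => mv_entry (p i)
  obtain ⟨P, hP, hPq⟩ := exists_P_fam _ hq
  refine ⟨P, hP, fun g => ?_⟩
  rw [← hPq, affK_eq]
  exact hp g
end
end

section
noncomputable section
open Topology

lemma quot_homeo {G E H Y : Type*} [TopologicalSpace G] [TopologicalSpace E] [TopologicalSpace H]
    [TopologicalSpace Y] (f : G → Y) (hf : Continuous f) (hfo : IsOpenMap (Set.rangeFactorization f))
    (X : Set (G × E)) (hsat : ∀ p q : G × E, f p.1 = f q.1 → p.2 = q.2 → q ∈ X → p ∈ X)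
    (Ψ : X → H) (hΨ : Continuous Ψ) (hΨs : Function.Surjective Ψ)
    (Φ : H → Y × E) (hΦ : Continuous Φ) (hΦΨ : ∀ p : X, Φ (Ψ p) = (f p.1.1, p.1.2))
    (s : Setoid H) (hs : ∀ a b, s.r a b ↔ Φ a = Φ b) :
    Nonempty (Quotient s ≃ₜ ((fun p : G × E => (f p.1, p.2)) '' X)) := by
  set S := (fun p : G × E => (f p.1, p.2)) '' X with hS
  have hmem : ∀ ρ, Φ ρ ∈ S := by
    intro ρ
    obtain ⟨p, rfl⟩ := hΨs ρ
    rw [hΦΨ]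
    exact ⟨p.1, p.2, rfl⟩
  let Φ' : H → S := fun ρ => ⟨Φ ρ, hmem ρ⟩
  have hΦ' : Continuous Φ' := hΦ.subtype_mk _
  have hopen : IsOpenMap (Φ' ∘ Ψ) := by
    intro U hU
    obtain ⟨U', hU', rfl⟩ := isOpen_induced_iff.1 hU
    have h1 : IsOpenMap (Prod.map (Set.rangeFactorization f) (id : E → E)) := hfo.prodMap IsOpenMap.id
    have h2 := h1 U' hU'
    have hj : IsInducing (Prod.map (Subtype.val : Set.range f → Y) (id : E → E)) :=
      IsInducing.subtypeVal.prodMap IsInducing.id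
    obtain ⟨O, hO, hOe⟩ := hj.isOpen_iff.1 h2
    refine isOpen_induced_iff.2 ⟨O, hO, ?_⟩
    ext ⟨y, hy⟩
    constructor
    · intro hyO
      obtain ⟨q, hq, rfl⟩ := hy
      have h3 : Prod.map (Set.rangeFactorization f) (id : E → E) q ∈
          Prod.map (Subtype.val : Set.range f → Y) (id : E → E) ⁻¹' O := hyO
      rw [hOe] at h3
      obtain ⟨p, hp, hpq⟩ := h3
      have e1 : f p.1 = f q.1 := congrArg Subtype.val (congrArg Prod.fst hpq)
      have e2 : p.2 = q.2 := (Prod.ext_iff.1 hpq).2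
      refine ⟨⟨p, hsat p q e1 e2 hq⟩, hp, ?_⟩
      apply Subtype.ext
      change Φ (Ψ _) = _
      rw [hΦΨ, e1, e2]
    · rintro ⟨p, hp, hpy⟩
      have h3 : Prod.map (Set.rangeFactorization f) (id : E → E) p.1 ∈
          Prod.map (Set.rangeFactorization f) (id : E → E) '' U' := ⟨p.1, hp, rfl⟩
      rw [← hOe] at h3
      have h4 : (f p.1.1, p.1.2) ∈ O := h3
      have h5 : Φ (Ψ p) = y := congrArg Subtype.val hpy
      rw [hΦΨ] at h5
      rw [h5] at h4
      exact h4
  have hsurj : Function.Surjective (Φ' ∘ Ψ) := by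
    rintro ⟨y, q, hq, rfl⟩
    exact ⟨⟨q, hq⟩, Subtype.ext (hΦΨ _)⟩
  have hq : IsQuotientMap (Φ' ∘ Ψ) := hopen.isQuotientMap (hΦ'.comp hΨ) hsurj
  have hq' : IsQuotientMap Φ' := IsQuotientMap.of_comp hΨ hΦ' hq
  have hk : s = Setoid.ker Φ' := by
    apply Setoid.ext
    intro a b
    rw [Setoid.ker_def]
    refine (hs a b).trans ⟨fun h => Subtype.ext h, fun h => congrArg Subtype.val h⟩
  subst hk
  exact ⟨IsQuotientMap.homeomorph (f := ⟨Φ', hΦ'⟩) hq'⟩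

section
variable {n : ℕ} {Δ : Type*} [Group Δ] {Z : Subgroup Δ}

lemma affK_toMatV {V : Type*} [NormedAddCommGroup V] [NormedSpace ℝ V] [FiniteDimensional ℝ V]
    (g : V ≃ᵃ[ℝ] V) : affK g = toMatV (affL g) := rfl

/-- `Ml` as a linear map evaluated at a vector -/
def MlL (v : Vn n) : (Fin n → EndV (Vn n)) →ₗ[ℝ] EndV (Vn n) :=
  (LinearMap.applyₗ v).comp ((bV n).constr ℝ : (Fin n → EndV (Vn n)) ≃ₗ[ℝ] _).toLinearMap

lemma MlL_apply (v : Vn n) (M : Fin n → EndV (Vn n)) : MlL v M = Ml M v := rfl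

lemma Ml_cont (v : Vn n) : Continuous fun M : Fin n → EndV (Vn n) => Ml M v :=
  (MlL v).continuous_of_finiteDimensional

lemma PolyMap.Ml {W : Type*} [AddCommGroup W] [Module ℝ W] {f : W → Fin n → EndV (Vn n)}
    (hf : PolyMap f) (v : Vn n) : PolyMap (fun w => Ml (f w) v) :=
  hf.linc (MlL v)

lemma isY_SA (D : GData n Δ Z) : SAinv {M : Fin n → EndV (Vn n) | IsY D (Ml M)} := by
  have hM : ∀ v : Vn n, PolyMap (fun M : Fin n → EndV (Vn n) => Ml M v) := fun v =>
    PolyMap.id.Ml v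
  have h1 : SAinv {M : Fin n → EndV (Vn n) | ∀ v : Vn n × Vn n,
      Ml M v.1 * Ml M v.2 = Ml M v.2 * Ml M v.1} :=
    SAinv.forall_eq (f := fun (v : Vn n × Vn n) (M : Fin n → EndV (Vn n)) => Ml M v.1 * Ml M v.2)
      (g := fun v M => Ml M v.2 * Ml M v.1) (fun v => (hM _).mul (hM _))
      (fun v => (hM _).mul (hM _))
  have h2 : SAinv {M : Fin n → EndV (Vn n) | ∀ v : Vn n × (Vn n × ℝ),
      (Ml M v.1 v.2).2 = 0} :=
    SAinv.zeros (fun (v : Vn n × (Vn n × ℝ)) (M : Fin n → EndV (Vn n)) => (Ml M v.1 v.2).2)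
      (fun v => ((hM v.1).linc (evalL v.2)).linc (LinearMap.snd ℝ (Vn n) ℝ))
  have h3 : SAinv {M : Fin n → EndV (Vn n) | ∀ v : Vn n, Ml M v (0, 1) = (v, (0 : ℝ))} :=
    SAinv.forall_eq (f := fun (v : Vn n) (M : Fin n → EndV (Vn n)) => Ml M v (0, 1))
      (g := fun v M => (v, (0 : ℝ))) (fun v => (hM v).linc (evalL (0, 1)))
      (fun v => PolyMap.const _)
  have h4 : SAinv {M : Fin n → EndV (Vn n) | ∀ v : Vn n, (Ml M v) ^ (dimE (Vn n)) = 0} :=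
    SAinv.forall_eq (f := fun (v : Vn n) (M : Fin n → EndV (Vn n)) => (Ml M v) ^ (dimE (Vn n)))
      (g := fun v M => 0) (fun v => (hM v).pow _)
      (fun v => PolyMap.const _)
  have h5 : SAinv {M : Fin n → EndV (Vn n) | ∀ v : Δ × Vn n,
      alH D v.1 * Ml M v.2 = Ml M (D.α v.1 v.2) * alH D v.1} :=
    SAinv.forall_eq (f := fun (v : Δ × Vn n) (M : Fin n → EndV (Vn n)) => alH D v.1 * Ml M v.2)
      (g := fun v M => Ml M (D.α v.1 v.2) * alH D v.1)
      (fun v => (PolyMap.const _).mul (hM _)) (fun v => (hM _).mul (PolyMap.const _))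
  convert (((h1.inter h2).inter h3).inter h4).inter h5 using 1
  ext M
  constructor
  · intro h
    exact ⟨⟨⟨⟨fun v => h.comm _ _, fun v => h.snd _ _⟩, h.ev⟩, h.nil⟩, fun v => h.eqv _ _⟩
  · rintro ⟨⟨⟨⟨a, b⟩, c⟩, d⟩, e⟩
    exact ⟨fun v v' => a (v, v'), fun v x => b (v, x), c, d, fun δ v => e (δ, v)⟩

/-- the parameter space -/
def Xh (D : GData n Δ Z) (A : Subgroup (Vn n ≃ᵃ[ℝ] Vn n)) :
    Set ((Vn n ≃ᵃ[ℝ] Vn n) × (Fin n → EndV (Vn n))) :=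
  {p | ∃ h : IsY D (Ml p.2), ∀ δ, PsiH h p.1 δ ∈ A}

lemma Xh_SA (D : GData n Δ Z) (A : Subgroup (Vn n ≃ᵃ[ℝ] Vn n)) (P : MatV (Vn n) → ℝ)
    (hP : P ∈ PolyAlg (MatV (Vn n))) (hA : ∀ g, g ∈ A ↔ P (affK g) = 0) {N : ℕ}
    (f : (Vn n ≃ᵃ[ℝ] Vn n) → Matrix (Fin N) (Fin N) ℝ)
    (hf : SAinv {p : Matrix (Fin N) (Fin N) ℝ × MatV (Vn n) | ∃ g, affK g = p.2 ∧ f g = p.1}) :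
    SAinv ((fun p : (Vn n ≃ᵃ[ℝ] Vn n) × (Fin n → EndV (Vn n)) => (f p.1, p.2)) '' Xh D A) := by
  let W := Matrix (Fin N) (Fin N) ℝ × (Fin n → EndV (Vn n))
  let E2 := EndV (Vn n) × EndV (Vn n)
  have q1 : PolyMap (fun w : W × E2 => w.1.1) := PolyMap.fst.comp PolyMap.fst
  have q2 : PolyMap (fun w : W × E2 => w.1.2) := PolyMap.snd.comp PolyMap.fst
  have q3 : PolyMap (fun w : W × E2 => w.2.1) := PolyMap.fst.comp PolyMap.snd
  have q4 : PolyMap (fun w : W × E2 => w.2.2) := PolyMap.snd.comp PolyMap.snd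
  have h1 : SAinv {w : W × E2 | ∃ g, affK g = toMatV w.2.1 ∧ f g = w.1.1} := by
    have h0 : PolyMap (fun w : W × E2 => (w.1.1, toMatV w.2.1)) :=
      q1.prodMk (q3.linc (toMatV (V := Vn n)).toLinearMap)
    exact hf.preimage h0
  have h2 : SAinv {w : W × E2 | w.2.1 * w.2.2 = 1} := SAinv.eq (q3.mul q4) (PolyMap.const _)
  have h3 : SAinv {w : W × E2 | IsY D (Ml w.1.2)} := (isY_SA D).preimage q2
  have h4 : SAinv {w : W × E2 | ∀ δ : Δ,
      P (toMatV (w.2.1 * (nexp (dd n) (Ml w.1.2 (D.c δ)) * alH D δ) * w.2.2)) = 0} := by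
    have h0 : ∀ δ : Δ, PolyMap (fun w : W × E2 =>
        w.2.1 * (nexp (dd n) (Ml w.1.2 (D.c δ)) * alH D δ) * w.2.2) := fun δ =>
      (q3.mul (((q2.Ml (D.c δ)).nexp (dd n)).mul (PolyMap.const _))).mul q4
    refine SAinv.zeros (fun (δ : Δ) (w : W × E2) =>
      P (toMatV (w.2.1 * (nexp (dd n) (Ml w.1.2 (D.c δ)) * alH D δ) * w.2.2))) fun δ => ?_
    exact polyMap_real.2 (PolyAlg.comp hP ((h0 δ).linc (toMatV (V := Vn n)).toLinearMap))
  have h5 := SAinv.exists (P := fun (q : W) (ab : E2) =>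
    (((∃ g, affK g = toMatV ab.1 ∧ f g = q.1) ∧ ab.1 * ab.2 = 1) ∧ IsY D (Ml q.2)) ∧
      ∀ δ : Δ, P (toMatV (ab.1 * (nexp (dd n) (Ml q.2 (D.c δ)) * alH D δ) * ab.2)) = 0)
      (((h1.inter h2).inter h3).inter h4)
  convert h5 using 1
  ext q
  constructor
  · rintro ⟨p, ⟨h, hp⟩, rfl⟩
    refine ⟨(affL p.1, affL p.1⁻¹), ⟨⟨⟨p.1, affK_toMatV _, rfl⟩, affL_mul_inv _⟩, h⟩, fun δ => ?_⟩
    have h6 := (hA _).1 (hp δ)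
    rw [affK_toMatV, affL_PsiH] at h6
    exact h6
  · rintro ⟨⟨a, b⟩, ⟨⟨⟨g, hg, hgq⟩, hab⟩, h⟩, hδ⟩
    have ha : affL g = a := (toMatV (V := Vn n)).injective hg
    have hb : affL g⁻¹ = b := by
      refine left_inv_eq_right_inv (affL_inv_mul g) ?_
      rw [ha]; exact hab
    refine ⟨(g, q.2), ⟨h, fun δ => ?_⟩, Prod.ext hgq rfl⟩
    rw [hA, affK_toMatV, affL_PsiH, ha, hb]
    exact hδ δ
end
end
end

section
noncomputable section
open Topology
section
variable {n : ℕ} {Δ : Type*} [Group Δ] {Z : Subgroup Δ}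

lemma hom_cont {X : Type*} [TopologicalSpace X] {F : X → Δ →* (Vn n ≃ᵃ[ℝ] Vn n)}
    (h : ∀ δ, Continuous fun x => affL (F x δ)) : Continuous F := by
  refine continuous_induced_rng.2 (continuous_pi fun δ => ?_)
  exact affL_inducing.continuous_iff.2 (h δ)

lemma hom_eval (δ : Δ) : Continuous fun ρ : Δ →* (Vn n ≃ᵃ[ℝ] Vn n) => affL (ρ δ) := by
  have h1 : Continuous fun ρ : Δ →* (Vn n ≃ᵃ[ℝ] Vn n) => (ρ : Δ → (Vn n ≃ᵃ[ℝ] Vn n)) :=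
    continuous_induced_dom
  exact affL_continuous.comp ((continuous_apply δ).comp h1)

lemma phiOf_cont (D : GData n Δ Z) (v : Vn n) :
    Continuous fun ρ : Δ →* (Vn n ≃ᵃ[ℝ] Vn n) => phiOf D ρ v := by
  have h1 : Continuous fun (ρ : Δ →* (Vn n ≃ᵃ[ℝ] Vn n)) (i : Fin n) =>
      nlog (dimE (Vn n)) (affL (tauOf D ρ (Multiplicative.ofAdd (Pi.single i 1))) - 1) := by
    refine continuous_pi fun i => (nlog_cont _).comp ?_
    exact (hom_eval _).sub continuous_const
  exact (Ml_cont v).comp h1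

lemma rbar_cont (D : GData n Δ Z) (δ : Δ) :
    Continuous fun ρ : Δ →* (Vn n ≃ᵃ[ℝ] Vn n) => rbar D ρ δ :=
  ((nexp_continuous _).comp (phiOf_cont D _).neg).mul (hom_eval δ)

variable [Fintype (Δ ⧸ Z)]

lemma xhat_cont (D : GData n Δ Z) :
    Continuous fun ρ : Δ →* (Vn n ≃ᵃ[ℝ] Vn n) => xhat D ρ := by
  have h1 : ∀ q : Δ ⧸ Z, Continuous fun ρ : Δ →* (Vn n ≃ᵃ[ℝ] Vn n) =>
      rbar D ρ q.out (0, 1) := fun q => (rbar_cont D _).clm_apply continuous_const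
  have h2 : Continuous fun ρ : Δ →* (Vn n ≃ᵃ[ℝ] Vn n) =>
      ∑ q : Δ ⧸ Z, rbar D ρ q.out (0, 1) := continuous_finsetSum _ fun q _ => h1 q
  exact h2.const_smul ((Fintype.card (Δ ⧸ Z) : ℝ)⁻¹)

lemma thL_cont (D : GData n Δ Z) :
    Continuous fun ρ : Δ →* (Vn n ≃ᵃ[ℝ] Vn n) => thL (phiOf D ρ) (xhat D ρ) := by
  rw [continuous_clm_apply]
  intro y
  simp only [thL_apply]
  exact ((phiOf_cont D y.1).clm_apply (xhat_cont D)).add ((xhat_cont D).const_smul y.2)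

lemma thOf_cont (D : GData n Δ Z) {X : Type*} [TopologicalSpace X]
    {F : X → Δ →* (Vn n ≃ᵃ[ℝ] Vn n)} (hF : Continuous F) (hC : ∀ x, Cr (F x)) :
    Continuous fun x => thOf D (F x) := by
  rw [affL_inducing.continuous_iff]
  have h1 : (affL ∘ fun x => thOf D (F x)) = fun x => thL (phiOf D (F x)) (xhat D (F x)) := by
    funext x
    exact thOf_spec D (hC x)
  rw [h1]
  exact (thL_cont D).comp hF

lemma MOf_cont (D : GData n Δ Z) {X : Type*} [TopologicalSpace X]
    {F : X → Δ →* (Vn n ≃ᵃ[ℝ] Vn n)} (hF : Continuous F) (hC : ∀ x, Cr (F x)) :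
    Continuous fun x => MOf D (F x) := by
  refine continuous_pi fun i => ?_
  have h1 := thOf_cont D hF hC
  have h2 : Continuous fun x => affL (thOf D (F x)) := affL_continuous.comp h1
  have h3 : Continuous fun x => affL (thOf D (F x))⁻¹ := affL_continuous.comp h1.inv
  have h4 : Continuous fun x => phiOf D (F x) (bV n i) := (phiOf_cont D _).comp hF
  exact (h3.mul h4).mul h2

lemma f_thOf {D : GData n Δ Z} (hfi : Z.FiniteIndex) {φ : Vn n →ₗ[ℝ] EndV (Vn n)} (h : IsY D φ)
    (θ : Vn n ≃ᵃ[ℝ] Vn n) (A : Subgroup (Vn n ≃ᵃ[ℝ] Vn n)) (P : MatV (Vn n) → ℝ)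
    (hP : P ∈ PolyAlg (MatV (Vn n))) (hA : ∀ g, g ∈ A ↔ P (affK g) = 0)
    (hin : ∀ δ, PsiH h θ δ ∈ A) : thOf D (PsiH h θ) * θ⁻¹ ∈ A := by
  obtain ⟨v, hv⟩ := th_Psi hfi h θ
  refine unip_mem h θ A P hP hA hin _ v ?_
  rw [map_mul affL, hv]

lemma PsiH_conj {D : GData n Δ Z} {φ : Vn n →ₗ[ℝ] EndV (Vn n)} (h : IsY D φ)
    (a θ : Vn n ≃ᵃ[ℝ] Vn n) (δ : Δ) : PsiH h (a * θ) δ = a * PsiH h θ δ * a⁻¹ := by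
  rw [PsiH_apply, PsiH_apply, mul_inv_rev]
  simp only [mul_assoc]

lemma homC_Cr {A : Subgroup (Vn n ≃ᵃ[ℝ] Vn n)} (ρ : homC A Δ) : Cr ρ.1 := ⟨ρ.2.1, ρ.2.2.2⟩

/-- the parametrisation -/
def PsiX (D : GData n Δ Z) (hfi : Z.FiniteIndex) (A : Subgroup (Vn n ≃ᵃ[ℝ] Vn n)) (p : Xh D A) :
    homC A Δ :=
  ⟨PsiH p.2.choose p.1.1, (PsiH_cryst hfi _ _).1, p.2.choose_spec, (PsiH_cryst hfi _ _).2⟩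

lemma PsiX_val (D : GData n Δ Z) (hfi : Z.FiniteIndex) (A : Subgroup (Vn n ≃ᵃ[ℝ] Vn n))
    (θ : Vn n ≃ᵃ[ℝ] Vn n) (M : Fin n → EndV (Vn n)) (hp : (θ, M) ∈ Xh D A)
    (h : IsY D (Ml M)) : (PsiX D hfi A ⟨(θ, M), hp⟩).1 = PsiH h θ := rfl

lemma PsiX_cont (D : GData n Δ Z) (hfi : Z.FiniteIndex) (A : Subgroup (Vn n ≃ᵃ[ℝ] Vn n)) :
    Continuous (PsiX D hfi A) := by
  refine Continuous.subtype_mk (hom_cont fun δ => ?_) _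
  simp only [affL_PsiH]
  have c1 : Continuous fun p : Xh D A => affL p.1.1 :=
    affL_continuous.comp (continuous_fst.comp continuous_subtype_val)
  have c2 : Continuous fun p : Xh D A => affL p.1.1⁻¹ :=
    affL_continuous.comp (continuous_fst.comp continuous_subtype_val).inv
  have c3 : Continuous fun p : Xh D A => nexp (dd n) (Ml p.1.2 (D.c δ)) :=
    (nexp_continuous _).comp ((Ml_cont _).comp (continuous_snd.comp continuous_subtype_val))
  exact (c1.mul (c3.mul continuous_const)).mul c2

lemma PsiX_surj (D : GData n Δ Z) (hfi : Z.FiniteIndex) (A : Subgroup (Vn n ≃ᵃ[ℝ] Vn n)) :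
    Function.Surjective (PsiX D hfi A) := by
  intro ρ
  have h0 : IsY D (Ml (MOf D ρ.1)) := MOf_isY D (homC_Cr ρ)
  have h1 : PsiH h0 (thOf D ρ.1) = ρ.1 := PsiH_NF D (homC_Cr ρ)
  have h2 : ∀ δ, PsiH h0 (thOf D ρ.1) δ ∈ A := by
    rw [h1]
    exact ρ.2.2.1
  generalize thOf D ρ.1 = θ at *
  generalize MOf D ρ.1 = M at *
  have hp : (θ, M) ∈ Xh D A := ⟨h0, h2⟩
  exact ⟨⟨(θ, M), hp⟩, Subtype.ext ((PsiX_val D hfi A θ M hp h0).trans h1)⟩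

/-- the invariant map -/
def PhiX (D : GData n Δ Z) {A : Subgroup (Vn n ≃ᵃ[ℝ] Vn n)} {Y : Type*}
    (f : (Vn n ≃ᵃ[ℝ] Vn n) → Y) (ρ : homC A Δ) : Y × (Fin n → EndV (Vn n)) :=
  (f (thOf D ρ.1), MOf D ρ.1)

lemma PhiX_cont (D : GData n Δ Z) {A : Subgroup (Vn n ≃ᵃ[ℝ] Vn n)} {Y : Type*} [TopologicalSpace Y]
    (f : (Vn n ≃ᵃ[ℝ] Vn n) → Y) (hf : Continuous f) :
    Continuous (PhiX D f : homC A Δ → Y × (Fin n → EndV (Vn n))) := by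
  have hv : Continuous fun ρ : homC A Δ => ρ.1 := continuous_subtype_val
  have h1 : Continuous fun ρ : homC A Δ => thOf D ρ.1 := thOf_cont D hv homC_Cr
  have h2 : Continuous fun ρ : homC A Δ => MOf D ρ.1 := MOf_cont D hv homC_Cr
  exact (hf.comp h1).prodMk h2

lemma PhiX_PsiX (D : GData n Δ Z) (hfi : Z.FiniteIndex) (A : Subgroup (Vn n ≃ᵃ[ℝ] Vn n))
    (P : MatV (Vn n) → ℝ)
    (hP : P ∈ PolyAlg (MatV (Vn n))) (hA : ∀ g, g ∈ A ↔ P (affK g) = 0) {Y : Type*}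
    (f : (Vn n ≃ᵃ[ℝ] Vn n) → Y) (hfA : ∀ θ η, f θ = f η ↔ θ * η⁻¹ ∈ A) (p : Xh D A) :
    PhiX D f (PsiX D hfi A p) = (f p.1.1, p.1.2) := by
  have h1 : f (thOf D (PsiX D hfi A p).1) = f p.1.1 :=
    (hfA _ _).2 (f_thOf hfi p.2.choose p.1.1 A P hP hA p.2.choose_spec)
  have h2 : MOf D (PsiX D hfi A p).1 = p.1.2 := MOf_Psi hfi p.2.choose p.1.1
  rw [PhiX, h1, h2]

lemma Xh_sat (D : GData n Δ Z) (A : Subgroup (Vn n ≃ᵃ[ℝ] Vn n)) {θ η : Vn n ≃ᵃ[ℝ] Vn n}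
    {M : Fin n → EndV (Vn n)} (h3 : θ * η⁻¹ ∈ A) (hq : (η, M) ∈ Xh D A) : (θ, M) ∈ Xh D A := by
  obtain ⟨h, hq⟩ := hq
  refine ⟨h, fun δ => ?_⟩
  have h5 := PsiH_conj h (θ * η⁻¹) η δ
  rw [inv_mul_cancel_right] at h5
  have h6 : PsiH h θ δ ∈ A := by
    rw [h5]
    exact A.mul_mem (A.mul_mem h3 (hq δ)) (A.inv_mem h3)
  exact h6

lemma PsiX_conj (D : GData n Δ Z) (hfi : Z.FiniteIndex) (A : Subgroup (Vn n ≃ᵃ[ℝ] Vn n))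
    {θ η : Vn n ≃ᵃ[ℝ] Vn n} {M : Fin n → EndV (Vn n)} (hp : (θ, M) ∈ Xh D A)
    (hq : (η, M) ∈ Xh D A) (δ : Δ) :
    (PsiX D hfi A ⟨(η, M), hq⟩).1 δ = (η * θ⁻¹) * (PsiX D hfi A ⟨(θ, M), hp⟩).1 δ * (η * θ⁻¹)⁻¹ := by
  obtain ⟨h, _⟩ := id hp
  rw [PsiX_val D hfi A η M hq h, PsiX_val D hfi A θ M hp h]
  have h5 := PsiH_conj h (η * θ⁻¹) θ δ
  rw [inv_mul_cancel_right] at h5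
  exact h5

lemma fibres (D : GData n Δ Z) (hfi : Z.FiniteIndex) (A : Subgroup (Vn n ≃ᵃ[ℝ] Vn n))
    (P : MatV (Vn n) → ℝ)
    (hP : P ∈ PolyAlg (MatV (Vn n))) (hA : ∀ g, g ∈ A ↔ P (affK g) = 0) {Y : Type*}
    (f : (Vn n ≃ᵃ[ℝ] Vn n) → Y) (hfA : ∀ θ η, f θ = f η ↔ θ * η⁻¹ ∈ A) (a b : homC A Δ) :
    (conjSetoid A Δ).r a b ↔ PhiX D f a = PhiX D f b := by
  have hΦΨ := PhiX_PsiX D hfi A P hP hA f hfA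
  constructor
  · rintro ⟨g, hg, hab⟩
    obtain ⟨⟨⟨θ, M⟩, hp⟩, rfl⟩ := PsiX_surj D hfi A a
    have hg1 : g * θ * θ⁻¹ = g := by rw [mul_inv_cancel_right]
    have hq : (g * θ, M) ∈ Xh D A := Xh_sat D A (by rw [hg1]; exact hg) hp
    have hb : b = PsiX D hfi A ⟨(g * θ, M), hq⟩ := by
      apply Subtype.ext
      apply MonoidHom.ext
      intro δ
      rw [hab δ, PsiX_conj D hfi A hp hq δ, hg1]
    rw [hb, hΦΨ, hΦΨ]
    have h1 : f (g * θ) = f θ := (hfA _ _).2 (by rw [hg1]; exact hg)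
    rw [h1]
  · intro hab
    obtain ⟨⟨⟨θ, M⟩, hp⟩, rfl⟩ := PsiX_surj D hfi A a
    obtain ⟨⟨⟨η, M'⟩, hq⟩, rfl⟩ := PsiX_surj D hfi A b
    rw [hΦΨ, hΦΨ] at hab
    obtain ⟨e1, e2⟩ := Prod.mk.inj hab
    have e2 : M = M' := e2
    subst e2
    exact ⟨η * θ⁻¹, (hfA _ _).1 e1.symm, fun δ => PsiX_conj D hfi A hp hq δ⟩

theorem main_homeo (D : GData n Δ Z) (hfi : Z.FiniteIndex) (A : Subgroup (Vn n ≃ᵃ[ℝ] Vn n))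
    (P : MatV (Vn n) → ℝ)
    (hP : P ∈ PolyAlg (MatV (Vn n))) (hA : ∀ g, g ∈ A ↔ P (affK g) = 0) {Y : Type*}
    [TopologicalSpace Y]
    (f : (Vn n ≃ᵃ[ℝ] Vn n) → Y) (hf : Continuous f)
    (hfo : IsOpenMap (Set.rangeFactorization f)) (hfA : ∀ θ η, f θ = f η ↔ θ * η⁻¹ ∈ A) :
    Nonempty (Quotient (conjSetoid A Δ) ≃ₜ
      ((fun p : (Vn n ≃ᵃ[ℝ] Vn n) × (Fin n → EndV (Vn n)) => (f p.1, p.2)) '' Xh D A)) := by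
  have hsat : ∀ p q : (Vn n ≃ᵃ[ℝ] Vn n) × (Fin n → EndV (Vn n)),
      f p.1 = f q.1 → p.2 = q.2 → q ∈ Xh D A → p ∈ Xh D A := by
    rintro ⟨θ, M⟩ ⟨η, M'⟩ h1 h2 hq
    have h2 : M = M' := h2
    subst h2
    exact Xh_sat D A ((hfA _ _).1 h1) hq
  exact quot_homeo f hf hfo (Xh D A) hsat (PsiX D hfi A) (PsiX_cont D hfi A) (PsiX_surj D hfi A)
    (PhiX D f) (PhiX_cont D f hf) (PhiX_PsiX D hfi A P hP hA f hfA) _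
    (fibres D hfi A P hP hA f hfA)
end

theorem sa_transport {W Q : Type*} [AddCommGroup W] [Module ℝ W] [TopologicalSpace W]
    [IsTopologicalAddGroup W] [ContinuousSMul ℝ W] [T2Space W] [FiniteDimensional ℝ W] [TopologicalSpace Q] (S : Set W) (hS : SAinv S)
    (h : Nonempty (Q ≃ₜ S)) :
    (∃ (N : ℕ) (S : Set (Fin N → ℝ)), IsSemialgebraicSet S ∧ Nonempty (Q ≃ₜ ↥S)) ∧ T2Space Q := by
  obtain ⟨h⟩ := h
  let e := (Module.finBasis ℝ W).equivFun
  let E : W ≃ₜ (Fin (Module.finrank ℝ W) → ℝ) := e.toContinuousLinearEquiv.toHomeomorph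
  refine ⟨⟨_, e.symm ⁻¹' S, (hS.preimage (PolyMap.lin e.symm.toLinearMap)).semialg, ⟨?_⟩⟩, ?_⟩
  · refine h.trans (E.subtype fun w => ?_)
    change w ∈ S ↔ e.symm (e w) ∈ S
    rw [LinearEquiv.symm_apply_apply]
  · exact h.symm.t2Space

end
end

/-- For a Bieberbach group `Δ` (a finite effective extension of `ℤ^n`) and a
Zariski-closed subgroup `A ≤ Aff(ℝ^n)` acting transitively on `ℝ^n`, the deformation
space `D_c(Δ, A)` is homeomorphic to a semi-algebraic set; in particular it is a
Hausdorff space. -/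
theorem defSpace_of_bieberbach_semialgebraic_and_hausdorff
    (n : ℕ) {Δ : Type*} [Group Δ] (Z : Subgroup Δ) (hnorm : Z.Normal)
    (hfi : Z.FiniteIndex)
    (hiso : Nonempty (↥Z ≃* Multiplicative (Fin n → ℤ)))
    (hc : Subgroup.centralizer (Z : Set Δ) = Z)
    (A : Subgroup (EuclideanSpace ℝ (Fin n) ≃ᵃ[ℝ] EuclideanSpace ℝ (Fin n)))
    (hA : IsZariskiClosedAff
      (A : Set (EuclideanSpace ℝ (Fin n) ≃ᵃ[ℝ] EuclideanSpace ℝ (Fin n))))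
    (htrans : ∀ x y : EuclideanSpace ℝ (Fin n), ∃ a ∈ A, a x = y) :
    (∃ (N : ℕ) (S : Set (Fin N → ℝ)), IsSemialgebraicSet S ∧
      Nonempty ((Quotient (conjSetoid A Δ)) ≃ₜ ↥S)) ∧
    T2Space (Quotient (conjSetoid A Δ)) := by
  obtain ⟨ζ⟩ := hiso
  obtain ⟨D⟩ := exists_gdata Z hnorm ζ hfi hc
  obtain ⟨P, hP, hPA⟩ := exists_P A hA
  have hσ : SigmaCompactSpace (Vn n ≃ᵃ[ℝ] Vn n) := affSigmaCompact
  obtain ⟨N, f, hf, hfo, hfA, hfS⟩ := chevalley affK affK_cont affK_range_SA A P hP hPA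
  have : Finite (Δ ⧸ Z) := Subgroup.finite_quotient_of_finiteIndex
  have : Fintype (Δ ⧸ Z) := Fintype.ofFinite _
  exact sa_transport _ (Xh_SA D A P hP hPA f hfS) (main_homeo D hfi A P hP hPA f hf hfo hfA)

end
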